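/- Let Ω ⊆ ℂⁿ be a bounded domain and let f, g ∈ ℳ. If f ≤ g outside a pluripolar subset of Ω, then S f ≤ S g everywhere on Ω. In particular, if f = g outside a pluripolar set, then S f ≡ S g on Ω. -/

import Mathlib

open Complex Polynomial Filter Set Topology

noncomputable section

/-- `u` is plurisubharmonic on `Ω ⊆ ℂⁿ`: it is upper semicontinuous on `Ω`, takes values in
`[-∞, ∞)`, is not identically `-∞`, and on every closed disc of every complex line contained
in `Ω` it satisfies the maximum principle against real parts of complex polynomials
(an equivalent formulation of subharmonicity of the restriction to every complex line). -/
def IsPSH {n : ℕ} (Ω : Set (Fin n → ℂ)) (u : (Fin n → ℂ) → EReal) : Prop :=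
  UpperSemicontinuousOn u Ω ∧
  (∀ z ∈ Ω, u z ≠ ⊤) ∧
  (∃ z ∈ Ω, u z ≠ ⊥) ∧
  ∀ z ∈ Ω, ∀ w : Fin n → ℂ, ∀ r : ℝ, 0 < r →
    (∀ ζ : ℂ, ‖ζ‖ ≤ r → z + ζ • w ∈ Ω) →
    ∀ p : Polynomial ℂ,
      (∀ ζ : ℂ, ‖ζ‖ = r → u (z + ζ • w) ≤ (((p.eval ζ).re : ℝ) : EReal)) →
      ∀ ζ : ℂ, ‖ζ‖ ≤ r → u (z + ζ • w) ≤ (((p.eval ζ).re : ℝ) : EReal)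

/-- `v` is plurisuperharmonic on `Ω` iff `-v` is plurisubharmonic on `Ω`. -/
def IsPSupH {n : ℕ} (Ω : Set (Fin n → ℂ)) (v : (Fin n → ℂ) → EReal) : Prop :=
  IsPSH Ω (fun z => -(v z))

/-- `f` belongs to the class `ℳ`: `f : Ω → [0, +∞]` admits a plurisuperharmonic
majorant on `Ω`. -/
def MemM {n : ℕ} (Ω : Set (Fin n → ℂ)) (f : (Fin n → ℂ) → EReal) : Prop :=
  (∀ z ∈ Ω, 0 ≤ f z) ∧ ∃ v, IsPSupH Ω v ∧ ∀ z ∈ Ω, f z ≤ v z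

/-- The reduced function `R_λ f`: the pointwise infimum of all plurisuperharmonic
majorants of `(f - λ)⁺ = max {f - λ, 0}` on `Ω`. -/
def Rop {n : ℕ} (Ω : Set (Fin n → ℂ)) (f : (Fin n → ℂ) → EReal) (lam : ℝ)
    (z : Fin n → ℂ) : EReal :=
  sInf { y | ∃ v, IsPSupH Ω v ∧ (∀ ζ ∈ Ω, max (f ζ - (lam : EReal)) 0 ≤ v ζ) ∧ y = v z }

/-- Lower semicontinuous regularization of `g` relative to the set `A`:
`g_*(z) = liminf_{A ∋ ζ → z} g(ζ)`. -/
def lscReg {n : ℕ} (A : Set (Fin n → ℂ)) (g : (Fin n → ℂ) → EReal)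
    (z : Fin n → ℂ) : EReal :=
  liminf g (nhdsWithin z A)

/-- Upper semicontinuous regularization of `g` relative to the set `A`:
`g*(z) = limsup_{A ∋ ζ → z} g(ζ)`. -/
def uscReg {n : ℕ} (A : Set (Fin n → ℂ)) (g : (Fin n → ℂ) → EReal)
    (z : Fin n → ℂ) : EReal :=
  limsup g (nhdsWithin z A)

/-- `S_λ f`: the lower semicontinuous regularization of `R_λ f` on `Ω`. -/
def Slam {n : ℕ} (Ω : Set (Fin n → ℂ)) (f : (Fin n → ℂ) → EReal) (lam : ℝ) :
    (Fin n → ℂ) → EReal :=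
  lscReg Ω (Rop Ω f lam)

/-- The operator `S`: the lower semicontinuous regularization of
`lim_{λ → ∞} S_λ f`; since `λ ↦ S_λ f` is decreasing on `λ ≥ 0`, this limit is the
infimum over `λ ≥ 0`. -/
def Sop {n : ℕ} (Ω : Set (Fin n → ℂ)) (f : (Fin n → ℂ) → EReal) :
    (Fin n → ℂ) → EReal :=
  lscReg Ω (fun z => ⨅ (lam : ℝ) (_ : 0 ≤ lam), Slam Ω f lam z)

/-- `f` is tame on `Ω` if `S f ≡ 0`. -/
def Tame {n : ℕ} (Ω : Set (Fin n → ℂ)) (f : (Fin n → ℂ) → EReal) : Prop :=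
  ∀ z ∈ Ω, Sop Ω f z = 0

/-- `E` is a pluripolar subset of `Ω`: `E ⊆ {w = -∞}` for some plurisubharmonic `w` on `Ω`. -/
def Pluripolar {n : ℕ} (Ω : Set (Fin n → ℂ)) (E : Set (Fin n → ℂ)) : Prop :=
  E ⊆ Ω ∧ ∃ w, IsPSH Ω w ∧ ∀ z ∈ E, w z = ⊥

section

open MeasureTheory
open scoped ENNReal

namespace PshTools

/-- The parametrization of the unit circle by `ℝ / ℤ`. -/
abbrev ec (t : UnitAddCircle) : ℂ := (AddCircle.toCircle t : ℂ)

/-- The normalized rotation invariant measure on the circle. -/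
abbrev nuC : Measure UnitAddCircle := AddCircle.haarAddCircle

lemma norm_ec (t : UnitAddCircle) : ‖ec t‖ = 1 := Circle.norm_coe _

lemma continuous_ec : Continuous ec :=
  continuous_subtype_val.comp AddCircle.continuous_toCircle

lemma exists_ec {ζ : ℂ} (h : ‖ζ‖ = 1) : ∃ t, ec t = ζ := by
  obtain ⟨t, ht⟩ := (AddCircle.homeomorphCircle (T := 1) one_ne_zero).surjective
    ⟨ζ, by simpa [Submonoid.unitSphere] using h⟩
  refine ⟨t, ?_⟩
  have := congrArg (fun z : Circle => (z : ℂ)) ht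
  simpa [AddCircle.homeomorphCircle_apply] using this

lemma fourier_nat (k : ℕ) (t : UnitAddCircle) : fourier (k : ℤ) t = ec t ^ k := by
  rw [fourier_apply, AddCircle.toCircle_zsmul]; simp

lemma fourier_negNat (k : ℕ) (t : UnitAddCircle) :
    fourier (-(k : ℤ)) t = (starRingEnd ℂ) (ec t ^ k) := by
  rw [fourier_neg, fourier_nat]

lemma integrable_of_continuous {F : Type*} [NormedAddCommGroup F] {f : UnitAddCircle → F}
    (hf : Continuous f) : Integrable f nuC :=
  hf.integrable_of_hasCompactSupport (HasCompactSupport.of_compactSpace f)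

lemma integral_ec_pow (k : ℕ) (hk : k ≠ 0) : ∫ t, ec t ^ k ∂nuC = 0 := by
  have := fourierCoeff_fourier (T := 1) (k : ℤ)
  have h0 := congrFun this 0
  rw [fourierCoeff] at h0
  simp only [neg_zero, fourier_zero, one_smul] at h0
  rw [← show (fun t => fourier (k : ℤ) t) = fun t => ec t ^ k from funext (fourier_nat k)]
  rw [h0]
  simp [Pi.single_apply]
  omega

lemma integral_poly (p : ℂ[X]) : ∫ t, p.eval (ec t) ∂nuC = p.eval 0 := by
  induction p using Polynomial.induction_on' with
  | add p q hp hq =>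
    simp only [eval_add]
    rw [integral_add, hp, hq]
    · exact integrable_of_continuous (p.continuous.comp continuous_ec)
    · exact integrable_of_continuous (q.continuous.comp continuous_ec)
  | monomial k a =>
    simp only [eval_monomial]
    rw [integral_const_mul]
    rcases eq_or_ne k 0 with rfl | hk
    · simp
    · rw [integral_ec_pow k hk]; simp [hk]

lemma integral_re_poly (p : ℂ[X]) : ∫ t, (p.eval (ec t)).re ∂nuC = (p.eval 0).re := by
  rw [← integral_poly p]
  exact integral_re (integrable_of_continuous (p.continuous.comp continuous_ec))

lemma exists_poly_approx {g : UnitAddCircle → ℝ} (hg : Continuous g) {ε : ℝ} (hε : 0 < ε) :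
    ∃ p : ℂ[X], ∀ t, |g t - (p.eval (ec t)).re| < ε := by
  have key : ∀ f ∈ Submodule.span ℂ (range (@fourier 1)),
      ∀ a : ℂ, ∃ p : ℂ[X], ∀ t, (a * f t).re = (p.eval (ec t)).re := by
    intro f hf
    induction hf using Submodule.span_induction with
    | mem x hx =>
      obtain ⟨k, rfl⟩ := hx
      obtain ⟨m, rfl | rfl⟩ := k.eq_nat_or_neg
      · exact fun a => ⟨C a * X ^ m, fun t => by rw [fourier_nat]; simp⟩
      · refine fun a => ⟨C ((starRingEnd ℂ) a) * X ^ m, fun t => ?_⟩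
        rw [fourier_negNat, ← Complex.conj_re]
        simp
    | zero => exact fun a => ⟨0, by simp⟩
    | add x y _ _ hx hy =>
      intro a
      obtain ⟨p, hp⟩ := hx a
      obtain ⟨q, hq⟩ := hy a
      refine ⟨p + q, fun t => ?_⟩
      rw [eval_add, Complex.add_re, ← hp, ← hq, ContinuousMap.add_apply, mul_add, Complex.add_re]
    | smul b x _ hx =>
      intro a
      obtain ⟨p, hp⟩ := hx (a * b)
      refine ⟨p, fun t => ?_⟩
      rw [← hp, ContinuousMap.smul_apply, smul_eq_mul, mul_assoc]
  have hmem : (⟨fun t => (g t : ℂ), by fun_prop⟩ : C(UnitAddCircle, ℂ)) ∈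
      (Submodule.span ℂ (range (@fourier 1))).topologicalClosure := by
    rw [span_fourier_closure_eq_top]; trivial
  rw [← SetLike.mem_coe, Submodule.topologicalClosure_coe, Metric.mem_closure_iff] at hmem
  obtain ⟨f, hf, hd⟩ := hmem ε hε
  obtain ⟨p, hp⟩ := key f hf 1
  simp only [one_mul] at hp
  refine ⟨p, fun t => ?_⟩
  rw [← hp]
  have h1 := (ContinuousMap.dist_lt_iff hε).1 hd t
  rw [dist_eq_norm] at h1
  refine lt_of_le_of_lt ?_ h1
  have := Complex.abs_re_le_norm ((g t : ℂ) - f t)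
  simpa using this

/-- Lipschitz regularization of a truncated function, from below. -/
def infConv (F : UnitAddCircle → ℝ≥0∞) (k : ℕ) (t : UnitAddCircle) : ℝ :=
  ⨅ s, ((min (F s) k).toReal + k * dist s t)

lemma infConv_bdd (F : UnitAddCircle → ℝ≥0∞) (k : ℕ) (t : UnitAddCircle) :
    BddBelow (range fun s => ((min (F s) k).toReal + k * dist s t)) :=
  ⟨0, by rintro _ ⟨s, rfl⟩; positivity⟩

lemma infConv_nonneg (F : UnitAddCircle → ℝ≥0∞) (k : ℕ) (t : UnitAddCircle) :
    0 ≤ infConv F k t := le_ciInf fun s => by positivity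

lemma infConv_le (F : UnitAddCircle → ℝ≥0∞) (k : ℕ) (t : UnitAddCircle) :
    ENNReal.ofReal (infConv F k t) ≤ F t := by
  have h1 : infConv F k t ≤ (min (F t) k).toReal := by
    have := ciInf_le (infConv_bdd F k t) t
    simpa [infConv] using this
  refine (ENNReal.ofReal_le_ofReal h1).trans ?_
  rw [ENNReal.ofReal_toReal (by simp)]
  exact min_le_left _ _

lemma infConv_continuous (F : UnitAddCircle → ℝ≥0∞) (k : ℕ) : Continuous (infConv F k) := by
  refine (LipschitzWith.of_le_add_mul (k : NNReal) fun x y => ?_).continuous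
  have : ∀ s, infConv F k x ≤ ((min (F s) k).toReal + k * dist s y) + k * dist x y := by
    intro s
    refine (ciInf_le (infConv_bdd F k x) s).trans ?_
    have : dist s x ≤ dist s y + dist x y := by
      rw [dist_comm x y]; exact dist_triangle _ _ _
    have hk : (0 : ℝ) ≤ k := by positivity
    nlinarith
  have h2 : infConv F k x - k * dist x y ≤ infConv F k y :=
    le_ciInf fun s => by linarith [this s]
  simp only [NNReal.coe_natCast]
  linarith

lemma le_liminf_infConv {F : UnitAddCircle → ℝ≥0∞} (hF : LowerSemicontinuous F)
    (t : UnitAddCircle) :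
    F t ≤ liminf (fun k : ℕ => ENNReal.ofReal (infConv F k t)) atTop := by
  refine le_of_forall_lt fun c hc => ?_
  obtain ⟨c', hcc', hc'⟩ := exists_between hc
  refine hcc'.trans_le ?_
  have hc't : c' ≠ ⊤ := hc'.ne_top
  obtain ⟨δ, hδ, hδF⟩ := Metric.eventually_nhds_iff.1 (hF t c' hc')
  obtain ⟨k₀, hk₀⟩ := exists_nat_ge (max (c'.toReal) (c'.toReal / δ))
  refine le_liminf_of_le (by isBoundedDefault) ?_
  filter_upwards [eventually_ge_atTop k₀] with k hk
  rw [← ENNReal.ofReal_toReal hc't]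
  refine ENNReal.ofReal_le_ofReal (le_ciInf fun s => ?_)
  have hkk : (k₀ : ℝ) ≤ k := by exact_mod_cast hk
  have hk1 : c'.toReal ≤ k := (le_max_left _ _).trans (hk₀.trans hkk)
  have hk2 : c'.toReal / δ ≤ k := (le_max_right _ _).trans (hk₀.trans hkk)
  by_cases hs : dist s t < δ
  · have h1 : c' ≤ min (F s) k := by
      refine le_min (hδF hs).le ?_
      rw [← ENNReal.ofReal_toReal hc't, ← ENNReal.ofReal_natCast]
      exact ENNReal.ofReal_le_ofReal hk1
    have := ENNReal.toReal_mono (by simp) h1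
    have h3 : (0 : ℝ) ≤ k * dist s t := by positivity
    linarith
  · have h1 : c'.toReal ≤ k * δ := (div_le_iff₀ hδ).1 hk2
    have h2 : (k : ℝ) * δ ≤ k * dist s t := by
      have := not_lt.1 hs
      gcongr
    have h3 : 0 ≤ (min (F s) k).toReal := by positivity
    linarith

lemma lintegral_le_of_poly {F : UnitAddCircle → ℝ≥0∞} (hF : LowerSemicontinuous F) {c : ℝ≥0∞}
    (h : ∀ p : ℂ[X], (∀ t, ENNReal.ofReal (p.eval (ec t)).re ≤ F t) →
      ENNReal.ofReal (p.eval 0).re ≤ c) : ∫⁻ t, F t ∂nuC ≤ c := by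
  have hk : ∀ k : ℕ, ∫⁻ t, ENNReal.ofReal (infConv F k t) ∂nuC ≤ c := by
    intro k
    refine ENNReal.le_of_forall_pos_le_add fun ε hε _ => ?_
    obtain ⟨p, hp⟩ := exists_poly_approx (infConv_continuous F k) (ε := ε / 2) (by positivity)
    have hinteg := integrable_of_continuous (infConv_continuous F k)
    rw [← ofReal_integral_eq_lintegral_ofReal hinteg (ae_of_all _ (infConv_nonneg F k))]
    have hq := h (p - C ((ε / 2 : ℝ) : ℂ)) (fun t => by
      refine le_trans (ENNReal.ofReal_le_ofReal ?_) (infConv_le F k t)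
      have := (abs_lt.1 (hp t)).1
      rw [eval_sub, eval_C, Complex.sub_re, Complex.ofReal_re]
      linarith)
    rw [eval_sub, eval_C, Complex.sub_re, Complex.ofReal_re] at hq
    have h2 : ∫ t, infConv F k t ∂nuC ≤ (p.eval 0).re + ε / 2 := by
      have : ∫ t, infConv F k t ∂nuC ≤ ∫ t, ((p.eval (ec t)).re + ε / 2) ∂nuC := by
        refine integral_mono hinteg ?_ fun t => ?_
        · refine integrable_of_continuous ?_
          have : Continuous fun t => p.eval (ec t) := p.continuous.comp continuous_ec
          fun_prop
        · have := (abs_lt.1 (hp t)).2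
          simp only
          linarith
      refine this.trans_eq ?_
      rw [integral_add, integral_re_poly]
      · simp
      · refine integrable_of_continuous ?_
        have : Continuous fun t => p.eval (ec t) := p.continuous.comp continuous_ec
        fun_prop
      · exact integrable_const _
    calc ENNReal.ofReal (∫ t, infConv F k t ∂nuC)
        ≤ ENNReal.ofReal (((p.eval 0).re - ε / 2) + ε) := ENNReal.ofReal_le_ofReal (by linarith)
      _ ≤ ENNReal.ofReal ((p.eval 0).re - ε / 2) + ENNReal.ofReal ε := ENNReal.ofReal_add_le
      _ ≤ c + ε := by
        rw [ENNReal.ofReal_coe_nnreal]; gcongr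
  calc ∫⁻ t, F t ∂nuC ≤ ∫⁻ t, liminf (fun k : ℕ => ENNReal.ofReal (infConv F k t)) atTop ∂nuC :=
        lintegral_mono fun t => le_liminf_infConv hF t
    _ ≤ liminf (fun k : ℕ => ∫⁻ t, ENNReal.ofReal (infConv F k t) ∂nuC) atTop :=
        lintegral_liminf_le fun k => by
          have := (infConv_continuous F k).measurable
          fun_prop
    _ ≤ c := by
        refine (liminf_le_liminf (Eventually.of_forall hk)).trans ?_
        simp

variable {n : ℕ}

lemma lsc_comp {X Y : Type*} [TopologicalSpace X] [TopologicalSpace Y] {v : Y → ℝ≥0∞}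
    (hv : LowerSemicontinuous v) {g : X → Y} (hg : Continuous g) :
    LowerSemicontinuous fun x => v (g x) :=
  fun x c hc => hg.continuousAt.eventually (hv (g x) c hc)

/-- The closed disc `z + ζ w`, `‖ζ‖ ≤ 1`, lies in `Ω`. -/
def DiscIn (Ω : Set (Fin n → ℂ)) (z w : Fin n → ℂ) : Prop :=
  ∀ ζ : ℂ, ‖ζ‖ ≤ 1 → z + ζ • w ∈ Ω

/-- Minimum principle against real parts of polynomials, for nonnegative functions. -/
def PolySup (Ω : Set (Fin n → ℂ)) (v : (Fin n → ℂ) → ℝ≥0∞) : Prop :=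
  ∀ z w, DiscIn Ω z w → ∀ p : ℂ[X],
    (∀ ζ : ℂ, ‖ζ‖ = 1 → ENNReal.ofReal (p.eval ζ).re ≤ v (z + ζ • w)) →
    ∀ ζ : ℂ, ‖ζ‖ ≤ 1 → ENNReal.ofReal (p.eval ζ).re ≤ v (z + ζ • w)

/-- Super mean value inequality on circles. -/
def CircMean (Ω : Set (Fin n → ℂ)) (v : (Fin n → ℂ) → ℝ≥0∞) : Prop :=
  ∀ z w, DiscIn Ω z w → ∫⁻ t, v (z + ec t • w) ∂nuC ≤ v z

lemma PolySup.circMean {Ω : Set (Fin n → ℂ)} {v : (Fin n → ℂ) → ℝ≥0∞}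
    (hv : LowerSemicontinuous v) (h : PolySup Ω v) : CircMean Ω v := by
  intro z w hd
  refine lintegral_le_of_poly ?_ fun p hp => ?_
  · have hc : Continuous fun t : UnitAddCircle => z + ec t • w :=
      continuous_const.add (continuous_ec.smul continuous_const)
    exact lsc_comp hv hc
  · have := h z w hd p (fun ζ hζ => by
      obtain ⟨t, rfl⟩ := exists_ec hζ
      exact hp t) 0 (by simp)
    simpa using this

lemma CircMean.polySup {Ω : Set (Fin n → ℂ)} {v : (Fin n → ℂ) → ℝ≥0∞}
    (hv : LowerSemicontinuous v) (h : CircMean Ω v) : PolySup Ω v := by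
  intro z w hd p hp ζ₀ hζ₀
  by_contra! hlt
  obtain ⟨K, hK⟩ : ∃ K : ℝ, ∀ ζ ∈ Metric.closedBall (0 : ℂ) 1, ‖p.eval ζ‖ ≤ K :=
    (isCompact_closedBall (0 : ℂ) 1).exists_bound_of_continuousOn p.continuous.continuousOn
  have hKre : ∀ ζ : ℂ, ‖ζ‖ ≤ 1 → (p.eval ζ).re ≤ K := fun ζ hζ =>
    (Complex.re_le_norm _).trans (hK ζ (by simpa using hζ))
  set G : ℂ → ℝ≥0∞ := fun ζ => v (z + ζ • w) + ENNReal.ofReal (K - (p.eval ζ).re) with hG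
  have hvc : LowerSemicontinuous fun ζ : ℂ => v (z + ζ • w) :=
    lsc_comp hv (by fun_prop : Continuous fun ζ : ℂ => z + ζ • w)
  have hpc : Continuous fun ζ : ℂ => ENNReal.ofReal (K - (p.eval ζ).re) := by
    have := p.continuous
    exact ENNReal.continuous_ofReal.comp (by fun_prop)
  have hGl : LowerSemicontinuous G := hvc.add hpc.lowerSemicontinuous
  have hbd : ∀ ζ : ℂ, ‖ζ‖ = 1 → ENNReal.ofReal K ≤ G ζ := by
    intro ζ hζ
    calc ENNReal.ofReal K = ENNReal.ofReal ((p.eval ζ).re + (K - (p.eval ζ).re)) := by congr 1; ring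
      _ ≤ _ := ENNReal.ofReal_add_le
      _ ≤ _ := by simp only [hG]; gcongr; exact hp ζ hζ
  have hpos : 0 < (p.eval ζ₀).re := by
    by_contra! hneg
    rw [ENNReal.ofReal_of_nonpos hneg] at hlt
    exact not_lt_zero hlt
  have h0 : G ζ₀ < ENNReal.ofReal K := by
    have : ENNReal.ofReal K
        = ENNReal.ofReal (p.eval ζ₀).re + ENNReal.ofReal (K - (p.eval ζ₀).re) := by
      rw [← ENNReal.ofReal_add hpos.le (by linarith [hKre ζ₀ hζ₀])]; congr 1; ring
    rw [this]
    exact ENNReal.add_lt_add_right ENNReal.ofReal_ne_top hlt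
  obtain ⟨ζ₁, hζ₁, hmin⟩ := (hGl.lowerSemicontinuousOn _).exists_isMinOn
    (⟨ζ₀, by simpa using hζ₀⟩ : (Metric.closedBall (0 : ℂ) 1).Nonempty)
    (isCompact_closedBall (0 : ℂ) 1)
  have hm : G ζ₁ < ENNReal.ofReal K :=
    (isMinOn_iff.1 hmin ζ₀ (by simpa using hζ₀)).trans_lt h0
  have hζ₁' : ‖ζ₁‖ ≤ 1 := by simpa using hζ₁
  have hlt1 : ‖ζ₁‖ < 1 := by
    refine lt_of_le_of_ne hζ₁' fun he => ?_
    exact absurd (hbd ζ₁ he) (not_le.2 hm)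
  set R : ℝ := 1 - ‖ζ₁‖ with hR
  have hR0 : 0 < R := by linarith
  have hin : ∀ ξ : ℂ, ‖ξ‖ ≤ 1 → ‖ζ₁ + ξ * R‖ ≤ 1 := by
    intro ξ hξ
    calc ‖ζ₁ + ξ * R‖ ≤ ‖ζ₁‖ + ‖ξ * R‖ := norm_add_le _ _
      _ = ‖ζ₁‖ + ‖ξ‖ * R := by rw [norm_mul, Complex.norm_real, Real.norm_of_nonneg hR0.le]
      _ ≤ ‖ζ₁‖ + 1 * R := by gcongr
      _ = 1 := by rw [hR]; ring
  have hcirc := h (z + ζ₁ • w) ((R : ℂ) • w) (fun ξ hξ => by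
    have := hd (ζ₁ + ξ * R) (hin ξ hξ)
    rwa [add_smul, mul_smul, ← add_assoc] at this)
  have hpm : ∫⁻ t, ENNReal.ofReal (K - (p.eval (ζ₁ + ec t * R)).re) ∂nuC
      = ENNReal.ofReal (K - (p.eval ζ₁).re) := by
    have hc : Continuous fun t => K - (p.eval (ζ₁ + ec t * R)).re := by
      have := p.continuous.comp (continuous_const.add (continuous_ec.mul continuous_const) :
        Continuous fun t => ζ₁ + ec t * (R : ℂ))
      exact continuous_const.sub (Complex.continuous_re.comp this)
    rw [← ofReal_integral_eq_lintegral_ofReal (integrable_of_continuous hc)]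
    · have := integral_re_poly (C (K : ℂ) - p.comp (C ζ₁ + X * C (R : ℂ)))
      simp only [eval_sub, eval_comp, eval_add, eval_C, eval_mul, eval_X, Complex.sub_re,
        Complex.ofReal_re, zero_mul, add_zero] at this
      rw [this]
    · refine ae_of_all _ fun t => ?_
      have := hKre _ (hin (ec t) (norm_ec t).le)
      simp only [Pi.zero_apply]
      linarith
  have hcl : Continuous fun t => ζ₁ + ec t * (R : ℂ) :=
    continuous_const.add (continuous_ec.mul continuous_const)
  have hGc : LowerSemicontinuous fun t => G (ζ₁ + ec t * R) := lsc_comp hGl hcl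
  have hGint : ∫⁻ t, G (ζ₁ + ec t * R) ∂nuC ≤ G ζ₁ := by
    simp only [hG]
    have hmeas : Measurable fun t => ENNReal.ofReal (K - (p.eval (ζ₁ + ec t * R)).re) :=
      (hpc.comp hcl).measurable
    rw [lintegral_add_right _ hmeas, hpm]
    gcongr
    simpa only [add_smul, mul_smul, ← add_assoc] using hcirc
  have hge : ∀ t, G ζ₁ ≤ G (ζ₁ + ec t * R) := fun t =>
    isMinOn_iff.1 hmin _ (by simpa using hin (ec t) (norm_ec t).le)
  have hae : (fun _ => G ζ₁) =ᵐ[nuC] fun t => G (ζ₁ + ec t * R) := by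
    refine ae_eq_of_ae_le_of_lintegral_le (ae_of_all _ hge) ?_ hGc.measurable.aemeasurable ?_
    · simpa using hm.ne_top
    · simpa using hGint
  obtain ⟨η, hη1, hη2⟩ : ∃ η : ℂ, ‖η‖ = 1 ∧ ‖ζ₁ + η * R‖ = 1 := by
    rcases eq_or_ne ζ₁ 0 with h0 | h0
    · exact ⟨1, by simp, by simp [h0, hR]⟩
    · have hn : ‖ζ₁‖ ≠ 0 := norm_ne_zero_iff.2 h0
      refine ⟨ζ₁ / ‖ζ₁‖, by simp [hn], ?_⟩
      have : ζ₁ + ζ₁ / ‖ζ₁‖ * R = ζ₁ / ‖ζ₁‖ := by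
        have hn' : (‖ζ₁‖ : ℂ) ≠ 0 := by exact_mod_cast hn
        rw [hR]; push_cast; field_simp; ring
      rw [this]; simp [hn]
  obtain ⟨t₀, rfl⟩ := exists_ec hη1
  have hopen : IsOpen {t | G ζ₁ < G (ζ₁ + ec t * R)} := hGc.isOpen_preimage (G ζ₁)
  have hpos' := hopen.measure_pos nuC ⟨t₀, hm.trans_le (hbd _ hη2)⟩
  have hzero : nuC {t | G ζ₁ < G (ζ₁ + ec t * R)} = 0 := by
    refine measure_mono_null ?_ hae
    intro t ht
    exact ht.ne
  exact absurd hzero hpos'.ne'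

/-- The `[0, ∞]`-valued version of a nonnegative extended real function, extended by zero
outside `Ω`. -/
def toE (Ω : Set (Fin n → ℂ)) (v : (Fin n → ℂ) → EReal) : (Fin n → ℂ) → ℝ≥0∞ :=
  Ω.indicator fun z => (v z).toENNReal

lemma coe_toE {Ω : Set (Fin n → ℂ)} {v : (Fin n → ℂ) → EReal} {z : Fin n → ℂ}
    (hz : z ∈ Ω) (h : 0 ≤ v z) : ((toE Ω v z : ℝ≥0∞) : EReal) = v z := by
  rw [toE, indicator_of_mem hz, EReal.coe_toENNReal h]

lemma neg_le_coe_iff (x : ℝ≥0∞) (r : ℝ) :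
    -(x : EReal) ≤ (r : EReal) ↔ ENNReal.ofReal (-r) ≤ x := by
  rw [EReal.neg_le, ← EReal.coe_neg, ← EReal.coe_ennreal_le_coe_ennreal_iff,
    EReal.coe_ennreal_ofReal]
  have hm : ((max (-r) 0 : ℝ) : EReal) = max ((-r : ℝ) : EReal) 0 :=
    EReal.coe_strictMono.monotone.map_max
  rw [hm]
  constructor
  · intro h; exact max_le h (EReal.coe_ennreal_nonneg x)
  · intro h; exact (le_max_left _ _).trans h

lemma lsc_toE {Ω : Set (Fin n → ℂ)} (hΩ : IsOpen Ω) {v : (Fin n → ℂ) → EReal}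
    (hv : IsPSupH Ω v) (h0 : ∀ z ∈ Ω, 0 ≤ v z) : LowerSemicontinuous (toE Ω v) := by
  intro z c hc
  by_cases hz : z ∈ Ω
  · have hc' : (c : EReal) < v z := by
      rw [← coe_toE hz (h0 z hz)]; exact_mod_cast hc
    have := hv.1 z hz (-(c : EReal)) (EReal.neg_lt_neg_iff.2 hc')
    rw [hΩ.nhdsWithin_eq hz] at this
    filter_upwards [this, hΩ.mem_nhds hz] with y hy hyΩ
    have hy' : (c : EReal) < v y := EReal.neg_lt_neg_iff.1 hy
    rw [← coe_toE hyΩ (h0 y hyΩ)] at hy'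
    exact_mod_cast hy'
  · simp [toE, hz] at hc

lemma polySup_toE {Ω : Set (Fin n → ℂ)} {v : (Fin n → ℂ) → EReal}
    (hv : IsPSupH Ω v) (h0 : ∀ z ∈ Ω, 0 ≤ v z) : PolySup Ω (toE Ω v) := by
  intro z w hd p hp
  have hz : z ∈ Ω := by simpa using hd 0 (by simp)
  have key : ∀ ζ : ℂ, ‖ζ‖ ≤ 1 → (-(v (z + ζ • w)) ≤ ((((-p).eval ζ).re : ℝ) : EReal) ↔
      ENNReal.ofReal (p.eval ζ).re ≤ toE Ω v (z + ζ • w)) := by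
    intro ζ hζ
    rw [← coe_toE (hd ζ hζ) (h0 _ (hd ζ hζ)), neg_le_coe_iff]
    simp
  intro ζ hζ
  exact (key ζ hζ).1 (hv.2.2.2 z hz w 1 one_pos hd (-p)
    (fun ξ hξ => (key ξ hξ.le).2 (hp ξ hξ)) ζ hζ)

lemma exists_toE_ne_top {Ω : Set (Fin n → ℂ)} {v : (Fin n → ℂ) → EReal}
    (hv : IsPSupH Ω v) (h0 : ∀ z ∈ Ω, 0 ≤ v z) : ∃ z ∈ Ω, toE Ω v z ≠ ⊤ := by
  obtain ⟨z, hz, h⟩ := hv.2.2.1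
  refine ⟨z, hz, fun ht => h ?_⟩
  simp only
  rw [← coe_toE hz (h0 z hz), ht]
  rfl

lemma isPSupH_coe {Ω : Set (Fin n → ℂ)} {V : (Fin n → ℂ) → ℝ≥0∞}
    (hV : LowerSemicontinuous V) (hP : PolySup Ω V) (hf : ∃ z ∈ Ω, V z ≠ ⊤) :
    IsPSupH Ω fun z => (V z : EReal) := by
  refine ⟨?_, ?_, ?_, ?_⟩
  · intro z _ y hy
    refine Filter.Eventually.filter_mono nhdsWithin_le_nhds ?_
    rcases lt_or_ge 0 y with h0 | h0
    · refine Eventually.of_forall fun x => lt_of_le_of_lt ?_ h0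
      simpa using EReal.coe_ennreal_nonneg (V x)
    · have h1 : 0 ≤ -y := by simpa using EReal.neg_le_neg_iff.2 h0
      have h2 : ((-y).toENNReal : EReal) = -y := EReal.coe_toENNReal h1
      have h3 : (-y).toENNReal < V z := by
        rw [← EReal.coe_ennreal_lt_coe_ennreal_iff, h2]
        exact EReal.neg_lt_comm.1 hy
      filter_upwards [hV z _ h3] with x hx
      rw [gt_iff_lt, ← EReal.coe_ennreal_lt_coe_ennreal_iff, h2] at hx
      exact EReal.neg_lt_comm.1 hx
  · intro z _ h
    simp [EReal.neg_eq_top_iff] at h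
  · obtain ⟨z, hz, h⟩ := hf
    exact ⟨z, hz, by simpa [EReal.neg_eq_bot_iff] using h⟩
  · intro z _ w r hr hd p hp ζ hζ
    have hr' : (r : ℂ) ≠ 0 := by exact_mod_cast hr.ne'
    have hsm : ∀ ξ : ℂ, z + ξ • (r : ℂ) • w = z + (ξ * r) • w := fun ξ => by rw [mul_smul]
    have hnr : ∀ ξ : ℂ, ‖ξ * r‖ = ‖ξ‖ * r := fun ξ => by
      rw [norm_mul, Complex.norm_real, Real.norm_of_nonneg hr.le]
    have he : ∀ ξ : ℂ, ((-p).comp (C (r : ℂ) * X)).eval ξ = -p.eval (ξ * r) := fun ξ => by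
      rw [eval_comp, eval_neg, eval_mul, eval_C, eval_X, mul_comm]
    have := hP z ((r : ℂ) • w) (fun ξ hξ => by
      rw [hsm]; refine hd _ ?_
      rw [hnr]; nlinarith) ((-p).comp (C (r : ℂ) * X)) (fun ξ hξ => by
        have := (neg_le_coe_iff _ _).1 (hp (ξ * r) (by rw [hnr, hξ, one_mul]))
        rw [hsm, he, Complex.neg_re]
        exact this) (ζ / r) (by
          rw [norm_div, Complex.norm_real, Real.norm_of_nonneg hr.le]
          exact (div_le_one hr).2 hζ)
    rw [hsm, he, div_mul_cancel₀ _ hr', Complex.neg_re] at this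
    exact (neg_le_coe_iff _ _).2 this

/-- Multiplication by a unimodular number preserves Lebesgue measure. -/
lemma measurePreserving_smul_circle (c : Circle) :
    MeasurePreserving (fun y : Fin n → ℂ => (c : ℂ) • y) volume volume := by
  have h1 : MeasurePreserving (fun y : ℂ => (c : ℂ) * y) volume volume :=
    (rotation c).measurePreserving
  exact volume_preserving_pi fun _ => h1

lemma lintegral_ball_smul (c : Circle) (ρ : ℝ) {v : (Fin n → ℂ) → ℝ≥0∞} (hv : Measurable v)
    (z : Fin n → ℂ) :
    ∫⁻ y in Metric.ball 0 ρ, v (z + (c : ℂ) • y) = ∫⁻ y in Metric.ball 0 ρ, v (z + y) := by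
  have h := (measurePreserving_smul_circle (n := n) c).setLIntegral_comp_preimage
    (Metric.isOpen_ball (x := (0 : Fin n → ℂ)) (ε := ρ)).measurableSet
    (f := fun y => v (z + y)) (by fun_prop)
  rw [← h]
  congr 2
  ext y
  simp [norm_smul, Circle.norm_coe c]

lemma lintegral_ball_add (ρ : ℝ) (v : (Fin n → ℂ) → ℝ≥0∞) (z : Fin n → ℂ) :
    ∫⁻ y in Metric.ball 0 ρ, v (z + y) = ∫⁻ y in Metric.ball z ρ, v y := by
  have h := (measurePreserving_add_left volume z).setLIntegral_comp_preimage_emb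
    (measurableEmbedding_addLeft z) v (Metric.ball z ρ)
  rw [← h]
  congr 2
  ext y
  simp [dist_eq_norm]

lemma CircMean.lintegral_ball_le {Ω : Set (Fin n → ℂ)} {v : (Fin n → ℂ) → ℝ≥0∞}
    (hv : Measurable v) (h : CircMean Ω v) {z : Fin n → ℂ} {ρ : ℝ}
    (hΩ : Metric.ball z ρ ⊆ Ω) :
    ∫⁻ y in Metric.ball z ρ, v y ≤ v z * volume (Metric.ball z ρ) := by
  have hcm : Measurable fun q : (Fin n → ℂ) × UnitAddCircle => v (z + ec q.2 • q.1) := by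
    refine hv.comp (Continuous.measurable ?_)
    have := continuous_ec.comp (continuous_snd (X := Fin n → ℂ))
    exact continuous_const.add (this.smul continuous_fst)
  calc ∫⁻ y in Metric.ball z ρ, v y
      = ∫⁻ _ : UnitAddCircle, (∫⁻ y in Metric.ball z ρ, v y) ∂nuC := by simp
    _ = ∫⁻ t : UnitAddCircle, (∫⁻ y in Metric.ball 0 ρ, v (z + ec t • y)) ∂nuC := by
        refine lintegral_congr fun t => ?_
        rw [lintegral_ball_smul _ ρ hv, lintegral_ball_add]
    _ = ∫⁻ y in Metric.ball 0 ρ, (∫⁻ t : UnitAddCircle, v (z + ec t • y) ∂nuC) := by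
        rw [lintegral_lintegral_swap]
        exact (hcm.comp measurable_swap).aemeasurable
    _ ≤ ∫⁻ _ in Metric.ball (0 : Fin n → ℂ) ρ, v z := by
        refine setLIntegral_mono measurable_const fun y hy => h z y fun ζ hζ => hΩ ?_
        rw [mem_ball_zero_iff] at hy
        rw [Metric.mem_ball, dist_eq_norm, add_sub_cancel_left, norm_smul]
        calc ‖ζ‖ * ‖y‖ ≤ 1 * ‖y‖ := by gcongr
          _ < ρ := by simpa using hy
    _ = v z * volume (Metric.ball z ρ) := by
        have := lintegral_ball_add ρ (fun _ => v z) z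
        rw [this, setLIntegral_const]

lemma CircMean.ae_lt_top {Ω : Set (Fin n → ℂ)} (hΩ : IsOpen Ω) (hΩc : IsPreconnected Ω)
    {v : (Fin n → ℂ) → ℝ≥0∞} (hv : Measurable v) (h : CircMean Ω v)
    (hf : ∃ z ∈ Ω, v z ≠ ⊤) : volume (Ω ∩ {z | v z = ⊤}) = 0 := by
  set A : Set (Fin n → ℂ) := {a | ∃ U ∈ 𝓝 a, volume (U ∩ {z | v z = ⊤}) = 0} with hA
  have hAo : IsOpen A := by
    rw [isOpen_iff_mem_nhds]
    rintro a ⟨U, hU, h0⟩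
    filter_upwards [eventually_mem_nhds_iff.2 hU] with b hb
    exact ⟨U, hb, h0⟩
  have hball : ∀ z ρ, 0 < ρ → Metric.ball z ρ ⊆ Ω → v z ≠ ⊤ →
      volume (Metric.ball z ρ ∩ {z | v z = ⊤}) = 0 := by
    intro z ρ _ hz hvz
    have hfin : ∫⁻ y in Metric.ball z ρ, v y ≠ ⊤ :=
      ((h.lintegral_ball_le hv hz).trans_lt
        (ENNReal.mul_lt_top (lt_top_iff_ne_top.2 hvz) measure_ball_lt_top)).ne
    have := MeasureTheory.ae_lt_top hv hfin
    rw [ae_iff, Measure.restrict_apply' measurableSet_ball] at this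
    refine measure_mono_null ?_ this
    rintro y ⟨hy, hy'⟩
    exact ⟨by simpa using hy', hy⟩
  have hsub : Ω ⊆ A := by
    refine hΩc.subset_of_closure_inter_subset hAo (?_ : (Ω ∩ A).Nonempty) (?_ : closure A ∩ Ω ⊆ A)
    · obtain ⟨z, hz, hvz⟩ := hf
      obtain ⟨ρ, hρ, hb⟩ := Metric.isOpen_iff.1 hΩ z hz
      exact ⟨z, hz, _, Metric.ball_mem_nhds z hρ, hball z ρ hρ hb hvz⟩
    · rintro b ⟨hbA, hb⟩
      obtain ⟨ρ, hρ, hbΩ⟩ := Metric.isOpen_iff.1 hΩ b hb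
      obtain ⟨a, ⟨U, hU, hU0⟩, hab⟩ := Metric.mem_closure_iff.1 hbA (ρ / 2) (by positivity)
      have hW : interior U ∩ Metric.ball b (ρ / 2) ∈ 𝓝 a :=
        inter_mem (interior_mem_nhds.2 hU) (Metric.isOpen_ball.mem_nhds (by
          rwa [Metric.mem_ball, dist_comm]))
      have hWo : IsOpen (interior U ∩ Metric.ball b (ρ / 2)) :=
        isOpen_interior.inter Metric.isOpen_ball
      obtain ⟨c, hcW, hc⟩ : ∃ c ∈ interior U ∩ Metric.ball b (ρ / 2), v c ≠ ⊤ := by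
        by_contra! hcon
        have : volume (interior U ∩ Metric.ball b (ρ / 2)) = 0 :=
          measure_mono_null (fun x hx =>
            (⟨interior_subset hx.1, hcon x hx⟩ : x ∈ U ∩ {z | v z = ⊤})) hU0
        exact (hWo.measure_pos volume ⟨a, mem_of_mem_nhds hW⟩).ne' this
      have hcb : dist c b < ρ / 2 := hcW.2
      refine ⟨Metric.ball c (ρ / 2), Metric.isOpen_ball.mem_nhds (by
        rwa [Metric.mem_ball, dist_comm]), hball c _ (by positivity) ?_ hc⟩
      refine Subset.trans ?_ hbΩ
      exact Metric.ball_subset_ball' (by linarith)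
  refine measure_null_of_locally_null _ fun x hx => ?_
  obtain ⟨U, hU, hU0⟩ := hsub hx.1
  exact ⟨U ∩ (Ω ∩ {z | v z = ⊤}), inter_mem (mem_nhdsWithin_of_mem_nhds hU) self_mem_nhdsWithin,
    measure_mono_null (fun y hy => (⟨hy.1, hy.2.2⟩ : y ∈ U ∩ {z | v z = ⊤})) hU0⟩

lemma measurable_disc {v : (Fin n → ℂ) → ℝ≥0∞} (hv : Measurable v) (z w : Fin n → ℂ) :
    Measurable fun t : UnitAddCircle => v (z + ec t • w) :=
  hv.comp (continuous_const.add (continuous_ec.smul continuous_const)).measurable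

lemma CircMean.add {Ω : Set (Fin n → ℂ)} {u v : (Fin n → ℂ) → ℝ≥0∞} (hu : CircMean Ω u)
    (hv : CircMean Ω v) (hum : Measurable u) : CircMean Ω fun z => u z + v z := by
  intro z w hd
  rw [lintegral_add_left (measurable_disc hum z w)]
  exact add_le_add (hu z w hd) (hv z w hd)

lemma CircMean.const_mul {Ω : Set (Fin n → ℂ)} {v : (Fin n → ℂ) → ℝ≥0∞} (hv : CircMean Ω v)
    (hvm : Measurable v) (c : ℝ≥0∞) : CircMean Ω fun z => c * v z := by
  intro z w hd
  rw [lintegral_const_mul _ (measurable_disc hvm z w)]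
  beta_reduce
  gcongr
  exact hv z w hd

lemma CircMean.tsum {ι : Type*} [Countable ι] {Ω : Set (Fin n → ℂ)}
    {v : ι → (Fin n → ℂ) → ℝ≥0∞} (hv : ∀ i, CircMean Ω (v i)) (hvm : ∀ i, Measurable (v i)) :
    CircMean Ω fun z => ∑' i, v i z := by
  intro z w hd
  rw [lintegral_tsum fun i => (measurable_disc (hvm i) z w).aemeasurable]
  exact ENNReal.tsum_le_tsum fun i => hv i z w hd

lemma CircMean.min_const {Ω : Set (Fin n → ℂ)} {v : (Fin n → ℂ) → ℝ≥0∞} (hv : CircMean Ω v)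
    (c : ℝ≥0∞) : CircMean Ω fun z => min (v z) c := by
  intro z w hd
  refine le_min ((lintegral_mono fun t => min_le_left _ _).trans (hv z w hd)) ?_
  exact (lintegral_mono fun t => min_le_right _ _).trans (by simp)

lemma lsc_const_mul {v : (Fin n → ℂ) → ℝ≥0∞} (hv : LowerSemicontinuous v) {c : ℝ≥0∞}
    (hc : c ≠ ⊤) : LowerSemicontinuous fun z => c * v z :=
  (ENNReal.continuous_const_mul hc).comp_lowerSemicontinuous hv
    fun a b hab => by beta_reduce; gcongr

/-- The regularized limit inferior of a sequence of functions. -/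
def liminfReg (V : ℕ → (Fin n → ℂ) → ℝ≥0∞) (z : Fin n → ℂ) : ℝ≥0∞ :=
  liminf (fun p : ℕ × (Fin n → ℂ) => V p.1 p.2) (atTop ×ˢ 𝓝 z)

lemma lt_liminfReg_iff {V : ℕ → (Fin n → ℂ) → ℝ≥0∞} {z : Fin n → ℂ} {c : ℝ≥0∞}
    (h : c < liminfReg V z) : ∃ c', c < c' ∧ ∃ N, ∃ U ∈ 𝓝 z, ∀ l ≥ N, ∀ y ∈ U, c' ≤ V l y := by
  obtain ⟨c', hc, hc'⟩ := exists_between h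
  refine ⟨c', hc, ?_⟩
  have := eventually_lt_of_lt_liminf hc'
  rw [(atTop_basis.prod (𝓝 z).basis_sets).eventually_iff] at this
  obtain ⟨⟨N, U⟩, ⟨-, hU⟩, hh⟩ := this
  exact ⟨N, U, hU, fun l hl y hy => (hh (x := (l, y)) ⟨hl, hy⟩).le⟩

lemma le_liminfReg {V : ℕ → (Fin n → ℂ) → ℝ≥0∞} {z : Fin n → ℂ} {c : ℝ≥0∞} {N : ℕ}
    {U : Set (Fin n → ℂ)} (hU : U ∈ 𝓝 z) (h : ∀ l ≥ N, ∀ y ∈ U, c ≤ V l y) :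
    c ≤ liminfReg V z := by
  refine le_liminf_of_le (by isBoundedDefault) ?_
  rw [(atTop_basis.prod (𝓝 z).basis_sets).eventually_iff]
  exact ⟨(N, U), ⟨trivial, hU⟩, fun x hx => h _ hx.1 _ hx.2⟩

lemma lsc_liminfReg (V : ℕ → (Fin n → ℂ) → ℝ≥0∞) : LowerSemicontinuous (liminfReg V) := by
  intro z c hc
  obtain ⟨c', hcc', N, U, hU, h⟩ := lt_liminfReg_iff hc
  filter_upwards [eventually_mem_nhds_iff.2 hU] with y hy
  exact hcc'.trans_le (le_liminfReg hy h)

lemma liminfReg_le_liminf (V : ℕ → (Fin n → ℂ) → ℝ≥0∞) (z : Fin n → ℂ) :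
    liminfReg V z ≤ liminf (fun l => V l z) atTop := by
  refine le_of_forall_lt fun c hc => ?_
  obtain ⟨c', hcc', N, U, hU, h⟩ := lt_liminfReg_iff hc
  refine hcc'.trans_le (le_liminf_of_le (by isBoundedDefault) ?_)
  filter_upwards [eventually_ge_atTop N] with l hl
  exact h l hl z (mem_of_mem_nhds hU)

/-- The regularized limit inferior of functions satisfying the minimum principle on an open set
satisfies it too. -/
lemma polySup_liminfReg {Ω : Set (Fin n → ℂ)} (hΩ : IsOpen Ω)
    {V : ℕ → (Fin n → ℂ) → ℝ≥0∞} (hV : ∀ l, PolySup Ω (V l)) : PolySup Ω (liminfReg V) := by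
  intro z w hd p hp ζ₀ hζ₀
  refine ENNReal.le_of_forall_pos_le_add fun ε hε _ => ?_
  have hloc : ∀ ζ ∈ Metric.sphere (0 : ℂ) 1, ∃ W ∈ 𝓝 ζ, ∃ U ∈ 𝓝 (0 : Fin n → ℂ), ∃ N : ℕ,
      ∀ l ≥ N, ∀ ξ ∈ W, ∀ y ∈ U, ENNReal.ofReal ((p.eval ξ).re - ε) ≤ V l (z + y + ξ • w) := by
    intro ζ hζ
    have hζ' : ‖ζ‖ = 1 := by simpa using hζ
    have hpc : Continuous fun ξ : ℂ => (p.eval ξ).re :=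
      Complex.continuous_re.comp p.continuous
    by_cases hpos : 0 < (p.eval ζ).re - ε / 2
    · have h1 : ENNReal.ofReal ((p.eval ζ).re - ε / 2) < liminfReg V (z + ζ • w) := by
        refine lt_of_lt_of_le ?_ (hp ζ hζ')
        have : (0 : ℝ) < ε := hε
        exact (ENNReal.ofReal_lt_ofReal_iff (by linarith)).2 (by linarith)
      obtain ⟨c', hcc', N, U, hU, h⟩ := lt_liminfReg_iff h1
      have hc : Continuous fun q : ℂ × (Fin n → ℂ) => z + q.2 + q.1 • w := by fun_prop
      have hc0 : Tendsto (fun q : ℂ × (Fin n → ℂ) => z + q.2 + q.1 • w) (𝓝 ζ ×ˢ 𝓝 0)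
          (𝓝 (z + ζ • w)) := by
        have := hc.tendsto (ζ, 0)
        rwa [nhds_prod_eq, add_zero] at this
      obtain ⟨W, hW, U', hU', hWU⟩ := Filter.mem_prod_iff.1 (hc0 hU)
      have hW2 : {ξ : ℂ | (p.eval ξ).re < (p.eval ζ).re + ε / 2} ∈ 𝓝 ζ :=
        (isOpen_lt hpc continuous_const).mem_nhds (by
          have : (0 : ℝ) < ε := hε
          simpa using this)
      refine ⟨_, inter_mem hW hW2, U', hU', N, fun l hl ξ hξ y hy => ?_⟩
      refine le_trans ?_ (hcc'.le.trans (h l hl _ (hWU (mk_mem_prod hξ.1 hy))))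
      have := hξ.2
      simp only [mem_ofPred_eq] at this
      exact ENNReal.ofReal_le_ofReal (by linarith)
    · have hW2 : {ξ : ℂ | (p.eval ξ).re < (p.eval ζ).re + ε / 2} ∈ 𝓝 ζ :=
        (isOpen_lt hpc continuous_const).mem_nhds (by
          have : (0 : ℝ) < ε := hε
          simpa using this)
      refine ⟨_, hW2, univ, univ_mem, 0, fun l _ ξ hξ y _ => ?_⟩
      simp only [mem_ofPred_eq] at hξ
      rw [ENNReal.ofReal_of_nonpos (by linarith)]
      exact zero_le
  have hcomp : IsCompact (Metric.sphere (0 : ℂ) 1) := isCompact_sphere _ _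
  obtain ⟨U, hU, N, hUN⟩ : ∃ U ∈ 𝓝 (0 : Fin n → ℂ), ∃ N : ℕ, ∀ l ≥ N,
      ∀ ξ ∈ Metric.sphere (0 : ℂ) 1, ∀ y ∈ U,
        ENNReal.ofReal ((p.eval ξ).re - ε) ≤ V l (z + y + ξ • w) := by
    refine hcomp.induction_on (p := fun S => ∃ U ∈ 𝓝 (0 : Fin n → ℂ), ∃ N : ℕ, ∀ l ≥ N,
      ∀ ξ ∈ S, ∀ y ∈ U, ENNReal.ofReal ((p.eval ξ).re - ε) ≤ V l (z + y + ξ • w)) ?_ ?_ ?_ ?_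
    · exact ⟨univ, univ_mem, 0, by simp⟩
    · rintro s t hst ⟨U, hU, N, h⟩
      exact ⟨U, hU, N, fun l hl ξ hξ => h l hl ξ (hst hξ)⟩
    · rintro s t ⟨U, hU, N, h⟩ ⟨U', hU', N', h'⟩
      refine ⟨U ∩ U', inter_mem hU hU', max N N', fun l hl ξ hξ y hy => ?_⟩
      rcases hξ with hξ | hξ
      · exact h l (le_of_max_le_left hl) ξ hξ y hy.1
      · exact h' l (le_of_max_le_right hl) ξ hξ y hy.2
    · intro ζ hζ
      obtain ⟨W, hW, U, hU, N, h⟩ := hloc ζ hζ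
      exact ⟨W, mem_nhdsWithin_of_mem_nhds hW, U, hU, N, h⟩
  have hdisc : ∀ᶠ y in 𝓝 (0 : Fin n → ℂ), ∀ ξ ∈ Metric.closedBall (0 : ℂ) 1,
      z + y + ξ • w ∈ Ω := by
    refine (isCompact_closedBall (0 : ℂ) 1).eventually_forall_of_forall_eventually
      fun ξ hξ => ?_
    have hc : Continuous fun q : (Fin n → ℂ) × ℂ => z + q.1 + q.2 • w := by fun_prop
    refine hc.continuousAt.eventually (hΩ.mem_nhds ?_)
    simpa using hd ξ (by simpa using hξ)
  have hfin : ENNReal.ofReal ((p.eval ζ₀).re - ε) ≤ liminfReg V (z + ζ₀ • w) := by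
    have hS : {y | y ∈ U ∧ ∀ ξ ∈ Metric.closedBall (0 : ℂ) 1, z + y + ξ • w ∈ Ω} ∈
        𝓝 (0 : Fin n → ℂ) := inter_mem hU hdisc
    have ht : Tendsto (fun x => x - (z + ζ₀ • w)) (𝓝 (z + ζ₀ • w)) (𝓝 0) := by
      have : Continuous fun x => x - (z + ζ₀ • w) := by fun_prop
      simpa using this.tendsto (z + ζ₀ • w)
    refine le_liminfReg (N := N) (ht hS) fun l hl x hx => ?_
    obtain ⟨hx1, hx2⟩ := hx
    have := hV l (z + (x - (z + ζ₀ • w))) w (fun ξ hξ => hx2 ξ (by simpa using hξ))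
      (p - C ((ε : ℝ) : ℂ)) (fun ξ hξ => by
        have := hUN l hl ξ (by simpa using hξ) _ hx1
        simpa using this) ζ₀ hζ₀
    have e : z + (x - (z + ζ₀ • w)) + ζ₀ • w = x := by abel
    rw [e] at this
    simpa using this
  calc ENNReal.ofReal (p.eval ζ₀).re
      = ENNReal.ofReal (((p.eval ζ₀).re - ε) + ε) := by congr 1; ring
    _ ≤ ENNReal.ofReal ((p.eval ζ₀).re - ε) + ENNReal.ofReal ε := ENNReal.ofReal_add_le
    _ ≤ _ := by rw [ENNReal.ofReal_coe_nnreal]; gcongr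

lemma lintegral_liminfReg_le {V : ℕ → (Fin n → ℂ) → ℝ≥0∞} (hV : ∀ l, Measurable (V l))
    (μ : Measure (Fin n → ℂ)) {c : ℝ≥0∞} (hc : ∀ l, ∫⁻ z, V l z ∂μ ≤ c) :
    ∫⁻ z, liminfReg V z ∂μ ≤ c :=
  calc ∫⁻ z, liminfReg V z ∂μ ≤ ∫⁻ z, liminf (fun l => V l z) atTop ∂μ :=
        lintegral_mono fun z => liminfReg_le_liminf V z
    _ ≤ liminf (fun l => ∫⁻ z, V l z ∂μ) atTop := lintegral_liminf_le hV
    _ ≤ c := (liminf_le_liminf (Eventually.of_forall hc)).trans (by simp)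

lemma Rop_nonneg {Ω : Set (Fin n → ℂ)} {g : (Fin n → ℂ) → EReal} {lam : ℝ} {z : Fin n → ℂ}
    (hz : z ∈ Ω) : 0 ≤ Rop Ω g lam z := by
  refine le_sInf ?_
  rintro _ ⟨v, -, hv, rfl⟩
  exact (le_max_right _ _).trans (hv z hz)

theorem Slam_le_of_majorant {Ω : Set (Fin n → ℂ)} (hΩo : IsOpen Ω) (hΩc : IsConnected Ω)
    {f g : (Fin n → ℂ) → EReal} {E : Set (Fin n → ℂ)} (hfg : ∀ z ∈ Ω \ E, f z ≤ g z)
    {V : (Fin n → ℂ) → ℝ≥0∞} (hV : LowerSemicontinuous V) (hVm : CircMean Ω V)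
    (hVE : ∀ z ∈ E, V z = ⊤) (hVf : ∃ z ∈ Ω, V z ≠ ⊤) (lam : ℝ) {z : Fin n → ℂ} (hz : z ∈ Ω) :
    Slam Ω f lam z ≤ Slam Ω g lam z := by
  refine le_of_forall_lt fun c hc => ?_
  obtain ⟨c', hcc', hc'⟩ := exists_between hc
  refine hcc'.trans_le ?_
  have hev := eventually_lt_of_lt_liminf hc'
  rw [hΩo.nhdsWithin_eq hz] at hev
  obtain ⟨ρ, hρ, hball⟩ := Metric.mem_nhds_iff.1 (inter_mem hev (hΩo.mem_nhds hz))
  have hVnull := hVm.ae_lt_top hΩo hΩc.isPreconnected hV.measurable hVf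
  suffices H : ∀ y ∈ Metric.ball z ρ, c' ≤ Rop Ω g lam y by
    refine le_liminf_of_le (by isBoundedDefault) ?_
    rw [hΩo.nhdsWithin_eq hz]
    filter_upwards [Metric.ball_mem_nhds z hρ] with y hy using H y hy
  intro y hy
  rcases le_or_gt c' 0 with h0 | h0
  · exact h0.trans (Rop_nonneg (hball hy).2)
  refine le_sInf ?_
  rintro _ ⟨v, hv, hvg, rfl⟩
  have hv0 : ∀ x ∈ Ω, 0 ≤ v x := fun x hx => (le_max_right _ _).trans (hvg x hx)
  have hl := lsc_toE hΩo hv hv0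
  have hm := (polySup_toE hv hv0).circMean hl
  have hvnull := hm.ae_lt_top hΩo hΩc.isPreconnected hl.measurable (exists_toE_ne_top hv hv0)
  have hc0 : ((c'.toENNReal : ℝ≥0∞) : EReal) = c' := EReal.coe_toENNReal h0.le
  have hmaj : ∀ ε : NNReal, ∀ x ∈ Metric.ball z ρ, 0 < ε →
      c'.toENNReal ≤ toE Ω v x + ε * V x := by
    intro ε x hx hε
    set u : (Fin n → ℂ) → ℝ≥0∞ := fun x => toE Ω v x + ε * V x with hu
    have hul : LowerSemicontinuous u := hl.add (lsc_const_mul hV ENNReal.coe_ne_top)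
    have hum : CircMean Ω u :=
      hm.add (hVm.const_mul hV.measurable _) hl.measurable
    have huf : ∃ x ∈ Ω, u x ≠ ⊤ := by
      by_contra! hcon
      have hsub : Ω ⊆ (Ω ∩ {z | V z = ⊤}) ∪ (Ω ∩ {z | toE Ω v z = ⊤}) := by
        intro x hx
        by_contra hno
        simp only [mem_union, mem_inter_iff, hx, mem_ofPred_eq, true_and, not_or] at hno
        exact (ENNReal.add_ne_top.2 ⟨hno.2, ENNReal.mul_ne_top ENNReal.coe_ne_top hno.1⟩)
          (hcon x hx)
      have := measure_mono_null hsub (measure_union_null hVnull hvnull)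
      exact (hΩo.measure_pos volume hΩc.nonempty).ne' this
    have hps := isPSupH_coe hul (hum.polySup hul) huf
    have hle : ∀ ζ ∈ Ω, max (f ζ - (lam : EReal)) 0 ≤ (u ζ : EReal) := by
      intro ζ hζ
      by_cases hE : ζ ∈ E
      · have : u ζ = ⊤ := by
          have hε' : (ε : ℝ≥0∞) ≠ 0 := by exact_mod_cast hε.ne'
          simp only [hu, hVE ζ hE, ENNReal.mul_top hε', add_top]
        rw [this]; exact le_top
      · refine (max_le_max (EReal.sub_le_sub (hfg ζ ⟨hζ, hE⟩) le_rfl) le_rfl).trans ?_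
        refine (hvg ζ hζ).trans ?_
        rw [← coe_toE hζ (hv0 ζ hζ)]
        exact EReal.coe_ennreal_le_coe_ennreal_iff.2 le_self_add
    have h1 : Rop Ω f lam x ≤ (u x : EReal) := sInf_le ⟨_, hps, hle, rfl⟩
    have h2 : c' ≤ (u x : EReal) := (hball hx).1.le.trans h1
    rw [← hc0] at h2
    exact EReal.coe_ennreal_le_coe_ennreal_iff.1 h2
  have hae : ∀ x ∈ Metric.ball z ρ, V x ≠ ⊤ → c'.toENNReal ≤ toE Ω v x := by
    intro x hx hVx
    refine ENNReal.le_of_forall_pos_le_add fun ε hε _ => ?_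
    have hp : 0 < ε / ((V x).toNNReal + 1) := by positivity
    refine (hmaj _ x hx hp).trans ?_
    gcongr
    rw [← ENNReal.coe_toNNReal hVx, ← ENNReal.coe_mul, ENNReal.coe_le_coe]
    simp only [ENNReal.toNNReal_coe]
    rw [div_mul_eq_mul_div]
    refine div_le_of_le_mul₀ (by positivity) (by positivity) ?_
    gcongr
    exact le_self_add
  obtain ⟨δ, hδ, hδb⟩ := Metric.isOpen_iff.1 Metric.isOpen_ball y hy
  have hδΩ : Metric.ball y δ ⊆ Ω := fun x hx => (hball (hδb hx)).2
  have hmean := hm.lintegral_ball_le hl.measurable hδΩ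
  have hlow : c'.toENNReal * volume (Metric.ball y δ) ≤ ∫⁻ x in Metric.ball y δ, toE Ω v x := by
    rw [← setLIntegral_const]
    refine lintegral_mono_ae ?_
    rw [ae_restrict_iff' measurableSet_ball]
    have : ∀ᵐ x, x ∉ Ω ∩ {z | V z = ⊤} := measure_eq_zero_iff_ae_notMem.1 hVnull
    filter_upwards [this] with x hx hxb
    exact hae x (hδb hxb) fun ht => hx ⟨hδΩ hxb, ht⟩
  have hfin := hlow.trans hmean
  have : c'.toENNReal ≤ toE Ω v y :=
    (ENNReal.mul_le_mul_iff_left (Metric.measure_ball_pos volume y hδ).ne'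
      measure_ball_lt_top.ne).1 hfin
  rw [← hc0, ← coe_toE (hball hy).2 (hv0 y (hball hy).2)]
  exact EReal.coe_ennreal_le_coe_ennreal_iff.2 this

theorem Sop_le_of_majorant {Ω : Set (Fin n → ℂ)} (hΩo : IsOpen Ω) (hΩc : IsConnected Ω)
    {f g : (Fin n → ℂ) → EReal} {E : Set (Fin n → ℂ)} (hfg : ∀ z ∈ Ω \ E, f z ≤ g z)
    {V : (Fin n → ℂ) → ℝ≥0∞} (hV : LowerSemicontinuous V) (hVm : CircMean Ω V)
    (hVE : ∀ z ∈ E, V z = ⊤) (hVf : ∃ z ∈ Ω, V z ≠ ⊤) (z : Fin n → ℂ) :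
    Sop Ω f z ≤ Sop Ω g z := by
  refine liminf_le_liminf ?_
  filter_upwards [self_mem_nhdsWithin] with y hy
  exact iInf_mono fun lam => iInf_mono fun _ =>
    Slam_le_of_majorant hΩo hΩc hfg hV hVm hVE hVf lam hy

lemma norm_le_of_circle {h : ℂ → ℂ} (hd : Differentiable ℂ h) {R M : ℝ} (hR : 0 < R)
    (hM : ∀ ζ, ‖ζ‖ = R → ‖h ζ‖ ≤ M) {ζ : ℂ} (hζ : ‖ζ‖ ≤ R) : ‖h ζ‖ ≤ M := by
  refine Complex.norm_le_of_forall_mem_frontier_norm_le (U := Metric.ball 0 R)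
    Metric.isBounded_ball hd.diffContOnCl (fun ξ hξ => hM ξ ?_) ?_
  · rw [frontier_ball _ hR.ne'] at hξ; simpa using hξ
  · rw [closure_ball _ hR.ne']; simpa using hζ

/-- The restriction of a polynomial in several variables to a complex line. -/
def mvLine (P : MvPolynomial (Fin n) ℂ) (z w : Fin n → ℂ) : ℂ[X] :=
  MvPolynomial.aeval (fun i => C (z i) + C (w i) * X) P

lemma eval_mvLine (P : MvPolynomial (Fin n) ℂ) (z w : Fin n → ℂ) (ζ : ℂ) :
    (mvLine P z w).eval ζ = MvPolynomial.eval (z + ζ • w) P := by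
  have h := DFunLike.congr_fun (MvPolynomial.comp_aeval (R := ℂ)
    (fun i => C (z i) + C (w i) * X) (Polynomial.aeval ζ : ℂ[X] →ₐ[ℂ] ℂ)) P
  simp only [AlgHom.comp_apply] at h
  rw [← Polynomial.coe_aeval_eq_eval, mvLine, h, ← MvPolynomial.coe_aeval_eq_eval]
  have e : (fun i => Polynomial.aeval ζ (C (z i) + C (w i) * X)) = z + ζ • w := by
    ext i
    simp only [map_add, map_mul, Polynomial.aeval_C, Polynomial.aeval_X, Pi.add_apply,
      Pi.smul_apply, smul_eq_mul, Algebra.algebraMap_self, RingHom.id_apply]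
    ring
  rw [e]
  rfl

lemma natDegree_mvLine_le (P : MvPolynomial (Fin n) ℂ) (z w : Fin n → ℂ) :
    (mvLine P z w).natDegree ≤ P.totalDegree := by
  have := MvPolynomial.aeval_natDegree_le (m := P.totalDegree) (n := 1) P le_rfl
    (fun i => C (z i) + C (w i) * X) (fun i => by compute_degree)
  simpa [mvLine] using this

/-- The plurisuperharmonic function `ρ - (log |P|) / D`. -/
def logV (P : MvPolynomial (Fin n) ℂ) (D ρ : ℝ) (z : Fin n → ℂ) : ℝ≥0∞ :=
  if MvPolynomial.eval z P = 0 then ⊤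
  else ENNReal.ofReal (ρ - Real.log ‖MvPolynomial.eval z P‖ / D)

lemma le_logV {P : MvPolynomial (Fin n) ℂ} {D ρ c : ℝ} (hD : 0 < D) {z : Fin n → ℂ}
    (h : ‖MvPolynomial.eval z P‖ ≤ Real.exp (D * (ρ - c))) :
    ENNReal.ofReal c ≤ logV P D ρ z := by
  rw [logV]
  split_ifs with h0
  · exact le_top
  · refine ENNReal.ofReal_le_ofReal ?_
    have h1 := (Real.log_le_iff_le_exp (norm_pos_iff.2 h0)).2 h
    have : Real.log ‖MvPolynomial.eval z P‖ / D ≤ ρ - c := by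
      rw [div_le_iff₀ hD]; linarith
    linarith

lemma norm_le_of_le_logV {P : MvPolynomial (Fin n) ℂ} {D ρ c : ℝ} (hD : 0 < D) {z : Fin n → ℂ}
    (hρ : ‖MvPolynomial.eval z P‖ ≤ Real.exp (D * ρ)) (h : ENNReal.ofReal c ≤ logV P D ρ z) :
    ‖MvPolynomial.eval z P‖ ≤ Real.exp (D * (ρ - c)) := by
  rw [logV] at h
  split_ifs at h with h0
  · rw [h0, norm_zero]; positivity
  · have hpos := norm_pos_iff.2 h0
    rw [← Real.log_le_iff_le_exp hpos] at hρ ⊢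
    have h1 : Real.log ‖MvPolynomial.eval z P‖ / D ≤ ρ := by
      rw [div_le_iff₀ hD]; linarith
    have h2 := (ENNReal.ofReal_le_ofReal_iff (by linarith)).1 h
    have h3 : Real.log ‖MvPolynomial.eval z P‖ / D ≤ ρ - c := by linarith
    rw [div_le_iff₀ hD] at h3
    linarith

lemma logV_eq_of_norm_eq_one {P : MvPolynomial (Fin n) ℂ} {D ρ : ℝ} {z : Fin n → ℂ}
    (h : ‖MvPolynomial.eval z P‖ = 1) : logV P D ρ z = ENNReal.ofReal ρ := by
  have h0 : MvPolynomial.eval z P ≠ 0 := norm_pos_iff.1 (by rw [h]; exact one_pos)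
  rw [logV, if_neg h0, h]; simp

lemma lsc_logV (P : MvPolynomial (Fin n) ℂ) {D : ℝ} (hD : 0 < D) (ρ : ℝ) :
    LowerSemicontinuous (logV P D ρ) := by
  rw [lowerSemicontinuous_iff_isClosed_preimage]
  intro c
  rcases eq_or_ne c ⊤ with rfl | hc
  · convert isClosed_univ; ext; simp
  have : logV P D ρ ⁻¹' Iic c =
      {z | Real.exp (D * (ρ - c.toReal)) ≤ ‖MvPolynomial.eval z P‖} := by
    ext z
    simp only [mem_preimage, mem_Iic, mem_ofPred_eq, logV]
    split_ifs with h0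
    · rw [h0, norm_zero]
      simp only [top_le_iff, hc, false_iff, not_le]
      positivity
    · have hpos := norm_pos_iff.2 h0
      rw [ENNReal.ofReal_le_iff_le_toReal hc, ← Real.le_log_iff_exp_le hpos, sub_le_comm,
        le_div_iff₀ hD, mul_comm]
  rw [this]
  exact isClosed_le continuous_const (MvPolynomial.continuous_eval P).norm

lemma polySup_logV {Ω : Set (Fin n → ℂ)} {P : MvPolynomial (Fin n) ℂ} {D ρ : ℝ} (hD : 0 < D)
    (hb : ∀ z ∈ Ω, ‖MvPolynomial.eval z P‖ ≤ Real.exp (D * ρ)) :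
    PolySup Ω (logV P D ρ) := by
  intro z w hd p hp ζ hζ
  have hexp : ∀ ξ : ℂ, ‖Complex.exp (D * p.eval ξ)‖ = Real.exp (D * (p.eval ξ).re) := by
    intro ξ; rw [Complex.norm_exp]; simp
  have hdiff : Differentiable ℂ fun ξ => (mvLine P z w).eval ξ * Complex.exp (D * p.eval ξ) := by
    have h1 := (mvLine P z w).differentiable
    have h2 := p.differentiable
    fun_prop
  have key := norm_le_of_circle hdiff one_pos (M := Real.exp (D * ρ)) (fun ξ hξ => by
    have := norm_le_of_le_logV hD (hb _ (hd ξ hξ.le)) (hp ξ hξ)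
    rw [norm_mul, hexp, eval_mvLine]
    calc _ ≤ Real.exp (D * (ρ - (p.eval ξ).re)) * Real.exp (D * (p.eval ξ).re) := by gcongr
      _ = Real.exp (D * ρ) := by rw [← Real.exp_add]; congr 1; ring) hζ
  refine le_logV hD ?_
  rw [norm_mul, hexp, eval_mvLine] at key
  calc _ = ‖MvPolynomial.eval (z + ζ • w) P‖ * Real.exp (D * (p.eval ζ).re) *
        Real.exp (-(D * (p.eval ζ).re)) := by
        rw [mul_assoc, ← Real.exp_add]; simp
    _ ≤ Real.exp (D * ρ) * Real.exp (-(D * (p.eval ζ).re)) := by gcongr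
    _ = _ := by rw [← Real.exp_add]; congr 1; ring

/-- Bernstein–Walsh inequality for the unit disc. -/
lemma bernstein_walsh_disc {q : ℂ[X]} {D : ℕ} (hq : q.natDegree ≤ D)
    (h1 : ∀ ζ : ℂ, ‖ζ‖ ≤ 1 → ‖q.eval ζ‖ ≤ 1) {x : ℂ} (hx : 1 ≤ ‖x‖) :
    ‖q.eval x‖ ≤ ‖x‖ ^ D := by
  have key : ∀ y : ℂ, y ≠ 0 → (reflect D q).eval y⁻¹ * y ^ D = q.eval y := by
    intro y hy
    let := invertibleOfNonzero hy
    have := eval₂_reflect_mul_pow (RingHom.id ℂ) y D q hq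
    simpa [eval₂_id] using this
  have hx0 : x ≠ 0 := norm_pos_iff.1 (by linarith)
  have hcirc : ∀ ζ : ℂ, ‖ζ‖ = 1 → ‖(reflect D q).eval ζ‖ ≤ 1 := by
    intro ζ hζ
    have hζ0 : ζ⁻¹ ≠ 0 := inv_ne_zero (norm_pos_iff.1 (by rw [hζ]; exact one_pos))
    have h := key ζ⁻¹ hζ0
    have h2 := h1 ζ⁻¹ (by simp [hζ])
    rw [← h] at h2
    simpa [hζ] using h2
  have := norm_le_of_circle (reflect D q).differentiable one_pos hcirc (ζ := x⁻¹)
    (by rw [norm_inv]; exact inv_le_one_of_one_le₀ hx)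
  rw [← key x hx0, norm_mul, norm_pow]
  calc _ ≤ 1 * ‖x‖ ^ D := by gcongr
    _ = _ := one_mul _

lemma bernstein_walsh {P : MvPolynomial (Fin n) ℂ} {D : ℕ} (hP : P.totalDegree ≤ D)
    {z₀ : Fin n → ℂ} {r R : ℝ} (hr : 0 < r) (hrR : r ≤ R)
    (h1 : ∀ z ∈ Metric.closedBall z₀ r, ‖MvPolynomial.eval z P‖ ≤ 1)
    {z : Fin n → ℂ} (hz : ‖z - z₀‖ ≤ R) : ‖MvPolynomial.eval z P‖ ≤ (R / r) ^ D := by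
  have hRr : 1 ≤ R / r := (one_le_div hr).2 hrR
  rcases le_or_gt ‖z - z₀‖ r with h | h
  · exact (h1 z (by rwa [mem_closedBall_iff_norm])).trans (one_le_pow₀ hRr)
  have hpos : 0 < ‖z - z₀‖ := hr.trans h
  set w : Fin n → ℂ := ((r / ‖z - z₀‖ : ℝ) : ℂ) • (z - z₀) with hw
  have hwn : ‖w‖ = r := by
    rw [hw, norm_smul, Complex.norm_real, Real.norm_of_nonneg (by positivity)]
    field_simp
  have := bernstein_walsh_disc ((natDegree_mvLine_le P z₀ w).trans hP) (fun ζ hζ => by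
    rw [eval_mvLine]
    refine h1 _ ?_
    rw [mem_closedBall_iff_norm, add_sub_cancel_left, norm_smul, hwn]
    nlinarith) (x := ((‖z - z₀‖ / r : ℝ) : ℂ)) (by
      rw [Complex.norm_real, Real.norm_of_nonneg (by positivity)]
      exact (one_le_div hr).2 h.le)
  rw [eval_mvLine, Complex.norm_real, Real.norm_of_nonneg (by positivity), hw, smul_smul,
    ← Complex.ofReal_mul] at this
  have e : ‖z - z₀‖ / r * (r / ‖z - z₀‖) = 1 := by field_simp
  rw [e, Complex.ofReal_one, one_smul, add_sub_cancel] at this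
  refine this.trans ?_
  gcongr

open scoped ContDiff

/-- The real Hessian of `φ`. -/
def hess (φ : (Fin n → ℂ) → ℝ) (a : Fin n → ℂ) :
    (Fin n → ℂ) →L[ℝ] (Fin n → ℂ) →L[ℝ] ℝ := fderiv ℝ (fderiv ℝ φ) a

/-- The Levi form of `φ`. -/
def levi (φ : (Fin n → ℂ) → ℝ) (a v : Fin n → ℂ) : ℝ :=
  (hess φ a v v + hess φ a (I • v) (I • v)) / 4

lemma contDiff_fderiv {φ : (Fin n → ℂ) → ℝ} (hφ : ContDiff ℝ ∞ φ) :
    ContDiff ℝ ∞ (fderiv ℝ φ) := hφ.fderiv_right (by simp)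

lemma contDiff_hess {φ : (Fin n → ℂ) → ℝ} (hφ : ContDiff ℝ ∞ φ) :
    ContDiff ℝ ∞ (hess φ) := (contDiff_fderiv hφ).fderiv_right (by simp)

lemma hess_symm {φ : (Fin n → ℂ) → ℝ} (hφ : ContDiff ℝ ∞ φ) (a v w : Fin n → ℂ) :
    hess φ a v w = hess φ a w v :=
  (hφ.contDiffAt.isSymmSndFDerivAt (by simp; exact WithTop.coe_le_coe.2 (le_top : (2 : ℕ∞) ≤ ⊤)))
    v w

/-- Second order Taylor expansion along the segment from `a` to `a + y`. -/
lemma taylor_two {φ : (Fin n → ℂ) → ℝ} (hφ : ContDiff ℝ ∞ φ) {a y : Fin n → ℂ} {om : ℝ}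
    (hom : ∀ s ∈ Icc (0 : ℝ) 1, ‖hess φ (a + s • y) - hess φ a‖ ≤ om) :
    |φ (a + y) - φ a - fderiv ℝ φ a y - hess φ a y y / 2| ≤ om * ‖y‖ ^ 2 := by
  have hom0 : 0 ≤ om := (norm_nonneg (hess φ (a + (0 : ℝ) • y) - hess φ a)).trans (hom 0 (by simp))
  have hline : ∀ s : ℝ, HasDerivAt (fun s : ℝ => a + s • y) y s := fun s => by
    simpa using ((hasDerivAt_id s).smul_const y).const_add a
  have hd1 : ∀ s : ℝ, HasDerivAt (fun s : ℝ => φ (a + s • y)) (fderiv ℝ φ (a + s • y) y) s :=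
    fun s => ((hφ.differentiable (by simp)) _).hasFDerivAt.comp_hasDerivAt s (hline s)
  have hd2 : ∀ s : ℝ, HasDerivAt (fun s : ℝ => fderiv ℝ φ (a + s • y) y)
      (hess φ (a + s • y) y y) s := by
    intro s
    have h := (((contDiff_fderiv hφ).differentiable (by simp)) (a + s • y)).hasFDerivAt
      |>.comp_hasDerivAt s (hline s)
    exact ((ContinuousLinearMap.apply ℝ ℝ y).hasFDerivAt
      (x := fderiv ℝ φ (a + s • y))).comp_hasDerivAt s h
  set g1 : ℝ → ℝ := fun s => fderiv ℝ φ (a + s • y) y - fderiv ℝ φ a y - s * hess φ a y y with hg1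
  set g0 : ℝ → ℝ := fun s => φ (a + s • y) - φ a - s * fderiv ℝ φ a y - s ^ 2 * (hess φ a y y / 2)
    with hg0
  have hg1d : ∀ s, HasDerivAt g1 (hess φ (a + s • y) y y - hess φ a y y) s := by
    intro s
    have := ((hd2 s).sub_const (fderiv ℝ φ a y)).sub ((hasDerivAt_id s).mul_const (hess φ a y y))
    refine this.congr_deriv ?_
    simp
  have hg0d : ∀ s, HasDerivAt g0 (g1 s) s := by
    intro s
    have := (((hd1 s).sub_const (φ a)).sub ((hasDerivAt_id s).mul_const (fderiv ℝ φ a y))).sub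
      ((hasDerivAt_pow 2 s).mul_const (hess φ a y y / 2))
    refine this.congr_deriv ?_
    simp only [hg1]; push_cast; ring
  have hb1 : ∀ s ∈ Icc (0 : ℝ) 1, ‖g1 s‖ ≤ om * ‖y‖ ^ 2 := by
    intro s hs
    have h := (convex_Icc (0 : ℝ) 1).norm_image_sub_le_of_norm_hasDerivWithin_le
      (fun x _ => (hg1d x).hasDerivWithinAt) (C := om * ‖y‖ ^ 2) (fun x hx => by
        have h1 : hess φ (a + x • y) y y - hess φ a y y = (hess φ (a + x • y) - hess φ a) y y := by
          simp
        rw [h1]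
        calc _ ≤ ‖hess φ (a + x • y) - hess φ a‖ * ‖y‖ * ‖y‖ :=
              ContinuousLinearMap.le_opNorm₂ _ _ _
          _ ≤ om * ‖y‖ * ‖y‖ := by gcongr; exact hom x hx
          _ = _ := by ring) (left_mem_Icc.2 zero_le_one) hs
    have h0 : g1 0 = 0 := by simp [hg1]
    rw [h0, sub_zero, sub_zero] at h
    refine h.trans ?_
    rw [Real.norm_of_nonneg hs.1]
    have : 0 ≤ om * ‖y‖ ^ 2 := by positivity
    nlinarith [hs.2]
  have h := (convex_Icc (0 : ℝ) 1).norm_image_sub_le_of_norm_hasDerivWithin_le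
      (fun x _ => (hg0d x).hasDerivWithinAt) (C := om * ‖y‖ ^ 2) hb1
      (left_mem_Icc.2 zero_le_one) (right_mem_Icc.2 zero_le_one)
  have h0 : g0 0 = 0 := by simp [hg0]
  rw [h0] at h
  simpa [hg0] using h

/-- The holomorphic part of the second order Taylor polynomial of `φ` on the line `a + ζ v`,
without its constant term. -/
def holoPart (φ : (Fin n → ℂ) → ℝ) (a v : Fin n → ℂ) : ℂ[X] :=
  C ((fderiv ℝ φ a v : ℂ) - fderiv ℝ φ a (I • v) * I) * X +
    C (((hess φ a v v - hess φ a (I • v) (I • v)) / 4 : ℝ) - (hess φ a v (I • v) / 2 : ℝ) * I) *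
      X ^ 2

lemma smul_eq_re_im (ζ : ℂ) (v : Fin n → ℂ) : ζ • v = ζ.re • v + ζ.im • (I • v) := by
  ext i
  have h : (ζ : ℂ) = ζ.re + ζ.im * I := (Complex.re_add_im ζ).symm
  simp only [Pi.smul_apply, smul_eq_mul, Pi.add_apply, Complex.real_smul]
  nth_rewrite 1 [h]
  ring

lemma taylor_part_eq {φ : (Fin n → ℂ) → ℝ} (hφ : ContDiff ℝ ∞ φ) (a v : Fin n → ℂ) (ζ : ℂ) :
    fderiv ℝ φ a (ζ • v) + hess φ a (ζ • v) (ζ • v) / 2 =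
      ((holoPart φ a v).eval ζ).re + ‖ζ‖ ^ 2 * levi φ a v := by
  rw [smul_eq_re_im, ← Complex.normSq_eq_norm_sq, Complex.normSq_apply]
  simp only [holoPart, levi, map_add, map_smul, add_apply,
    smul_eq_mul, eval_add, eval_mul, eval_C, eval_X, Complex.add_re, Complex.mul_re,
    Complex.sub_re, Complex.sub_im, Complex.ofReal_re, Complex.ofReal_im, Complex.I_re,
    Complex.I_im, Complex.mul_im, pow_two, smul_apply]
  rw [hess_symm hφ a (I • v) v]
  ring

/-- A smooth function with sub mean value property on circles has nonnegative Levi form. -/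
lemma levi_nonneg {φ : (Fin n → ℂ) → ℝ} (hφ : ContDiff ℝ ∞ φ) {U : Set (Fin n → ℂ)}
    (hU : IsOpen U) (h : ∀ z w, DiscIn U z w → φ z ≤ ∫ t, φ (z + ec t • w) ∂nuC)
    {a : Fin n → ℂ} (ha : a ∈ U) (v : Fin n → ℂ) : 0 ≤ levi φ a v := by
  rcases eq_or_ne v 0 with rfl | hv
  · simp [levi]
  refine le_of_forall_pos_le_add fun ε hε => ?_
  have hvn : 0 < ‖v‖ := norm_pos_iff.2 hv
  have hcont := (contDiff_hess hφ).continuous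
  obtain ⟨δ, hδ, hδb⟩ := Metric.continuousAt_iff.1 (hcont.continuousAt (x := a))
    (ε / ‖v‖ ^ 2) (by positivity)
  obtain ⟨δ', hδ', hδU⟩ := Metric.isOpen_iff.1 hU a ha
  set ρ : ℝ := min δ δ' / (2 * ‖v‖) with hρ
  have hρ0 : 0 < ρ := by positivity
  set w : Fin n → ℂ := (ρ : ℂ) • v with hw
  have hwn : ‖w‖ = min δ δ' / 2 := by
    rw [hw, norm_smul, Complex.norm_real, Real.norm_of_nonneg hρ0.le, hρ]; field_simp
  have hmin0 : 0 < min δ δ' := by positivity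
  have hdisc : DiscIn U a w := by
    intro ζ hζ
    refine hδU ?_
    rw [mem_ball_iff_norm, add_sub_cancel_left, norm_smul, hwn]
    have := min_le_right δ δ'
    nlinarith
  have hT : ∀ t, φ (a + ec t • w) ≤ φ a + (((holoPart φ a w).eval (ec t)).re + levi φ a w) +
      ε * ρ ^ 2 := by
    intro t
    have h1 := taylor_two hφ (a := a) (y := ec t • w) (om := ε / ‖v‖ ^ 2) (fun s hs => by
      refine (dist_eq_norm (hess φ (a + s • ec t • w)) (hess φ a)).ge.trans (hδb ?_).le
      rw [dist_eq_norm, add_sub_cancel_left, norm_smul, norm_smul, norm_ec, one_mul, hwn,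
        Real.norm_of_nonneg hs.1]
      have := min_le_left δ δ'
      nlinarith [hs.2])
    have h2 := taylor_part_eq hφ a w (ec t)
    have h3 : ε / ‖v‖ ^ 2 * ‖ec t • w‖ ^ 2 = ε * ρ ^ 2 := by
      rw [norm_smul, norm_ec, one_mul, hw, norm_smul, Complex.norm_real,
        Real.norm_of_nonneg hρ0.le]
      field_simp
    rw [h3] at h1
    rw [norm_ec, one_pow, one_mul] at h2
    have := (abs_le.1 h1).2
    linarith
  have hm := h a w hdisc
  have hc1 : Continuous fun t => φ (a + ec t • w) :=
    hφ.continuous.comp (continuous_const.add (continuous_ec.smul continuous_const))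
  have hc2 : Continuous fun t => ((holoPart φ a w).eval (ec t)).re :=
    Complex.continuous_re.comp ((holoPart φ a w).continuous.comp continuous_ec)
  have hi : ∫ t, φ (a + ec t • w) ∂nuC ≤ φ a + levi φ a w + ε * ρ ^ 2 := by
    calc _ ≤ ∫ t, (((holoPart φ a w).eval (ec t)).re + (φ a + levi φ a w + ε * ρ ^ 2)) ∂nuC := by
          refine integral_mono (integrable_of_continuous hc1)
            (integrable_of_continuous (by fun_prop)) fun t => ?_
          simp only
          linarith [hT t]
      _ = _ := by
          rw [integral_add (integrable_of_continuous hc2) (integrable_const _), integral_re_poly]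
          simp [holoPart]
  have hlev : levi φ a w = ρ ^ 2 * levi φ a v := by
    have e : I • w = (ρ : ℝ) • (I • v) := by
      rw [hw, ← Complex.coe_smul, smul_comm]
    have e' : w = (ρ : ℝ) • v := by rw [hw, Complex.coe_smul]
    rw [levi, levi, e, e']
    simp only [map_smul, smul_apply, smul_eq_mul]
    ring
  rw [hlev] at hi
  have : 0 ≤ ρ ^ 2 * (levi φ a v + ε) := by linarith
  exact nonneg_of_mul_nonneg_right this (by positivity)

open scoped Convolution

/-- Smooth functions with values in `[-1, 0]` and nonnegative Levi form on a ball. -/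
structure Good (z₀ : Fin n → ℂ) (R : ℝ) (φ : (Fin n → ℂ) → ℝ) : Prop where
  smooth : ContDiff ℝ ∞ φ
  lower : ∀ z, -1 ≤ φ z
  upper : ∀ z, φ z ≤ 0
  levi_nonneg : ∀ a ∈ Metric.ball z₀ R, ∀ v, 0 ≤ levi φ a v

/-- The truncation of `v` at level `j`, normalized to take values in `[0, 1]`. -/
def trunc (v : (Fin n → ℂ) → ℝ≥0∞) (j : ℕ) (z : Fin n → ℂ) : ℝ := (min (v z) j).toReal / j

lemma trunc_nonneg (v : (Fin n → ℂ) → ℝ≥0∞) (j : ℕ) (z : Fin n → ℂ) : 0 ≤ trunc v j z := by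
  unfold trunc; positivity

lemma trunc_le_one (v : (Fin n → ℂ) → ℝ≥0∞) (j : ℕ) (z : Fin n → ℂ) : trunc v j z ≤ 1 := by
  unfold trunc
  refine div_le_one_of_le₀ ?_ (by positivity)
  simpa using ENNReal.toReal_mono (ENNReal.natCast_ne_top j) (min_le_right (v z) (j : ℝ≥0∞))

lemma trunc_eq_one {v : (Fin n → ℂ) → ℝ≥0∞} {j : ℕ} (hj : 0 < j) {z : Fin n → ℂ}
    (h : (j : ℝ≥0∞) ≤ v z) : trunc v j z = 1 := by
  unfold trunc
  rw [min_eq_right h, ENNReal.toReal_natCast, div_self (by positivity)]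

lemma measurable_trunc {v : (Fin n → ℂ) → ℝ≥0∞} (hv : Measurable v) (j : ℕ) :
    Measurable (trunc v j) := by
  unfold trunc; fun_prop

lemma tendsto_trunc {v : (Fin n → ℂ) → ℝ≥0∞} {z : Fin n → ℂ} (h : v z < ⊤) :
    Tendsto (fun j => trunc v j z) atTop (𝓝 0) := by
  refine squeeze_zero (fun j => trunc_nonneg v j z) (fun j => ?_)
    (tendsto_const_div_atTop_nhds_zero_nat (v z).toReal)
  unfold trunc
  gcongr
  · exact h.ne
  · exact min_le_left _ _

lemma CircMean.integral_trunc_le {Ω : Set (Fin n → ℂ)} {v : (Fin n → ℂ) → ℝ≥0∞}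
    (hv : Measurable v) (h : CircMean Ω v) (j : ℕ) {z w : Fin n → ℂ} (hd : DiscIn Ω z w) :
    ∫ t, trunc v j (z + ec t • w) ∂nuC ≤ trunc v j z := by
  have h1 := h.min_const j z w hd
  simp only [trunc]
  rw [integral_div]
  gcongr
  rw [integral_toReal]
  · exact ENNReal.toReal_mono (ne_top_of_le_ne_top (ENNReal.natCast_ne_top j) (min_le_right _ _)) h1
  · exact ((measurable_disc (hv.min measurable_const) z w)).aemeasurable
  · exact Eventually.of_forall fun t =>
      (min_le_right _ _).trans_lt (ENNReal.natCast_lt_top j)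

lemma exists_good {z₀ : Fin n → ℂ} {r : ℝ} {v : (Fin n → ℂ) → ℝ≥0∞}
    (hv : Measurable v) (hm : CircMean (Metric.ball z₀ (3 * r)) v)
    (h0 : ∀ z ∉ Metric.ball z₀ (3 * r), v z = 0) (hfin : ∀ᵐ z, v z < ⊤) {η : ℝ} (hη : 0 < η) :
    ∃ j : ℕ, 0 < j ∧ ∀ ε : ℝ, 0 < ε → ε ≤ r → ∃ φ : (Fin n → ℂ) → ℝ,
      Good z₀ (2 * r) φ ∧ ∫ z in Metric.ball z₀ (2 * r), -φ z ≤ η ∧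
      ∀ z, (∀ y ∈ Metric.ball z ε, (j : ℝ≥0∞) ≤ v y) → φ z = -1 := by
  have hdom : Integrable ((Metric.ball z₀ (3 * r)).indicator fun _ => (1 : ℝ)) := by
    rw [integrable_indicator_iff measurableSet_ball]
    exact integrableOn_const measure_ball_lt_top.ne
  have hle : ∀ j z, ‖trunc v j z‖ ≤ (Metric.ball z₀ (3 * r)).indicator (fun _ => (1 : ℝ)) z := by
    intro j z
    rw [Real.norm_of_nonneg (trunc_nonneg v j z)]
    by_cases hz : z ∈ Metric.ball z₀ (3 * r)
    · simpa [hz] using trunc_le_one v j z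
    · simp [hz, trunc, h0 z hz]
  have hinteg : ∀ j, Integrable (trunc v j) := fun j =>
    hdom.mono' (measurable_trunc hv j).aestronglyMeasurable (Eventually.of_forall (hle j))
  have hlim : Tendsto (fun j => ∫ z, trunc v j z) atTop (𝓝 0) := by
    have := tendsto_integral_of_dominated_convergence (f := fun _ : Fin n → ℂ => (0 : ℝ))
      (F := fun j => trunc v j) _
      (fun j => (measurable_trunc hv j).aestronglyMeasurable) hdom
      (fun j => Eventually.of_forall (hle j)) (hfin.mono fun z hz => tendsto_trunc hz)
    simpa using this
  obtain ⟨j, hjη, hj⟩ := ((hlim.eventually (ge_mem_nhds hη)).and (eventually_gt_atTop 0)).exists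
  refine ⟨j, hj, fun ε hε hεr => ?_⟩
  let b : ContDiffBump (0 : Fin n → ℂ) := ⟨ε / 2, ε, by positivity, by linarith⟩
  have hbsupp : Function.support (b.normed volume) = Metric.ball 0 ε := b.support_normed_eq
  have hbi : Integrable (b.normed volume) := b.integrable_normed
  set s := trunc v j with hs
  have hsm : Measurable s := measurable_trunc hv j
  set ψ : (Fin n → ℂ) → ℝ := b.normed volume ⋆[ContinuousLinearMap.lsmul ℝ ℝ, volume] s with hψ
  have hψe : ∀ z, ψ z = ∫ y, b.normed volume y * s (z - y) := fun z => by
    simp [hψ, convolution_def]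
  have hbm : Measurable (b.normed volume) := b.continuous_normed.measurable
  have hprod : ∀ z, Integrable fun y => b.normed volume y * s (z - y) := by
    intro z
    refine hbi.mul_bdd (c := 1) (hsm.comp (measurable_const.sub measurable_id)).aestronglyMeasurable
      (Eventually.of_forall fun y => ?_)
    rw [Real.norm_of_nonneg (trunc_nonneg v j _)]
    exact trunc_le_one v j _
  have hψ0 : ∀ z, 0 ≤ ψ z := fun z => by
    rw [hψe]
    exact integral_nonneg fun y => mul_nonneg (b.nonneg_normed y) (trunc_nonneg v j _)
  have hψ1 : ∀ z, ψ z ≤ 1 := fun z => by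
    rw [hψe, ← b.integral_normed (μ := (volume : Measure (Fin n → ℂ)))]
    exact integral_mono (hprod z) hbi fun y =>
      mul_le_of_le_one_right (b.nonneg_normed y) (trunc_le_one v j _)
  have hsmooth : ContDiff ℝ ∞ ψ :=
    HasCompactSupport.contDiff_convolution_left _ b.hasCompactSupport_normed
      b.contDiff_normed (hinteg j).locallyIntegrable
  refine ⟨fun z => -ψ z, ⟨hsmooth.neg, fun z => by linarith [hψ1 z], fun z => by linarith [hψ0 z],
    ?_⟩, ?_, ?_⟩
  · intro a ha w
    refine PshTools.levi_nonneg hsmooth.neg Metric.isOpen_ball (fun z w hd => ?_) ha w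
    rw [integral_neg, neg_le_neg_iff]
    simp only [hψe]
    have hmeas : Measurable (Function.uncurry fun (t : UnitAddCircle) (y : Fin n → ℂ) =>
        b.normed volume y * s (z + ec t • w - y)) := by
      refine (hbm.comp measurable_snd).mul (hsm.comp ?_)
      refine Measurable.sub ?_ measurable_snd
      exact (continuous_const.add ((continuous_ec.comp continuous_fst).smul
        continuous_const)).measurable
    have hpi : Integrable (Function.uncurry fun (t : UnitAddCircle) (y : Fin n → ℂ) =>
        b.normed volume y * s (z + ec t • w - y)) (nuC.prod volume) := by
      refine (hbi.comp_snd nuC).mono' hmeas.aestronglyMeasurable (Eventually.of_forall fun p => ?_)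
      simp only [Function.uncurry]
      rw [Real.norm_of_nonneg (mul_nonneg (b.nonneg_normed _) (trunc_nonneg v j _))]
      exact mul_le_of_le_one_right (b.nonneg_normed _) (trunc_le_one v j _)
    rw [integral_integral_swap hpi]
    refine integral_mono hpi.integral_prod_right (hprod z) fun y => ?_
    beta_reduce
    rw [integral_const_mul]
    by_cases hy : y ∈ Metric.ball (0 : Fin n → ℂ) ε
    · refine mul_le_mul_of_nonneg_left ?_ (b.nonneg_normed y)
      have hd' : DiscIn (Metric.ball z₀ (3 * r)) (z - y) w := by
        intro ζ hζ
        have h1 := hd ζ hζ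
        rw [mem_ball_iff_norm] at h1 hy ⊢
        rw [sub_zero] at hy
        calc ‖z - y + ζ • w - z₀‖ = ‖(z + ζ • w - z₀) - y‖ := by congr 1; abel
          _ ≤ ‖z + ζ • w - z₀‖ + ‖y‖ := norm_sub_le _ _
          _ < 3 * r := by linarith
      have h2 := hm.integral_trunc_le hv j hd'
      refine le_trans (le_of_eq ?_) h2
      congr 1; ext t; congr 1; abel
    · have : b.normed volume y = 0 := by
        by_contra hne
        exact hy (hbsupp ▸ Function.mem_support.2 hne)
      simp [this]
  · have hψi : Integrable ψ :=
      Integrable.integrable_convolution _ hbi (hinteg j)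
    calc ∫ z in Metric.ball z₀ (2 * r), -(-ψ z) = ∫ z in Metric.ball z₀ (2 * r), ψ z := by simp
      _ ≤ ∫ z, ψ z := setIntegral_le_integral hψi (Eventually.of_forall hψ0)
      _ = ∫ z, s z := by
          rw [hψ, integral_convolution _ hbi (hinteg j)]
          simp [b.integral_normed, hs]
      _ ≤ η := hjη
  · intro z hz
    rw [neg_inj, hψe, ← b.integral_normed (μ := (volume : Measure (Fin n → ℂ)))]
    refine integral_congr_ae (Eventually.of_forall fun y => ?_)
    beta_reduce
    by_cases hy : y ∈ Metric.ball (0 : Fin n → ℂ) ε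
    · rw [hs, trunc_eq_one hj (hz _ ?_), mul_one]
      rw [mem_ball_iff_norm] at hy ⊢
      simpa using hy
    · have : b.normed volume y = 0 := by
        by_contra hne
        exact hy (hbsupp ▸ Function.mem_support.2 hne)
      simp [this]

section Algebra

variable {R A : Type*} [CommRing R] [CommRing A] [Algebra R A] {k : ℕ}

lemma derivation_prod {ι : Type*} [DecidableEq ι] (D : Derivation R A A) (s : Finset ι)
    (f : ι → A) : D (∏ i ∈ s, f i) = ∑ l ∈ s, D (f l) * ∏ m ∈ s.erase l, f m := by
  induction s using Finset.induction_on with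
  | empty => simp
  | insert a s ha ih =>
    rw [Finset.prod_insert ha, Derivation.leibniz, Finset.sum_insert ha, Finset.erase_insert ha, ih,
      smul_eq_mul, smul_eq_mul, Finset.mul_sum, add_comm, mul_comm]
    congr 1
    refine Finset.sum_congr rfl fun l hl => ?_
    have hla : a ≠ l := fun h => ha (h ▸ hl)
    rw [Finset.erase_insert_of_ne hla, Finset.prod_insert (by simp [ha])]
    ring

/-- The Piola identity: the cofactors of a matrix of derivatives are divergence free. -/
lemma piola (D : Fin k → Derivation R A A) (hD : ∀ p q a, D p (D q a) = D q (D p a))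
    (u : Fin k → A) (i : Fin k) :
    ∑ j, D j ((Matrix.of fun p l => D p (u l)).adjugate i j) = 0 := by
  classical
  set M : Matrix (Fin k) (Fin k) A := Matrix.of fun p l => D p (u l) with hM
  have hadj : ∀ j, M.adjugate i j = ∑ σ : Equiv.Perm (Fin k),
      if σ i = j then Equiv.Perm.sign σ • ∏ l ∈ Finset.univ.erase i, D (σ l) (u l) else 0 := by
    intro j
    have h1 : M.adjugate i j = (M.updateCol i (Pi.single j 1)).det := by
      rw [← Matrix.cramer_apply, ← M.transpose_transpose, ← Matrix.adjugate_transpose,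
        Matrix.transpose_transpose, Matrix.transpose_apply, Matrix.adjugate_def]
      simp
    rw [h1, Matrix.det_apply]
    refine Finset.sum_congr rfl fun σ _ => ?_
    rw [← Finset.mul_prod_erase _ _ (Finset.mem_univ i)]
    have h2 : ∏ l ∈ Finset.univ.erase i, M.updateCol i (Pi.single j 1) (σ l) l =
        ∏ l ∈ Finset.univ.erase i, D (σ l) (u l) :=
      Finset.prod_congr rfl fun l hl => by
        rw [Matrix.updateCol_ne (Finset.ne_of_mem_erase hl)]; rfl
    rw [h2]
    by_cases h : σ i = j
    · simp [h]
    · simp [h]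
  have hsum : ∑ j, D j (M.adjugate i j) = ∑ l ∈ Finset.univ.erase i, ∑ σ : Equiv.Perm (Fin k),
      Equiv.Perm.sign σ • (D (σ i) (D (σ l) (u l)) *
        ∏ m ∈ (Finset.univ.erase i).erase l, D (σ m) (u m)) := by
    simp only [hadj, map_sum]
    rw [Finset.sum_comm, Finset.sum_comm (s := Finset.univ.erase i)]
    refine Finset.sum_congr rfl fun σ _ => ?_
    rw [Finset.sum_eq_single (σ i)]
    · rw [if_pos rfl]
      rw [Units.smul_def, map_zsmul, derivation_prod, Finset.smul_sum]
      simp only [Units.smul_def]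
    · intro j _ hj
      rw [if_neg (Ne.symm hj), map_zero]
    · simp
  rw [hsum]
  refine Finset.sum_eq_zero fun l hl => ?_
  have hli : l ≠ i := Finset.ne_of_mem_erase hl
  refine Finset.sum_involution (fun σ _ => σ * Equiv.swap i l) ?_ ?_ ?_ ?_
  · intro σ _
    have hp : ∏ m ∈ (Finset.univ.erase i).erase l, D ((σ * Equiv.swap i l) m) (u m) =
        ∏ m ∈ (Finset.univ.erase i).erase l, D (σ m) (u m) :=
      Finset.prod_congr rfl fun m hm => by
        simp only [Finset.mem_erase] at hm
        rw [Equiv.Perm.mul_apply, Equiv.swap_apply_of_ne_of_ne hm.2.1 hm.1]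
    rw [hp, Equiv.Perm.sign_mul, Equiv.Perm.sign_swap hli.symm]
    simp only [Equiv.Perm.mul_apply, Equiv.swap_apply_left, Equiv.swap_apply_right]
    rw [hD (σ l) (σ i)]
    simp
  · intro σ _ _ h
    have := congrArg (fun τ : Equiv.Perm (Fin k) => τ i) h
    simp only [Equiv.Perm.mul_apply, Equiv.swap_apply_left] at this
    exact hli (σ.injective this)
  · simp
  · intro σ _
    simp [mul_assoc]

/-- The complex Hessian with respect to two families of derivations. -/
def cHess (D D' : Fin k → Derivation R A A) (φ : A) : Matrix (Fin k) (Fin k) A :=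
  Matrix.of fun p l => D' p (D l φ)

lemma cHess_div (D D' : Fin k → Derivation R A A) (hD : ∀ p q a, D p (D q a) = D q (D p a))
    (hD' : ∀ p q a, D' p (D' q a) = D' q (D' p a)) (hDD : ∀ p q a, D p (D' q a) = D' q (D p a))
    (f φ χ : A) :
    χ * ((cHess D D' f).adjugate * cHess D D' φ).trace -
      φ * ((cHess D D' f).adjugate * cHess D D' χ).trace =
    ∑ j, D' j (χ * ∑ i, (cHess D D' f).adjugate i j * D i φ) -
      ∑ i, D i (φ * ∑ j, (cHess D D' f).adjugate i j * D' j χ) := by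
  set C := (cHess D D' f).adjugate with hC
  have p1 : ∀ i, ∑ j, D' j (C i j) = 0 := fun i => piola D' hD' (fun l => D l f) i
  have p2 : ∀ j, ∑ i, D i (C i j) = 0 := by
    intro j
    have h := piola D hD (fun l => D' l f) j
    have e : (Matrix.of fun p l => D p (D' l f)) = (cHess D D' f).transpose := by
      ext p l; simp [cHess, hDD]
    rw [e, ← Matrix.adjugate_transpose] at h
    exact h
  have e1 : ∑ j, D' j (χ * ∑ i, C i j * D i φ) = ∑ i, ∑ j, D' j χ * C i j * D i φ +
      ∑ i, (∑ j, D' j (C i j)) * (χ * D i φ) + χ * ∑ i, ∑ j, C i j * D' j (D i φ) := by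
    simp only [Finset.mul_sum, Finset.sum_mul, map_sum, Derivation.leibniz, smul_eq_mul]
    rw [Finset.sum_comm]
    simp only [← Finset.sum_add_distrib]
    refine Finset.sum_congr rfl fun i _ => Finset.sum_congr rfl fun j _ => ?_
    ring
  have e2 : ∑ i, D i (φ * ∑ j, C i j * D' j χ) = ∑ i, ∑ j, D' j χ * C i j * D i φ +
      ∑ j, (∑ i, D i (C i j)) * (φ * D' j χ) + φ * ∑ i, ∑ j, C i j * D' j (D i χ) := by
    rw [Finset.sum_congr rfl fun j _ => Finset.sum_mul _ _ _, Finset.sum_comm (s := Finset.univ)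
      (f := fun j i => D i (C i j) * (φ * D' j χ))]
    simp only [Finset.mul_sum, map_sum, Derivation.leibniz, smul_eq_mul, ← hDD]
    simp only [← Finset.sum_add_distrib]
    refine Finset.sum_congr rfl fun i _ => Finset.sum_congr rfl fun j _ => ?_
    ring
  simp only [e1, e2, p1, p2, Matrix.trace, Matrix.diag, Matrix.mul_apply, cHess, Matrix.of_apply]
  simp

end Algebra

/-- The algebra of complex valued smooth functions. -/
def smoothAlg (n : ℕ) : Subalgebra ℂ ((Fin n → ℂ) → ℂ) where
  carrier := {f | ContDiff ℝ ∞ f}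
  mul_mem' hf hg := by rw [mem_ofPred_eq] at *; exact hf.mul hg
  add_mem' hf hg := by rw [mem_ofPred_eq] at *; exact hf.add hg
  algebraMap_mem' _ := by rw [mem_ofPred_eq]; exact contDiff_const

lemma smoothAlg_contDiff (f : smoothAlg n) : ContDiff ℝ ∞ (f : (Fin n → ℂ) → ℂ) := f.2

lemma smoothAlg_differentiable (f : smoothAlg n) : Differentiable ℝ (f : (Fin n → ℂ) → ℂ) :=
  (smoothAlg_contDiff f).differentiable (by simp)

/-- The directional derivative as a derivation. -/
def dirD (v : Fin n → ℂ) : Derivation ℂ (smoothAlg n) (smoothAlg n) where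
  toFun f := ⟨fun z => fderiv ℝ (f : (Fin n → ℂ) → ℂ) z v,
    ((smoothAlg_contDiff f).fderiv_right (m := ∞) (by simp)).clm_apply contDiff_const⟩
  map_add' f g := by
    ext z
    simp [fderiv_add (smoothAlg_differentiable f z) (smoothAlg_differentiable g z)]
  map_smul' c f := by
    ext z
    simp [fderiv_const_smul (smoothAlg_differentiable f z) c]
  map_one_eq_zero' := by
    ext z
    simp
  leibniz' f g := by
    ext z
    simp [fderiv_mul (smoothAlg_differentiable f z) (smoothAlg_differentiable g z)]

lemma dirD_apply (v : Fin n → ℂ) (f : smoothAlg n) (z : Fin n → ℂ) :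
    (dirD v f : (Fin n → ℂ) → ℂ) z = fderiv ℝ (f : (Fin n → ℂ) → ℂ) z v := rfl

lemma dirD_dirD (v w : Fin n → ℂ) (f : smoothAlg n) (z : Fin n → ℂ) :
    (dirD v (dirD w f) : (Fin n → ℂ) → ℂ) z =
      fderiv ℝ (fderiv ℝ (f : (Fin n → ℂ) → ℂ)) z v w := by
  rw [dirD_apply]
  have h : DifferentiableAt ℝ (fderiv ℝ (f : (Fin n → ℂ) → ℂ)) z :=
    ((smoothAlg_contDiff f).fderiv_right (m := ∞) (by simp)).differentiable (by simp) z
  have := (h.hasFDerivAt.clm_apply (hasFDerivAt_const w z)).fderiv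
  change fderiv ℝ (fun z => fderiv ℝ (f : (Fin n → ℂ) → ℂ) z w) z v = _
  rw [this]
  simp

lemma dirD_comm (v w : Fin n → ℂ) (f : smoothAlg n) : dirD v (dirD w f) = dirD w (dirD v f) := by
  ext z
  rw [dirD_dirD, dirD_dirD]
  exact (smoothAlg_contDiff f).contDiffAt.isSymmSndFDerivAt
    (by simp; exact WithTop.coe_le_coe.2 (le_top : (2 : ℕ∞) ≤ ⊤)) v w

/-- The derivation `∂ / ∂ z_j`. -/
def dz (j : Fin n) : Derivation ℂ (smoothAlg n) (smoothAlg n) :=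
  (1 / 2 : ℂ) • (dirD (n := n) (Pi.single j 1) - I • dirD (n := n) (I • Pi.single j 1))

/-- The derivation `∂ / ∂ conj z_j`. -/
def dzb (j : Fin n) : Derivation ℂ (smoothAlg n) (smoothAlg n) :=
  (1 / 2 : ℂ) • (dirD (n := n) (Pi.single j 1) + I • dirD (n := n) (I • Pi.single j 1))

lemma dz_apply (j : Fin n) (f : smoothAlg n) :
    dz j f = (1 / 2 : ℂ) • (dirD (Pi.single j 1) f - I • dirD (I • Pi.single j 1) f) := rfl

lemma dzb_apply (j : Fin n) (f : smoothAlg n) :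
    dzb j f = (1 / 2 : ℂ) • (dirD (Pi.single j 1) f + I • dirD (I • Pi.single j 1) f) := rfl

lemma dirD_lin (v : Fin n → ℂ) (c d : ℂ) (f g : smoothAlg n) :
    dirD v (c • (f + d • g)) = c • (dirD v f + d • dirD v g) := by
  rw [Derivation.map_smul, Derivation.map_add, Derivation.map_smul]

lemma dirD_lin' (v : Fin n → ℂ) (c d : ℂ) (f g : smoothAlg n) :
    dirD v (c • (f - d • g)) = c • (dirD v f - d • dirD v g) := by
  rw [Derivation.map_smul, Derivation.map_sub, Derivation.map_smul]

lemma dz_dz (i j : Fin n) (f : smoothAlg n) : dz i (dz j f) = dz j (dz i f) := by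
  simp only [dz_apply, dirD_lin']
  rw [dirD_comm (Pi.single i 1), dirD_comm (Pi.single i 1), dirD_comm (I • Pi.single i 1),
    dirD_comm (I • Pi.single i 1)]
  module

lemma dzb_dzb (i j : Fin n) (f : smoothAlg n) : dzb i (dzb j f) = dzb j (dzb i f) := by
  simp only [dzb_apply, dirD_lin]
  rw [dirD_comm (Pi.single i 1), dirD_comm (Pi.single i 1), dirD_comm (I • Pi.single i 1),
    dirD_comm (I • Pi.single i 1)]
  module

lemma dz_dzb (i j : Fin n) (f : smoothAlg n) : dz i (dzb j f) = dzb j (dz i f) := by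
  simp only [dz_apply, dzb_apply, dirD_lin, dirD_lin']
  rw [dirD_comm (Pi.single i 1), dirD_comm (Pi.single i 1), dirD_comm (I • Pi.single i 1),
    dirD_comm (I • Pi.single i 1)]
  module

lemma hasCompactSupport_dirD {f : smoothAlg n} (hf : HasCompactSupport (f : (Fin n → ℂ) → ℂ))
    (v : Fin n → ℂ) : HasCompactSupport (dirD v f : (Fin n → ℂ) → ℂ) :=
  hf.fderiv_apply (𝕜 := ℝ) v

lemma integrable_smooth {f : smoothAlg n} (hf : HasCompactSupport (f : (Fin n → ℂ) → ℂ)) :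
    Integrable (f : (Fin n → ℂ) → ℂ) :=
  (smoothAlg_contDiff f).continuous.integrable_of_hasCompactSupport hf

lemma integral_dirD {f : smoothAlg n} (hf : HasCompactSupport (f : (Fin n → ℂ) → ℂ))
    (v : Fin n → ℂ) : ∫ z, (dirD v f : (Fin n → ℂ) → ℂ) z = 0 := by
  have h1 : Integrable fun z => fderiv ℝ (f : (Fin n → ℂ) → ℂ) z v :=
    integrable_smooth (hasCompactSupport_dirD hf v)
  have h := integral_mul_fderiv_eq_neg_fderiv_mul_of_integrable (𝕜 := ℂ) (μ := volume)
    (f := fun _ : Fin n → ℂ => (1 : ℂ)) (g := (f : (Fin n → ℂ) → ℂ)) (v := v) (by simp)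
    (by simpa using h1) (by simpa using integrable_smooth hf)
    (fun x _ => differentiableAt_const _) (fun x _ => smoothAlg_differentiable f x)
  simpa only [dirD_apply, one_mul, fderiv_fun_const, Pi.zero_apply, zero_apply, zero_mul,
    integral_zero, neg_zero] using h

lemma integral_dz {f : smoothAlg n} (hf : HasCompactSupport (f : (Fin n → ℂ) → ℂ))
    (j : Fin n) : ∫ z, (dz j f : (Fin n → ℂ) → ℂ) z = 0 := by
  have h1 := integrable_smooth (hasCompactSupport_dirD hf (Pi.single j 1))
  have h2 := integrable_smooth (hasCompactSupport_dirD hf (I • Pi.single j 1))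
  have e : ∀ z, (dz j f : (Fin n → ℂ) → ℂ) z =
      (1 / 2 : ℂ) * ((dirD (Pi.single j 1) f : (Fin n → ℂ) → ℂ) z
    - I * (dirD (I • Pi.single j 1) f : (Fin n → ℂ) → ℂ) z) := fun z => rfl
  simp only [e]
  rw [integral_const_mul, integral_sub h1 (h2.const_mul I), integral_const_mul, integral_dirD hf,
    integral_dirD hf]
  simp

lemma integral_dzb {f : smoothAlg n} (hf : HasCompactSupport (f : (Fin n → ℂ) → ℂ))
    (j : Fin n) : ∫ z, (dzb j f : (Fin n → ℂ) → ℂ) z = 0 := by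
  have h1 := integrable_smooth (hasCompactSupport_dirD hf (Pi.single j 1))
  have h2 := integrable_smooth (hasCompactSupport_dirD hf (I • Pi.single j 1))
  have e : ∀ z, (dzb j f : (Fin n → ℂ) → ℂ) z =
      (1 / 2 : ℂ) * ((dirD (Pi.single j 1) f : (Fin n → ℂ) → ℂ) z
    + I * (dirD (I • Pi.single j 1) f : (Fin n → ℂ) → ℂ) z) := fun z => rfl
  simp only [e]
  rw [integral_const_mul, integral_add h1 (h2.const_mul I), integral_const_mul, integral_dirD hf,
    integral_dirD hf]
  simp

/-- The complex Hessian in the coordinates selected by `e`. -/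
def sHess {k : ℕ} (e : Fin k → Fin n) (f : smoothAlg n) : Matrix (Fin k) (Fin k) (smoothAlg n) :=
  cHess (fun i => dz (e i)) (fun i => dzb (e i)) f

lemma hasCompactSupport_dz {χ : smoothAlg n}
    (hχ : HasCompactSupport (χ : (Fin n → ℂ) → ℂ)) (j : Fin n) :
    HasCompactSupport (dz j χ : (Fin n → ℂ) → ℂ) := by
  have h1 := hasCompactSupport_dirD hχ (Pi.single j 1)
  have h2 := hasCompactSupport_dirD hχ (I • Pi.single j 1)
  exact HasCompactSupport.smul_left (f := fun _ => (1 / 2 : ℂ))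
    (h1.sub (HasCompactSupport.smul_left (f := fun _ => I) h2))

lemma hasCompactSupport_dzb {χ : smoothAlg n}
    (hχ : HasCompactSupport (χ : (Fin n → ℂ) → ℂ)) (j : Fin n) :
    HasCompactSupport (dzb j χ : (Fin n → ℂ) → ℂ) := by
  have h1 := hasCompactSupport_dirD hχ (Pi.single j 1)
  have h2 := hasCompactSupport_dirD hχ (I • Pi.single j 1)
  exact HasCompactSupport.smul_left (f := fun _ => (1 / 2 : ℂ))
    (h1.add (HasCompactSupport.smul_left (f := fun _ => I) h2))

/-- The ideal of compactly supported smooth functions. -/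
def ccIdeal (n : ℕ) : Ideal (smoothAlg n) where
  carrier := {f | HasCompactSupport (f : (Fin n → ℂ) → ℂ)}
  add_mem' hf hg := by rw [mem_ofPred_eq] at *; exact hf.add hg
  zero_mem' := by rw [mem_ofPred_eq]; exact HasCompactSupport.zero
  smul_mem' c f hf := by rw [mem_ofPred_eq] at *; exact HasCompactSupport.mul_left hf

lemma mem_ccIdeal {f : smoothAlg n} :
    f ∈ ccIdeal n ↔ HasCompactSupport (f : (Fin n → ℂ) → ℂ) := Iff.rfl

lemma integral_sub_cc {f g : smoothAlg n} (hf : f ∈ ccIdeal n) (hg : g ∈ ccIdeal n) :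
    ∫ z, ((f - g : smoothAlg n) : (Fin n → ℂ) → ℂ) z =
      (∫ z, (f : (Fin n → ℂ) → ℂ) z) - ∫ z, (g : (Fin n → ℂ) → ℂ) z :=
  integral_sub (integrable_smooth hf) (integrable_smooth hg)

/-- Compactly supported smooth functions with vanishing integral. -/
def nullSub (n : ℕ) : AddSubgroup (smoothAlg n) where
  carrier := {f | f ∈ ccIdeal n ∧ ∫ z, (f : (Fin n → ℂ) → ℂ) z = 0}
  add_mem' hf hg := by
    rw [mem_ofPred_eq] at *
    refine ⟨add_mem hf.1 hg.1, ?_⟩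
    have := integral_add (integrable_smooth hf.1) (integrable_smooth hg.1)
    rw [hf.2, hg.2, add_zero] at this
    exact this
  zero_mem' := by rw [mem_ofPred_eq]; exact ⟨zero_mem _, by simp⟩
  neg_mem' {f} hf := by
    rw [mem_ofPred_eq] at *
    refine ⟨neg_mem hf.1, ?_⟩
    have := integral_neg (μ := volume) (f : (Fin n → ℂ) → ℂ)
    rw [hf.2, neg_zero] at this
    exact this

lemma dz_mem_nullSub {f : smoothAlg n} (hf : f ∈ ccIdeal n) (j : Fin n) : dz j f ∈ nullSub n :=
  ⟨hasCompactSupport_dz hf j, integral_dz hf j⟩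

lemma dzb_mem_nullSub {f : smoothAlg n} (hf : f ∈ ccIdeal n) (j : Fin n) : dzb j f ∈ nullSub n :=
  ⟨hasCompactSupport_dzb hf j, integral_dzb hf j⟩

/-- Integration by parts against the cofactor matrix of a complex Hessian. -/
lemma integral_trace_adjugate {k : ℕ} (e : Fin k → Fin n) (f φ : smoothAlg n) {χ : smoothAlg n}
    (hχ : χ ∈ ccIdeal n) :
    φ * ((sHess e f).adjugate * sHess e χ).trace ∈ ccIdeal n ∧
    ∫ z, ((χ * ((sHess e f).adjugate * sHess e φ).trace : smoothAlg n) : (Fin n → ℂ) → ℂ) z =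
      ∫ z, ((φ * ((sHess e f).adjugate * sHess e χ).trace : smoothAlg n) : (Fin n → ℂ) → ℂ) z := by
  set a := χ * ((sHess e f).adjugate * sHess e φ).trace with ha
  set b := φ * ((sHess e f).adjugate * sHess e χ).trace with hb
  have hac : a ∈ ccIdeal n := Ideal.mul_mem_right _ _ hχ
  have hab : a - b ∈ nullSub n := by
    have h := cHess_div (fun i => dz (e i)) (fun i => dzb (e i)) (fun _ _ => dz_dz _ _)
      (fun _ _ => dzb_dzb _ _) (fun _ _ => dz_dzb _ _) f φ χ
    have h' : a - b = _ := h
    rw [h']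
    refine sub_mem (sum_mem fun j _ => ?_) (sum_mem fun i _ => ?_)
    · exact dzb_mem_nullSub (Ideal.mul_mem_right _ _ hχ) _
    · refine dz_mem_nullSub (Ideal.mul_mem_left _ _ (sum_mem fun j _ => ?_)) _
      exact Ideal.mul_mem_left _ _ (dzb_mem_nullSub hχ _).1
  have hbc : b ∈ ccIdeal n := by
    have := sub_mem hac hab.1
    rwa [sub_sub_cancel] at this
  refine ⟨hbc, sub_eq_zero.1 ?_⟩
  rw [← integral_sub_cc hac hbc]
  exact hab.2

/-- The sesquilinear form attached to the Levi form. -/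
def sesq (φ : (Fin n → ℂ) → ℝ) (z v w : Fin n → ℂ) : ℂ :=
  ((hess φ z v w + hess φ z (I • v) (I • w) : ℝ) +
    (hess φ z (I • v) w - hess φ z v (I • w) : ℝ) * I) / 4

/-- The matrix of the Levi form. -/
def leviM (φ : (Fin n → ℂ) → ℝ) (z : Fin n → ℂ) : Matrix (Fin n) (Fin n) ℂ :=
  Matrix.of fun p l => sesq φ z (Pi.single p 1) (Pi.single l 1)

/-- A smooth real function as an element of the algebra of smooth functions. -/
def toS {φ : (Fin n → ℂ) → ℝ} (hφ : ContDiff ℝ ∞ φ) : smoothAlg n :=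
  ⟨fun z => (φ z : ℂ), Complex.ofRealCLM.contDiff.comp hφ⟩

lemma dirD_toS {φ : (Fin n → ℂ) → ℝ} (hφ : ContDiff ℝ ∞ φ) (v : Fin n → ℂ) :
    dirD v (toS hφ) = toS ((contDiff_fderiv hφ).clm_apply (contDiff_const (c := v))) := by
  ext z
  have h := (Complex.ofRealCLM.hasFDerivAt (x := φ z)).comp z
    ((hφ.differentiable (by simp)) z).hasFDerivAt
  change fderiv ℝ (Complex.ofRealCLM ∘ φ) z v = _
  rw [h.fderiv]
  rfl

lemma dirD_dirD_toS {φ : (Fin n → ℂ) → ℝ} (hφ : ContDiff ℝ ∞ φ) (v w z : Fin n → ℂ) :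
    (dirD v (dirD w (toS hφ)) : (Fin n → ℂ) → ℂ) z = hess φ z v w := by
  rw [dirD_toS, dirD_toS]
  have h : DifferentiableAt ℝ (fderiv ℝ φ) z := (contDiff_fderiv hφ).differentiable (by simp) z
  have := (h.hasFDerivAt.clm_apply (hasFDerivAt_const w z)).fderiv
  change ((fderiv ℝ (fun z => fderiv ℝ φ z w) z v : ℝ) : ℂ) = _
  rw [this]
  simp [hess]

lemma dzb_dz_toS {φ : (Fin n → ℂ) → ℝ} (hφ : ContDiff ℝ ∞ φ) (p l : Fin n) (z : Fin n → ℂ) :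
    (dzb p (dz l (toS hφ)) : (Fin n → ℂ) → ℂ) z = leviM φ z p l := by
  rw [dz_apply, dzb_apply, dirD_lin', dirD_lin']
  change (1 / 2 : ℂ) * ((1 / 2 : ℂ) * ((dirD _ (dirD _ (toS hφ)) : (Fin n → ℂ) → ℂ) z -
    I * (dirD _ (dirD _ (toS hφ)) : (Fin n → ℂ) → ℂ) z) + I * ((1 / 2 : ℂ) *
    ((dirD _ (dirD _ (toS hφ)) : (Fin n → ℂ) → ℂ) z -
    I * (dirD _ (dirD _ (toS hφ)) : (Fin n → ℂ) → ℂ) z))) = _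
  simp only [dirD_dirD_toS, leviM, sesq, Matrix.of_apply]
  push_cast
  ring_nf
  rw [I_sq]
  ring

lemma sesq_self {φ : (Fin n → ℂ) → ℝ} (hφ : ContDiff ℝ ∞ φ) (z v : Fin n → ℂ) :
    sesq φ z v v = levi φ z v := by
  simp only [sesq, levi, hess_symm hφ z (I • v) v, sub_self]
  push_cast
  ring

lemma sesq_conj {φ : (Fin n → ℂ) → ℝ} (hφ : ContDiff ℝ ∞ φ) (z v w : Fin n → ℂ) :
    star (sesq φ z v w) = sesq φ z w v := by
  simp only [sesq, hess_symm hφ z w v, hess_symm hφ z (I • w) v, hess_symm hφ z (I • w) (I • v),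
    hess_symm hφ z w (I • v)]
  simp only [Complex.star_def, map_div₀, map_add, map_mul, Complex.conj_ofReal, Complex.conj_I,
    map_ofNat]
  push_cast
  ring

lemma sesq_add_right (φ : (Fin n → ℂ) → ℝ) (z v w w' : Fin n → ℂ) :
    sesq φ z v (w + w') = sesq φ z v w + sesq φ z v w' := by
  simp only [sesq, smul_add, map_add]
  push_cast
  ring

lemma sesq_smul_right (φ : (Fin n → ℂ) → ℝ) (z v w : Fin n → ℂ) (c : ℂ) :
    sesq φ z v (c • w) = c * sesq φ z v w := by
  have hI : I • I • w = -w := by rw [smul_smul, I_mul_I, neg_one_smul]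
  have h1 : I • (c • w) = c.re • (I • w) + c.im • (-w) := by
    rw [smul_comm, smul_eq_re_im c (I • w), hI]
  rw [sesq, h1, smul_eq_re_im c w]
  simp only [map_add, map_smul, map_neg, smul_eq_mul, sesq]
  have hc := (Complex.re_add_im c).symm
  generalize c.re = x at *
  generalize c.im = y at *
  subst hc
  push_cast
  ring_nf
  rw [I_sq]
  ring

/-- `z ↦ sesq φ z v w` is linear in `w`. -/
def sesqLin (φ : (Fin n → ℂ) → ℝ) (z v : Fin n → ℂ) : (Fin n → ℂ) →ₗ[ℂ] ℂ where
  toFun := sesq φ z v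
  map_add' := sesq_add_right φ z v
  map_smul' c w := sesq_smul_right φ z v w c

lemma sesq_eq_sum (φ : (Fin n → ℂ) → ℝ) (z v w : Fin n → ℂ) :
    sesq φ z v w = ∑ l, w l * sesq φ z v (Pi.single l 1) := by
  change sesqLin φ z v w = _
  conv_lhs => rw [pi_eq_sum_univ' w]
  rw [map_sum]
  refine Finset.sum_congr rfl fun l _ => ?_
  rw [map_smul, smul_eq_mul]
  rfl

lemma levi_eq_dotProduct {φ : (Fin n → ℂ) → ℝ} (hφ : ContDiff ℝ ∞ φ) (z v : Fin n → ℂ) :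
    (levi φ z v : ℂ) = star v ⬝ᵥ (leviM φ z).mulVec v := by
  rw [← sesq_self hφ, sesq_eq_sum]
  simp only [dotProduct, Matrix.mulVec, leviM, Matrix.of_apply, Pi.star_apply, Finset.mul_sum]
  rw [Finset.sum_comm]
  refine Finset.sum_congr rfl fun l _ => ?_
  rw [← sesq_conj hφ, sesq_eq_sum φ z _ v]
  rw [star_sum, Finset.mul_sum]
  refine Finset.sum_congr rfl fun p _ => ?_
  rw [star_mul', sesq_conj hφ]
  ring

lemma isHermitian_leviM {φ : (Fin n → ℂ) → ℝ} (hφ : ContDiff ℝ ∞ φ) (z : Fin n → ℂ) :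
    (leviM φ z).IsHermitian := by
  ext p l
  simp only [leviM, Matrix.conjTranspose_apply, Matrix.of_apply, sesq_conj hφ]

open scoped ComplexOrder MatrixOrder

section Matrix

variable {k : ℕ}

/-- The excess of the shifted principal minor of `B` selected by `e`. -/
def minorX (c : ℝ) (B : Matrix (Fin n) (Fin n) ℂ) (e : Fin k → Fin n) : ℝ :=
  (B.submatrix e e + (c : ℂ) • 1).det.re - c ^ k

lemma posDef_shift {c : ℝ} (hc : 0 < c) {B : Matrix (Fin k) (Fin k) ℂ} (hB : B.PosSemidef) :
    (B + (c : ℂ) • 1).PosDef :=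
  (Matrix.PosDef.one.smul (by exact_mod_cast hc)).posSemidef_add hB

lemma posSemidef_adjugate {A : Matrix (Fin k) (Fin k) ℂ} (hA : A.PosDef) :
    A.adjugate.PosSemidef := by
  have h : A.adjugate = A.det • A⁻¹ := by
    rw [Matrix.inv_def, smul_smul, Ring.mul_inverse_cancel _ hA.det_pos.ne'.isUnit, one_smul]
  rw [h]
  exact hA.inv.posSemidef.smul hA.det_pos.le

lemma exists_conjTranspose_mul_self {B : Matrix (Fin k) (Fin k) ℂ} (hB : B.PosSemidef) :
    ∃ C : Matrix (Fin k) (Fin k) ℂ, B = C.conjTranspose * C :=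
  CStarAlgebra.nonneg_iff_eq_star_mul_self.mp hB.nonneg

lemma trace_mul_nonneg {P B : Matrix (Fin k) (Fin k) ℂ} (hP : P.PosSemidef) (hB : B.PosSemidef) :
    0 ≤ (P * B).trace.re := by
  obtain ⟨C, rfl⟩ := exists_conjTranspose_mul_self hB
  rw [← mul_assoc, Matrix.trace_mul_comm, ← mul_assoc]
  exact (Complex.le_def.1 (hP.mul_mul_conjTranspose_same C).trace_nonneg).1

lemma submatrix_shift (c : ℝ) (B : Matrix (Fin n) (Fin n) ℂ) (e : Fin (k + 1) → Fin n)
    (i : Fin (k + 1)) :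
    (B.submatrix e e + (c : ℂ) • 1).submatrix i.succAbove i.succAbove =
      B.submatrix (e ∘ i.succAbove) (e ∘ i.succAbove) + (c : ℂ) • 1 := by
  rw [Matrix.submatrix_add, Matrix.submatrix_smul]
  simp only [Pi.add_apply, Pi.smul_apply, Matrix.submatrix_submatrix]
  rw [Matrix.submatrix_one _ Fin.succAbove_right_injective]

lemma trace_adjugate_shift (c : ℝ) (B : Matrix (Fin n) (Fin n) ℂ) (e : Fin (k + 1) → Fin n) :
    (B.submatrix e e + (c : ℂ) • 1).adjugate.trace.re =
      ∑ i : Fin (k + 1), (minorX c B (e ∘ i.succAbove) + c ^ k) := by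
  rw [Matrix.trace, Complex.re_sum]
  refine Finset.sum_congr rfl fun i _ => ?_
  rw [Matrix.diag_apply, Matrix.adjugate_fin_succ_eq_det_submatrix, submatrix_shift, minorX,
    sub_add_cancel, Even.neg_one_pow ⟨_, rfl⟩, one_mul]

lemma minorX_succ (c : ℝ) (B : Matrix (Fin n) (Fin n) ℂ) (e : Fin (k + 1) → Fin n) :
    (k + 1) * minorX c B e =
      ((B.submatrix e e + (c : ℂ) • 1).adjugate * B.submatrix e e).trace.re +
        c * ∑ i : Fin (k + 1), minorX c B (e ∘ i.succAbove) := by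
  set A := B.submatrix e e + (c : ℂ) • 1 with hA
  have h1 : A.adjugate * B.submatrix e e = A.adjugate * A - (c : ℂ) • A.adjugate := by
    have : B.submatrix e e = A - (c : ℂ) • 1 := by rw [hA, add_sub_cancel_right]
    rw [this, mul_sub, mul_smul_comm, mul_one]
  have h2 := trace_adjugate_shift c B e
  rw [← hA, Finset.sum_add_distrib] at h2
  have h3 : minorX c B e = A.det.re - c ^ (k + 1) := rfl
  rw [h1, Matrix.adjugate_mul, Matrix.trace_sub, Matrix.trace_smul, Matrix.trace_smul,
    Matrix.trace_one, Complex.sub_re, smul_eq_mul, smul_eq_mul, Complex.re_ofReal_mul, h2, h3,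
    Fintype.card_fin, mul_comm A.det, ← Complex.ofReal_natCast, Complex.re_ofReal_mul]
  simp only [Finset.sum_const, Finset.card_univ, Fintype.card_fin, nsmul_eq_mul]
  push_cast
  ring

lemma minorX_nonneg {c : ℝ} (hc : 0 < c) {B : Matrix (Fin n) (Fin n) ℂ} (hB : B.PosSemidef)
    (e : Fin k → Fin n) : 0 ≤ minorX c B e := by
  induction k with
  | zero => simp [minorX]
  | succ k ih =>
    have h := minorX_succ c B e
    have h1 := trace_mul_nonneg (posSemidef_adjugate (posDef_shift hc (hB.submatrix e)))
      (hB.submatrix e)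
    have h2 : 0 ≤ c * ∑ i : Fin (k + 1), minorX c B (e ∘ i.succAbove) :=
      mul_nonneg hc.le (Finset.sum_nonneg fun i _ => ih _)
    have h3 : 0 ≤ ((k : ℝ) + 1) * minorX c B e := by rw [h]; exact add_nonneg h1 h2
    exact nonneg_of_mul_nonneg_right h3 (by positivity)

lemma norm_le_of_posSemidef {P : Matrix (Fin k) (Fin k) ℂ} (hP : P.PosSemidef) (i j : Fin k) :
    ‖P i j‖ ≤ P.trace.re := by
  obtain ⟨C, rfl⟩ := exists_conjTranspose_mul_self hP
  have ht : (C.conjTranspose * C).trace.re = ∑ l, ∑ a, ‖C l a‖ ^ 2 := by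
    rw [Finset.sum_comm, Matrix.trace, Complex.re_sum]
    refine Finset.sum_congr rfl fun a _ => ?_
    rw [Matrix.diag_apply, Matrix.mul_apply, Complex.re_sum]
    refine Finset.sum_congr rfl fun l _ => ?_
    rw [Matrix.conjTranspose_apply, Complex.star_def, Complex.conj_mul', ← Complex.ofReal_pow,
      Complex.ofReal_re]
  rw [ht, Matrix.mul_apply]
  refine (norm_sum_le _ _).trans (Finset.sum_le_sum fun l _ => ?_)
  rw [Matrix.conjTranspose_apply, norm_mul, norm_star]
  have hle : ∀ a, ‖C l a‖ ^ 2 ≤ ∑ a, ‖C l a‖ ^ 2 := fun a =>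
    Finset.single_le_sum (f := fun a => ‖C l a‖ ^ 2) (fun _ _ => by positivity)
      (Finset.mem_univ a)
  nlinarith [hle i, hle j, sq_nonneg (‖C l i‖ - ‖C l j‖)]

lemma abs_trace_mul_le {P M : Matrix (Fin k) (Fin k) ℂ} (hP : P.PosSemidef) {K : ℝ}
    (hM : ∀ i j, ‖M i j‖ ≤ K) : |(P * M).trace.re| ≤ k ^ 2 * K * P.trace.re := by
  refine (Complex.abs_re_le_norm _).trans ?_
  simp only [Matrix.trace, Matrix.diag, Matrix.mul_apply]
  calc ‖∑ i, ∑ j, P i j * M j i‖ ≤ ∑ i, ∑ j, ‖P i j * M j i‖ :=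
        (norm_sum_le _ _).trans (Finset.sum_le_sum fun i _ => norm_sum_le _ _)
    _ ≤ ∑ _i : Fin k, ∑ _j : Fin k, P.trace.re * K := by
        gcongr with i _ j _
        rw [norm_mul]
        exact mul_le_mul (norm_le_of_posSemidef hP i j) (hM j i) (norm_nonneg _)
          ((norm_nonneg _).trans (norm_le_of_posSemidef hP i j))
    _ = _ := by
        simp only [Finset.sum_const, Finset.card_univ, Fintype.card_fin, nsmul_eq_mul, Matrix.trace,
          Matrix.diag]
        ring

end Matrix

/-- The quadratic function `c * ∑ ‖z i - a i‖ ^ 2`. -/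
def quad (c : ℝ) (a z : Fin n → ℂ) : ℝ := c * ∑ i, ‖z i - a i‖ ^ 2

/-- Coordinates as smooth functions. -/
def coordS (a : Fin n → ℂ) (i : Fin n) : smoothAlg n :=
  ⟨fun z => z i - a i, show ContDiff ℝ ∞ (fun z : Fin n → ℂ => z i - a i) from
    (contDiff_apply ℝ ℂ i).sub contDiff_const⟩

/-- Conjugate coordinates as smooth functions. -/
def coordSb (a : Fin n → ℂ) (i : Fin n) : smoothAlg n :=
  ⟨fun z => (starRingEnd ℂ) (z i - a i),
    show ContDiff ℝ ∞ (fun z : Fin n → ℂ => (starRingEnd ℂ) (z i - a i)) from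
    Complex.conjCLE.contDiff.comp ((contDiff_apply ℝ ℂ i).sub contDiff_const)⟩

lemma contDiff_quad (c : ℝ) (a : Fin n → ℂ) : ContDiff ℝ ∞ (quad c a) := by
  unfold quad
  exact contDiff_const.mul (ContDiff.sum fun i _ =>
    ((contDiff_apply ℝ ℂ i).sub contDiff_const).norm_sq ℝ)

lemma toS_add {φ ψ : (Fin n → ℂ) → ℝ} (hφ : ContDiff ℝ ∞ φ) (hψ : ContDiff ℝ ∞ ψ) :
    toS (hφ.add hψ) = toS hφ + toS hψ := by
  ext z
  exact Complex.ofReal_add _ _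

lemma toS_quad (c : ℝ) (a : Fin n → ℂ) :
    toS (contDiff_quad c a) = (c : ℂ) • ∑ i, coordS a i * coordSb a i := by
  ext z
  have h : ((∑ i, coordS a i * coordSb a i : smoothAlg n) : (Fin n → ℂ) → ℂ) z =
      ∑ i, (z i - a i) * (starRingEnd ℂ) (z i - a i) := by
    rw [AddSubmonoidClass.coe_finsetSum, Finset.sum_apply]
    rfl
  change ((quad c a z : ℝ) : ℂ) =
    (c : ℂ) * ((∑ i, coordS a i * coordSb a i : smoothAlg n) : (Fin n → ℂ) → ℂ) z
  rw [h, quad]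
  push_cast
  simp only [Complex.mul_conj']

lemma dirD_coordS (a v : Fin n → ℂ) (i : Fin n) :
    dirD v (coordS a i) = algebraMap ℂ (smoothAlg n) (v i) := by
  ext z
  have h : HasFDerivAt (fun z : Fin n → ℂ => z i - a i)
      (ContinuousLinearMap.proj (R := ℝ) (φ := fun _ : Fin n => ℂ) i) z :=
    (ContinuousLinearMap.proj (R := ℝ) (φ := fun _ : Fin n => ℂ) i).hasFDerivAt.sub_const _
  change fderiv ℝ (fun z : Fin n → ℂ => z i - a i) z v = v i
  rw [h.fderiv]
  rfl

lemma dirD_coordSb (a v : Fin n → ℂ) (i : Fin n) :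
    dirD v (coordSb a i) = algebraMap ℂ (smoothAlg n) ((starRingEnd ℂ) (v i)) := by
  ext z
  have h : HasFDerivAt (fun z : Fin n → ℂ => z i - a i)
      (ContinuousLinearMap.proj (R := ℝ) (φ := fun _ : Fin n => ℂ) i) z :=
    (ContinuousLinearMap.proj (R := ℝ) (φ := fun _ : Fin n => ℂ) i).hasFDerivAt.sub_const _
  have h2 := (Complex.conjCLE : ℂ →L[ℝ] ℂ).hasFDerivAt.comp z h
  change fderiv ℝ ((Complex.conjCLE : ℂ →L[ℝ] ℂ) ∘ (fun z : Fin n → ℂ => z i - a i)) z v = _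
  rw [h2.fderiv]
  rfl

lemma dz_coordS (a : Fin n → ℂ) (l i : Fin n) :
    dz l (coordS a i) = algebraMap ℂ (smoothAlg n) (if i = l then 1 else 0) := by
  rw [dz_apply, dirD_coordS, dirD_coordS]
  ext z
  change (1 / 2 : ℂ) * ((Pi.single l 1 : Fin n → ℂ) i - I * (I * (Pi.single l 1 : Fin n → ℂ) i)) =
    if i = l then 1 else 0
  rw [Pi.single_apply, ← mul_assoc, I_mul_I]
  split_ifs <;> ring

lemma dz_coordSb (a : Fin n → ℂ) (l i : Fin n) : dz l (coordSb a i) = 0 := by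
  rw [dz_apply, dirD_coordSb, dirD_coordSb]
  ext z
  change (1 / 2 : ℂ) * ((starRingEnd ℂ) ((Pi.single l 1 : Fin n → ℂ) i) -
    I * (starRingEnd ℂ) (I * (Pi.single l 1 : Fin n → ℂ) i)) = 0
  rw [map_mul, conj_I, ← mul_assoc, mul_neg, I_mul_I]
  ring

lemma dzb_coordSb (a : Fin n → ℂ) (l i : Fin n) :
    dzb l (coordSb a i) = algebraMap ℂ (smoothAlg n) (if i = l then 1 else 0) := by
  rw [dzb_apply, dirD_coordSb, dirD_coordSb]
  ext z
  change (1 / 2 : ℂ) * ((starRingEnd ℂ) ((Pi.single l 1 : Fin n → ℂ) i) +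
    I * (starRingEnd ℂ) (I * (Pi.single l 1 : Fin n → ℂ) i)) = if i = l then 1 else 0
  rw [map_mul, conj_I, ← mul_assoc, mul_neg, I_mul_I, Pi.single_apply]
  split_ifs <;> simp
  norm_num

lemma dzb_dz_quad (c : ℝ) (a : Fin n → ℂ) (p l : Fin n) :
    dzb p (dz l (toS (contDiff_quad c a))) =
      algebraMap ℂ (smoothAlg n) ((c : ℂ) * if p = l then 1 else 0) := by
  have h : dz l (toS (contDiff_quad c a)) = (c : ℂ) • coordSb a l := by
    rw [toS_quad, Derivation.map_smul, map_sum]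
    congr 1
    rw [Finset.sum_eq_single l]
    · rw [Derivation.leibniz, dz_coordSb, dz_coordS, if_pos rfl, map_one, smul_zero, zero_add,
        smul_eq_mul, mul_one]
    · intro b _ hb
      rw [Derivation.leibniz, dz_coordSb, dz_coordS, if_neg hb, map_zero, smul_zero, smul_zero,
        add_zero]
    · exact fun h => absurd (Finset.mem_univ l) h
  rw [h, Derivation.map_smul, dzb_coordSb, map_mul, Algebra.smul_def]
  simp only [eq_comm]

lemma leviM_add {φ ψ : (Fin n → ℂ) → ℝ} (hφ : ContDiff ℝ ∞ φ) (hψ : ContDiff ℝ ∞ ψ)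
    (z : Fin n → ℂ) : leviM (fun y => φ y + ψ y) z = leviM φ z + leviM ψ z := by
  ext p l
  rw [Matrix.add_apply, ← dzb_dz_toS hφ, ← dzb_dz_toS hψ, ← dzb_dz_toS (hφ.add hψ), toS_add,
    Derivation.map_add, Derivation.map_add]
  rfl

lemma leviM_quad (c : ℝ) (a z : Fin n → ℂ) : leviM (quad c a) z = (c : ℂ) • 1 := by
  ext p l
  rw [← dzb_dz_toS (contDiff_quad c a), dzb_dz_quad, Matrix.smul_apply, Matrix.one_apply]
  rfl

lemma leviM_add_quad {φ : (Fin n → ℂ) → ℝ} (hφ : ContDiff ℝ ∞ φ) (c : ℝ) (a z : Fin n → ℂ) :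
    leviM (fun y => φ y + quad c a y) z = leviM φ z + (c : ℂ) • 1 := by
  rw [leviM_add hφ (contDiff_quad c a), leviM_quad]

lemma posSemidef_leviM {φ : (Fin n → ℂ) → ℝ} (hφ : ContDiff ℝ ∞ φ) {z : Fin n → ℂ}
    (h : ∀ v, 0 ≤ levi φ z v) : (leviM φ z).PosSemidef := by
  refine Matrix.PosSemidef.of_dotProduct_mulVec_nonneg (isHermitian_leviM hφ z) fun v => ?_
  rw [← levi_eq_dotProduct hφ]
  exact_mod_cast h v

/-- Evaluation of smooth functions. -/
def evS (z : Fin n → ℂ) : smoothAlg n →+* ℂ :=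
  (Pi.evalRingHom (fun _ : Fin n → ℂ => ℂ) z).comp (smoothAlg n).val.toRingHom

lemma evS_apply (z : Fin n → ℂ) (f : smoothAlg n) : evS z f = (f : (Fin n → ℂ) → ℂ) z := rfl

lemma map_sHess {k : ℕ} (e : Fin k → Fin n) {φ : (Fin n → ℂ) → ℝ} (hφ : ContDiff ℝ ∞ φ)
    (z : Fin n → ℂ) : (evS z).mapMatrix (sHess e (toS hφ)) = (leviM φ z).submatrix e e := by
  ext i j
  exact dzb_dz_toS hφ (e i) (e j) z

lemma map_sHess_add_quad {k : ℕ} {e : Fin k → Fin n} (he : Function.Injective e)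
    {φ : (Fin n → ℂ) → ℝ} (hφ : ContDiff ℝ ∞ φ) (c : ℝ) (a z : Fin n → ℂ) :
    (evS z).mapMatrix (sHess e (toS (hφ.add (contDiff_quad c a)))) =
      (leviM φ z).submatrix e e + (c : ℂ) • 1 := by
  rw [map_sHess, leviM_add_quad hφ, Matrix.submatrix_add, Matrix.submatrix_smul]
  simp only [Pi.add_apply, Pi.smul_apply]
  rw [Matrix.submatrix_one _ he]

lemma evS_trace {k : ℕ} (z : Fin n → ℂ) (A B : Matrix (Fin k) (Fin k) (smoothAlg n)) :
    evS z (A.adjugate * B).trace =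
      (((evS z).mapMatrix A).adjugate * (evS z).mapMatrix B).trace := by
  rw [← RingHom.map_adjugate, ← map_mul, RingHom.mapMatrix_apply, ← AddMonoidHom.coe_coe,
    AddMonoidHom.map_trace]

lemma continuous_leviM {φ : (Fin n → ℂ) → ℝ} (hφ : ContDiff ℝ ∞ φ) : Continuous (leviM φ) := by
  refine continuous_matrix fun i j => ?_
  have : (fun z => leviM φ z i j) = (dzb i (dz j (toS hφ)) : (Fin n → ℂ) → ℂ) := by
    ext z
    exact (dzb_dz_toS hφ i j z).symm
  rw [this]
  exact (smoothAlg_contDiff _).continuous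

lemma continuous_minorX {k : ℕ} {φ : (Fin n → ℂ) → ℝ} (hφ : ContDiff ℝ ∞ φ) (c : ℝ)
    (e : Fin k → Fin n) : Continuous fun z => minorX c (leviM φ z) e := by
  unfold minorX
  exact (Complex.continuous_re.comp (((continuous_leviM hφ).matrix_submatrix e e).add
    continuous_const).matrix_det).sub continuous_const

variable {k : ℕ}

lemma integrableOn_ball {g : (Fin n → ℂ) → ℝ} (hg : Continuous g) (z : Fin n → ℂ) (ρ : ℝ) :
    IntegrableOn g (Metric.ball z ρ) :=
  (hg.locallyIntegrable.integrableOn_isCompact (isCompact_closedBall z ρ)).mono_set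
    Metric.ball_subset_closedBall

/-- The trace of the adjugate of a shifted Levi matrix against another Levi matrix. -/
def adjTr (c : ℝ) (e : Fin k → Fin n) (φ ψ : (Fin n → ℂ) → ℝ) (z : Fin n → ℂ) : ℝ :=
  (((leviM φ z).submatrix e e + (c : ℂ) • 1).adjugate * (leviM ψ z).submatrix e e).trace.re

lemma continuous_adjTr (c : ℝ) (e : Fin k → Fin n) {φ ψ : (Fin n → ℂ) → ℝ} (hφ : ContDiff ℝ ∞ φ)
    (hψ : ContDiff ℝ ∞ ψ) : Continuous (adjTr c e φ ψ) := by
  unfold adjTr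
  exact Complex.continuous_re.comp (((((continuous_leviM hφ).matrix_submatrix e e).add
    continuous_const).matrix_adjugate.matrix_mul
      ((continuous_leviM hψ).matrix_submatrix e e)).matrix_trace)

lemma integral_adjTr (c : ℝ) {e : Fin k → Fin n} (he : Function.Injective e)
    {φ χ : (Fin n → ℂ) → ℝ} (hφ : ContDiff ℝ ∞ φ) (hχ : ContDiff ℝ ∞ χ)
    (hχc : HasCompactSupport χ) :
    ∫ z, χ z * adjTr c e φ φ z = ∫ z, φ z * adjTr c e φ χ z := by
  set f := toS (hφ.add (contDiff_quad c (0 : Fin n → ℂ))) with hf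
  have hcc : toS hχ ∈ ccIdeal n := hχc.comp_left (g := fun x : ℝ => (x : ℂ)) Complex.ofReal_zero
  have key := integral_trace_adjugate e f (toS hφ) hcc
  have hval : ∀ {α β : (Fin n → ℂ) → ℝ} (hα : ContDiff ℝ ∞ α) (hβ : ContDiff ℝ ∞ β)
      (z : Fin n → ℂ), ((toS hα * ((sHess e f).adjugate * sHess e (toS hβ)).trace :
        smoothAlg n) : (Fin n → ℂ) → ℂ) z = (α z : ℂ) * (((leviM φ z).submatrix e e +
          (c : ℂ) • 1).adjugate * (leviM β z).submatrix e e).trace := by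
    intro α β hα hβ z
    rw [← evS_apply, map_mul, evS_trace, hf, map_sHess_add_quad he hφ, map_sHess]
    rfl
  have i1 := integrable_smooth (mem_ccIdeal.1 (Ideal.mul_mem_right
    ((sHess e f).adjugate * sHess e (toS hφ)).trace _ hcc))
  have i2 := integrable_smooth (mem_ccIdeal.1 key.1)
  have h1 := (integral_re i1).trans ((congrArg RCLike.re key.2).trans (integral_re i2).symm)
  simp only [hval, RCLike.re_eq_complex_re, Complex.re_ofReal_mul] at h1
  exact h1

lemma minorX_integral_step {c : ℝ} (hc : 0 < c) {z₀ : Fin n → ℂ} {R ρ ρ' K : ℝ}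
    (hρ' : ρ' ≤ R) {χ : (Fin n → ℂ) → ℝ} (hχ : ContDiff ℝ ∞ χ)
    (hχc : HasCompactSupport χ) (hχ0 : ∀ z, 0 ≤ χ z) (hχ1 : ∀ z ∈ Metric.ball z₀ ρ, χ z = 1)
    (hχs : ∀ z ∉ Metric.ball z₀ ρ', χ z = 0) (hχl : ∀ z ∉ Metric.ball z₀ ρ', leviM χ z = 0)
    (hρρ : ρ ≤ ρ')
    (hK0 : 0 ≤ K) (hK : ∀ z i j, ‖leviM χ z i j‖ ≤ K) {φ : (Fin n → ℂ) → ℝ} (hφ : Good z₀ R φ)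
    {e : Fin (k + 1) → Fin n} (he : Function.Injective e) :
    (k + 1) * ∫ z in Metric.ball z₀ ρ, minorX c (leviM φ z) e ≤
      (k + 1) ^ 2 * K * (∑ i : Fin (k + 1), (∫ z in Metric.ball z₀ ρ',
        minorX c (leviM φ z) (e ∘ i.succAbove)) +
        (k + 1) * c ^ k * ∫ z in Metric.ball z₀ ρ', -φ z) +
      c * ∑ i : Fin (k + 1), ∫ z in Metric.ball z₀ ρ,
        minorX c (leviM φ z) (e ∘ i.succAbove) := by
  have hpsd : ∀ z ∈ Metric.ball z₀ R, (leviM φ z).PosSemidef := fun z hz =>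
    posSemidef_leviM hφ.smooth (hφ.levi_nonneg z hz)
  have hinteg : ∀ {m : ℕ} (e' : Fin m → Fin n) (s : ℝ),
      IntegrableOn (fun z => minorX c (leviM φ z) e') (Metric.ball z₀ s) := fun e' s =>
    integrableOn_ball (continuous_minorX hφ.smooth c e') z₀ s
  have h1 : (k + 1) * ∫ z in Metric.ball z₀ ρ, minorX c (leviM φ z) e =
      (∫ z in Metric.ball z₀ ρ, adjTr c e φ φ z) +
        c * ∑ i : Fin (k + 1), ∫ z in Metric.ball z₀ ρ,
          minorX c (leviM φ z) (e ∘ i.succAbove) := by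
    rw [← integral_const_mul, ← integral_finsetSum _ fun i _ => hinteg _ _, ← integral_const_mul,
      ← integral_add (integrableOn_ball (continuous_adjTr c e hφ.smooth hφ.smooth) z₀ ρ)
        ((integrable_finsetSum _ fun i _ => hinteg _ _).const_mul c)]
    exact integral_congr_ae (Eventually.of_forall fun z => minorX_succ c (leviM φ z) e)
  rw [h1]
  gcongr
  have h2 : ∫ z in Metric.ball z₀ ρ, adjTr c e φ φ z ≤ ∫ z, χ z * adjTr c e φ φ z := by
    have hcont := continuous_adjTr c e hφ.smooth hφ.smooth
    rw [← setIntegral_eq_integral_of_forall_compl_eq_zero (s := Metric.ball z₀ ρ')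
      (f := fun z => χ z * adjTr c e φ φ z) fun z hz => by rw [hχs z hz, zero_mul]]
    calc ∫ z in Metric.ball z₀ ρ, adjTr c e φ φ z
        = ∫ z in Metric.ball z₀ ρ, χ z * adjTr c e φ φ z :=
          setIntegral_congr_fun measurableSet_ball fun z hz => by simp only [hχ1 z hz, one_mul]
      _ ≤ _ := by
          refine setIntegral_mono_set (integrableOn_ball (hχ.continuous.mul hcont) _ _) ?_
            (Metric.ball_subset_ball hρρ).eventuallyLE
          filter_upwards [ae_restrict_mem measurableSet_ball] with z hz
          have hz' := Metric.ball_subset_ball hρ' hz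
          exact mul_nonneg (hχ0 z) (trace_mul_nonneg (posSemidef_adjugate (posDef_shift hc
            ((hpsd z hz').submatrix e))) ((hpsd z hz').submatrix e))
  refine h2.trans ?_
  rw [integral_adjTr c he hφ.smooth hχ hχc,
    ← setIntegral_eq_integral_of_forall_compl_eq_zero (s := Metric.ball z₀ ρ')
      (f := fun z => φ z * adjTr c e φ χ z) fun z hz => by simp [adjTr, hχl z hz]]
  have hneg : IntegrableOn (fun z => -φ z) (Metric.ball z₀ ρ') :=
    integrableOn_ball hφ.smooth.continuous.neg _ _
  rw [← integral_finsetSum _ fun i _ => hinteg _ _, ← integral_const_mul,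
    ← integral_add (integrable_finsetSum _ fun i _ => hinteg _ _)
      (hneg.const_mul _), ← integral_const_mul]
  refine setIntegral_mono_on
    (integrableOn_ball (hφ.smooth.continuous.mul (continuous_adjTr c e hφ.smooth hχ)) _ _)
    (((integrable_finsetSum _ fun i _ => hinteg _ _).add
      (hneg.const_mul _)).const_mul _)
    measurableSet_ball fun z hz => ?_
  have hz' := hpsd z (Metric.ball_subset_ball hρ' hz)
  have h3 := abs_trace_mul_le (posSemidef_adjugate (posDef_shift hc (hz'.submatrix e)))
    (M := (leviM χ z).submatrix e e) (fun i j => hK z _ _)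
  rw [trace_adjugate_shift, Finset.sum_add_distrib] at h3
  simp only [Finset.sum_const, Finset.card_univ, Fintype.card_fin, nsmul_eq_mul] at h3
  have h4 : φ z * adjTr c e φ χ z ≤ -φ z * |adjTr c e φ χ z| := by
    rw [neg_mul, ← mul_neg]
    exact mul_le_mul_of_nonpos_left (neg_abs_le _) (hφ.upper z)
  have h5 := hφ.lower z
  have h6 := hφ.upper z
  have h7 : 0 ≤ ∑ i : Fin (k + 1), minorX c (leviM φ z) (e ∘ i.succAbove) :=
    Finset.sum_nonneg fun i _ => minorX_nonneg hc hz' _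
  push_cast at h3
  calc φ z * adjTr c e φ χ z ≤ -φ z * |adjTr c e φ χ z| := h4
    _ ≤ -φ z * ((k + 1) ^ 2 * K *
        (∑ i : Fin (k + 1), minorX c (leviM φ z) (e ∘ i.succAbove) + (k + 1) * c ^ k)) :=
        mul_le_mul_of_nonneg_left h3 (by linarith)
    _ = (k + 1) ^ 2 * K * ((-φ z) * ∑ i : Fin (k + 1), minorX c (leviM φ z) (e ∘ i.succAbove) +
          (k + 1) * c ^ k * -φ z) := by ring
    _ ≤ _ := by
        gcongr
        exact mul_le_of_le_one_left h7 (by linarith)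

lemma leviM_eq_zero_of_notMem_tsupport {χ : (Fin n → ℂ) → ℝ} {z : Fin n → ℂ}
    (hz : z ∉ tsupport χ) : leviM χ z = 0 := by
  have h : hess χ z = 0 := by
    have := notMem_subset ((tsupport_fderiv_subset ℝ (f := fderiv ℝ χ)).trans
      (tsupport_fderiv_subset ℝ)) hz
    exact image_eq_zero_of_notMem_tsupport this
  ext i j
  simp [leviM, sesq, h]

lemma exists_bound_leviM {χ : (Fin n → ℂ) → ℝ} (hχ : ContDiff ℝ ∞ χ) (hχc : HasCompactSupport χ) :
    ∃ K, 0 ≤ K ∧ ∀ z i j, ‖leviM χ z i j‖ ≤ K := by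
  have h : ∀ i j, ∃ C, ∀ z, ‖leviM χ z i j‖ ≤ C := fun i j =>
    ((continuous_leviM hχ).matrix_elem i j).bounded_above_of_compact_support
      (hχc.mono' fun z hz => by
        by_contra h
        exact hz (congrFun (congrFun (leviM_eq_zero_of_notMem_tsupport h) i) j))
  choose C hC using h
  refine ⟨∑ i, ∑ j, |C i j|, by positivity, fun z i j => (hC i j z).trans ?_⟩
  exact (le_abs_self _).trans ((Finset.single_le_sum (f := fun j => |C i j|)
    (fun _ _ => abs_nonneg _) (Finset.mem_univ j)).trans
    (Finset.single_le_sum (f := fun i => ∑ j, |C i j|)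
    (fun _ _ => Finset.sum_nonneg fun _ _ => abs_nonneg _) (Finset.mem_univ i)))

/-- Chern-Levine-Nirenberg type estimate for principal minors of the Levi matrix. -/
lemma minorX_integral_bound {c : ℝ} (hc : 0 < c) (z₀ : Fin n → ℂ) (R : ℝ) (k : ℕ) :
    ∀ ρ, 0 < ρ → ρ < R → ∃ C, 0 ≤ C ∧ ∀ φ, Good z₀ R φ → ∀ e : Fin k → Fin n,
      Function.Injective e → ∫ z in Metric.ball z₀ ρ, minorX c (leviM φ z) e ≤
        C * ∫ z in Metric.ball z₀ R, -φ z := by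
  induction k with
  | zero =>
    intro ρ _ _
    refine ⟨0, le_rfl, fun φ _ e _ => ?_⟩
    simp [minorX]
  | succ k ih =>
    intro ρ hρ hρR
    obtain ⟨C₁, hC₁, h₁⟩ := ih ρ hρ hρR
    obtain ⟨C₂, hC₂, h₂⟩ := ih ((ρ + R) / 2) (by linarith) (by linarith)
    let χ : ContDiffBump z₀ := ⟨ρ, (3 * ρ + R) / 4, hρ, by linarith⟩
    have hχ : ContDiff ℝ ∞ χ := χ.contDiff
    obtain ⟨K, hK0, hK⟩ := exists_bound_leviM hχ χ.hasCompactSupport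
    have hts : ∀ z ∉ Metric.ball z₀ ((ρ + R) / 2), z ∉ tsupport χ := by
      intro z hz h
      rw [χ.tsupport_eq, Metric.mem_closedBall] at h
      rw [Metric.mem_ball, not_lt] at hz
      have : χ.rOut = (3 * ρ + R) / 4 := rfl
      linarith
    refine ⟨(k + 1) ^ 2 * K * ((k + 1) * C₂ + (k + 1) * c ^ k) + c * ((k + 1) * C₁),
      by positivity, fun φ hφ e he => ?_⟩
    have hstep := minorX_integral_step hc (z₀ := z₀) (R := R) (ρ := ρ) (ρ' := (ρ + R) / 2)
      (by linarith) hχ χ.hasCompactSupport (fun z => χ.nonneg)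
      (fun z hz => χ.one_of_mem_closedBall (Metric.ball_subset_closedBall hz))
      (fun z hz => image_eq_zero_of_notMem_tsupport (hts z hz))
      (fun z hz => leviM_eq_zero_of_notMem_tsupport (hts z hz)) (by linarith) hK0 hK hφ he
    set J := ∫ z in Metric.ball z₀ R, -φ z with hJ
    have hinj : ∀ i : Fin (k + 1), Function.Injective (e ∘ i.succAbove) := fun i =>
      he.comp Fin.succAbove_right_injective
    have hJ' : ∫ z in Metric.ball z₀ ((ρ + R) / 2), -φ z ≤ J := by
      refine setIntegral_mono_set (integrableOn_ball hφ.smooth.continuous.neg _ _) ?_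
        (Metric.ball_subset_ball (by linarith)).eventuallyLE
      exact Eventually.of_forall fun z => neg_nonneg.2 (hφ.upper z)
    have hs : ∀ (C s : ℝ), (∀ e : Fin k → Fin n, Function.Injective e →
        ∫ z in Metric.ball z₀ s, minorX c (leviM φ z) e ≤ C * J) →
        ∑ i : Fin (k + 1), ∫ z in Metric.ball z₀ s, minorX c (leviM φ z) (e ∘ i.succAbove) ≤
          (k + 1) * (C * J) := by
      intro C s h
      refine (Finset.sum_le_sum fun i _ => h _ (hinj i)).trans ?_
      simp
    have hX : 0 ≤ ∫ z in Metric.ball z₀ ρ, minorX c (leviM φ z) e :=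
      setIntegral_nonneg measurableSet_ball fun z hz => minorX_nonneg hc
        (posSemidef_leviM hφ.smooth (hφ.levi_nonneg z (Metric.ball_subset_ball hρR.le hz))) e
    calc ∫ z in Metric.ball z₀ ρ, minorX c (leviM φ z) e
        ≤ (k + 1) * ∫ z in Metric.ball z₀ ρ, minorX c (leviM φ z) e :=
          le_mul_of_one_le_left hX (by linarith [Nat.cast_nonneg (α := ℝ) k])
      _ ≤ _ := hstep
      _ ≤ (k + 1) ^ 2 * K * ((k + 1) * (C₂ * J) + (k + 1) * c ^ k * J) +
          c * ((k + 1) * (C₁ * J)) := by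
        gcongr
        · exact hs _ _ (h₂ φ hφ)
        · exact hs _ _ (h₁ φ hφ)
      _ = _ := by ring

/-- The determinant of the Levi matrix of `φ + quad c a`. -/
def detL (c : ℝ) (φ : (Fin n → ℂ) → ℝ) (z : Fin n → ℂ) : ℝ := (leviM φ z + (c : ℂ) • 1).det.re

lemma detL_eq (c : ℝ) (φ : (Fin n → ℂ) → ℝ) (z : Fin n → ℂ) :
    detL c φ z = minorX c (leviM φ z) id + c ^ n := by
  simp [detL, minorX]

lemma continuous_detL (c : ℝ) {φ : (Fin n → ℂ) → ℝ} (hφ : ContDiff ℝ ∞ φ) :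
    Continuous (detL c φ) := by
  have : detL c φ = fun z => minorX c (leviM φ z) id + c ^ n := funext (detL_eq c φ)
  rw [this]
  exact (continuous_minorX hφ c id).add continuous_const

lemma pow_le_detL {c : ℝ} (hc : 0 < c) {φ : (Fin n → ℂ) → ℝ} {z₀ : Fin n → ℂ} {R : ℝ}
    (hφ : Good z₀ R φ) {z : Fin n → ℂ} (hz : z ∈ Metric.ball z₀ R) : c ^ n ≤ detL c φ z := by
  rw [detL_eq]
  linarith [minorX_nonneg hc (posSemidef_leviM hφ.smooth (hφ.levi_nonneg z hz)) id]

lemma detL_integral_bound {c : ℝ} (hc : 0 < c) (z₀ : Fin n → ℂ) {ρ R : ℝ} (hρ : 0 < ρ)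
    (hρR : ρ < R) : ∃ C, 0 ≤ C ∧ ∀ φ, Good z₀ R φ → ∀ U : Set (Fin n → ℂ), MeasurableSet U →
      U ⊆ Metric.ball z₀ ρ → (∀ z ∈ U, φ z ≤ -(1 / 4)) →
      ∫ z in U, detL c φ z ≤ C * ∫ z in Metric.ball z₀ R, -φ z := by
  obtain ⟨C, hC, h⟩ := minorX_integral_bound hc z₀ R n ρ hρ hρR
  refine ⟨C + 4 * c ^ n, by positivity, fun φ hφ U hU hUB hUφ => ?_⟩
  have hi := integrableOn_ball (continuous_minorX hφ.smooth c id) z₀ ρ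
  have hn : IntegrableOn (fun z => -φ z) (Metric.ball z₀ R) :=
    integrableOn_ball hφ.smooth.continuous.neg z₀ R
  have hUR := hUB.trans (Metric.ball_subset_ball hρR.le)
  calc ∫ z in U, detL c φ z ≤ ∫ z in U, (minorX c (leviM φ z) id + 4 * c ^ n * -φ z) := by
        refine setIntegral_mono_on
          ((integrableOn_ball (continuous_detL c hφ.smooth) z₀ ρ).mono_set hUB)
          ((hi.mono_set hUB).add ((hn.mono_set hUR).const_mul _)) hU fun z hz => ?_
        rw [detL_eq]
        have := hUφ z hz
        have hcn : 0 < c ^ n := by positivity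
        nlinarith
    _ = (∫ z in U, minorX c (leviM φ z) id) + 4 * c ^ n * ∫ z in U, -φ z := by
        rw [← integral_const_mul]
        exact integral_add (hi.mono_set hUB) ((hn.mono_set hUR).const_mul _)
    _ ≤ (∫ z in Metric.ball z₀ ρ, minorX c (leviM φ z) id) +
          4 * c ^ n * ∫ z in Metric.ball z₀ R, -φ z := by
        refine add_le_add (setIntegral_mono_set hi ?_ hUB.eventuallyLE)
          (mul_le_mul_of_nonneg_left (setIntegral_mono_set hn ?_ hUR.eventuallyLE) (by positivity))
        · filter_upwards [ae_restrict_mem measurableSet_ball] with z hz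
          exact minorX_nonneg hc (posSemidef_leviM hφ.smooth
            (hφ.levi_nonneg z (Metric.ball_subset_ball hρR.le hz))) id
        · exact Eventually.of_forall fun z => neg_nonneg.2 (hφ.upper z)
    _ ≤ C * (∫ z in Metric.ball z₀ R, -φ z) + 4 * c ^ n * ∫ z in Metric.ball z₀ R, -φ z := by
        gcongr
        exact h φ hφ id Function.injective_id
    _ = _ := by ring

/-- The strictly plurisubharmonic perturbation of `φ`. -/
def pert (c : ℝ) (z₀ : Fin n → ℂ) (φ : (Fin n → ℂ) → ℝ) (z : Fin n → ℂ) : ℝ := φ z + quad c z₀ z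

lemma contDiff_pert (c : ℝ) (z₀ : Fin n → ℂ) {φ : (Fin n → ℂ) → ℝ} (hφ : ContDiff ℝ ∞ φ) :
    ContDiff ℝ ∞ (pert c z₀ φ) := hφ.add (contDiff_quad c z₀)

lemma levi_smul {φ : (Fin n → ℂ) → ℝ} (hφ : ContDiff ℝ ∞ φ) (a v : Fin n → ℂ) (ζ : ℂ) :
    levi φ a (ζ • v) = ‖ζ‖ ^ 2 * levi φ a v := by
  have h : ((levi φ a (ζ • v) : ℝ) : ℂ) = ((‖ζ‖ ^ 2 * levi φ a v : ℝ) : ℂ) := by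
    rw [levi_eq_dotProduct hφ, star_smul, smul_dotProduct, Matrix.mulVec_smul, dotProduct_smul,
      ← levi_eq_dotProduct hφ, smul_eq_mul, smul_eq_mul, ← mul_assoc, Complex.star_def,
      Complex.conj_mul']
    push_cast
    rfl
  exact_mod_cast h

lemma levi_add_le {φ : (Fin n → ℂ) → ℝ} {a : Fin n → ℂ}
    (h : ∀ v, 0 ≤ levi φ a v) (x y : Fin n → ℂ) :
    levi φ a (x + y) ≤ 2 * levi φ a x + 2 * levi φ a y := by
  have h1 := h (x - y)
  have h2 : levi φ a (x + y) + levi φ a (x - y) = 2 * levi φ a x + 2 * levi φ a y := by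
    simp only [levi, smul_add, smul_sub, map_add, map_sub, add_apply, sub_apply]
    ring
  linarith

lemma levi_neg (φ : (Fin n → ℂ) → ℝ) (a v : Fin n → ℂ) : levi φ a (-v) = levi φ a v := by
  simp [levi]

lemma levi_pert {φ : (Fin n → ℂ) → ℝ} (hφ : ContDiff ℝ ∞ φ) (c : ℝ) (z₀ a v : Fin n → ℂ) :
    levi (pert c z₀ φ) a v = levi φ a v + c * ∑ i, ‖v i‖ ^ 2 := by
  have h : ((levi (pert c z₀ φ) a v : ℝ) : ℂ) = ((levi φ a v + c * ∑ i, ‖v i‖ ^ 2 : ℝ) : ℂ) := by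
    have hm : leviM (pert c z₀ φ) a = leviM φ a + (c : ℂ) • 1 := leviM_add_quad hφ c z₀ a
    rw [levi_eq_dotProduct (contDiff_pert c z₀ hφ), hm, Matrix.add_mulVec, dotProduct_add,
      ← levi_eq_dotProduct hφ, Matrix.smul_mulVec, Matrix.one_mulVec, dotProduct_smul]
    push_cast
    congr 2
    refine Finset.sum_congr rfl fun i _ => ?_
    rw [Pi.star_apply, Complex.star_def, Complex.conj_mul']
  exact_mod_cast h

lemma norm_sq_le_sum (v : Fin n → ℂ) : ‖v‖ ^ 2 ≤ ∑ i, ‖v i‖ ^ 2 := by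
  have h0 : 0 ≤ ∑ i, ‖v i‖ ^ 2 := Finset.sum_nonneg fun _ _ => by positivity
  rw [← Real.sq_sqrt h0]
  gcongr
  rw [pi_norm_le_iff_of_nonneg (Real.sqrt_nonneg _)]
  exact fun i => Real.le_sqrt_of_sq_le
    (Finset.single_le_sum (f := fun i => ‖v i‖ ^ 2) (fun _ _ => by positivity) (Finset.mem_univ i))

lemma Good.le_levi_pert {φ : (Fin n → ℂ) → ℝ} {z₀ : Fin n → ℂ} {R c : ℝ} (hφ : Good z₀ R φ)
    (hc : 0 ≤ c) {a : Fin n → ℂ} (ha : a ∈ Metric.ball z₀ R) (v : Fin n → ℂ) :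
    c * ‖v‖ ^ 2 ≤ levi (pert c z₀ φ) a v := by
  rw [levi_pert hφ.smooth]
  nlinarith [hφ.levi_nonneg a ha v, mul_le_mul_of_nonneg_left (norm_sq_le_sum v) hc]

/-- Local comparison data for a strictly plurisubharmonic function on a set. -/
structure LocalData (ψ : (Fin n → ℂ) → ℝ) (K : Set (Fin n → ℂ)) (c ε : ℝ) : Prop where
  smooth : ContDiff ℝ ∞ ψ
  lower : ∀ a ∈ K, ∀ v, c * ‖v‖ ^ 2 ≤ levi ψ a v
  comp : ∀ a ∈ K, ∀ b, ‖b - a‖ ≤ ε → ∀ v, levi ψ b v ≤ 2 * levi ψ a v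
  taylor : ∀ a ∈ K, ∀ v, ∀ ζ : ℂ, ‖ζ • v‖ ≤ ε →
    ψ a + ((holoPart ψ a v).eval ζ).re ≤ ψ (a + ζ • v) ∧
    ψ (a + ζ • v) ≤ ψ a + ((holoPart ψ a v).eval ζ).re + 2 * levi ψ a (ζ • v)
  det : ∀ a ∈ K, ∀ b, ‖b - a‖ ≤ ε → (leviM ψ a).det.re ≤ 2 * (leviM ψ b).det.re

lemma exists_uniform {F : Type*} [PseudoMetricSpace F] {f : (Fin n → ℂ) → F} (hf : Continuous f)
    {K : Set (Fin n → ℂ)} (hK : IsCompact K) {om : ℝ} (hom : 0 < om) :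
    ∃ δ > 0, ∀ a ∈ K, ∀ b, ‖b - a‖ ≤ δ → dist (f b) (f a) ≤ om := by
  have h := hK.uniformContinuousAt_of_continuousAt f (fun a _ => hf.continuousAt)
    (Metric.dist_mem_uniformity hom)
  obtain ⟨δ, hδ, h⟩ := Metric.mem_uniformity_dist.1 h
  refine ⟨δ / 2, by positivity, fun a ha b hab => ?_⟩
  rw [dist_comm]
  refine (h (a := a) (b := b) ?_ ha).le
  rw [dist_comm, dist_eq_norm]
  linarith

lemma abs_levi_sub_le {ψ : (Fin n → ℂ) → ℝ} {a b : Fin n → ℂ} {om : ℝ}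
    (h : ‖hess ψ b - hess ψ a‖ ≤ om) (v : Fin n → ℂ) :
    |levi ψ b v - levi ψ a v| ≤ om / 2 * ‖v‖ ^ 2 := by
  have key : ∀ w, ‖w‖ = ‖v‖ → |hess ψ b w w - hess ψ a w w| ≤ om * ‖v‖ ^ 2 := by
    intro w hw
    have := (hess ψ b - hess ψ a).le_opNorm₂ w w
    rw [sub_apply, sub_apply, Real.norm_eq_abs] at this
    refine this.trans ?_
    rw [hw, mul_assoc, ← sq]
    gcongr
  have h1 := abs_le.1 (key v rfl)
  have h2 := abs_le.1 (key (I • v) (by rw [norm_smul, norm_I, one_mul]))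
  rw [abs_le]
  simp only [levi]
  constructor <;> linarith [h1.1, h1.2, h2.1, h2.2]

lemma exists_localData {ψ : (Fin n → ℂ) → ℝ} (hψ : ContDiff ℝ ∞ ψ) {K : Set (Fin n → ℂ)}
    (hK : IsCompact K) {c η : ℝ} (hc : 0 < c) (hη : 0 < η)
    (hlow : ∀ a ∈ K, ∀ v, c * ‖v‖ ^ 2 ≤ levi ψ a v) (hdet : ∀ a ∈ K, η ≤ (leviM ψ a).det.re) :
    ∃ ε > 0, LocalData ψ K c ε := by
  obtain ⟨δ, hδ, h1⟩ := exists_uniform (contDiff_hess hψ).continuous hK hc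
  have hcd : Continuous fun z => (leviM ψ z).det.re :=
    Complex.continuous_re.comp (continuous_leviM hψ).matrix_det
  obtain ⟨δ', hδ', h2⟩ := exists_uniform hcd hK (half_pos hη)
  have h1' : ∀ a ∈ K, ∀ b, ‖b - a‖ ≤ δ → ‖hess ψ b - hess ψ a‖ ≤ c := fun a ha b hb =>
    (dist_eq_norm (hess ψ b) (hess ψ a)).ge.trans (h1 a ha b hb)
  refine ⟨min δ δ', lt_min hδ hδ', hψ, hlow, ?_, ?_, ?_⟩
  · intro a ha b hb v
    have := abs_le.1 (abs_levi_sub_le (h1' a ha b (hb.trans (min_le_left _ _))) v)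
    have := hlow a ha v
    nlinarith [sq_nonneg ‖v‖]
  · intro a ha v ζ hζ
    have ht := taylor_two hψ (a := a) (y := ζ • v) (om := c) fun s hs => by
      refine h1' a ha _ ?_
      rw [add_sub_cancel_left, norm_smul, Real.norm_eq_abs, abs_of_nonneg hs.1]
      exact (mul_le_of_le_one_left (norm_nonneg _) hs.2).trans (hζ.trans (min_le_left _ _))
    have h3 := taylor_part_eq hψ a v ζ
    have h4 := hlow a ha (ζ • v)
    have h5 := levi_smul hψ a v ζ
    have h6 := abs_le.1 ht
    constructor <;> linarith [h6.1, h6.2]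
  · intro a ha b hb
    have h3 := h2 a ha b (hb.trans (min_le_right _ _))
    rw [Real.dist_eq] at h3
    have := abs_le.1 h3
    linarith [hdet a ha, this.1]

lemma Good.exists_localData {φ : (Fin n → ℂ) → ℝ} {z₀ : Fin n → ℂ} {r c : ℝ} (hr : 0 < r)
    (hφ : Good z₀ (2 * r) φ) (hc : 0 < c) :
    ∃ ε > 0, LocalData (pert c z₀ φ) (Metric.closedBall z₀ r) c ε := by
  have hsub : Metric.closedBall z₀ r ⊆ Metric.ball z₀ (2 * r) :=
    Metric.closedBall_subset_ball (by linarith)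
  refine PshTools.exists_localData (contDiff_pert c z₀ hφ.smooth) (isCompact_closedBall z₀ r) hc
    (pow_pos hc n) (fun a ha => hφ.le_levi_pert hc.le (hsub ha)) fun a ha => ?_
  have hm : leviM (pert c z₀ φ) a = leviM φ a + (c : ℂ) • 1 := leviM_add_quad hφ.smooth c z₀ a
  rw [hm]
  exact pow_le_detL hc hφ (hsub ha)

/-- The Euclidean unit ball of `ℂⁿ`. -/
def euclBall (n : ℕ) : Set (Fin n → ℂ) := {w | ∑ i, ‖w i‖ ^ 2 < 1}

lemma isOpen_euclBall : IsOpen (euclBall n) :=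
  isOpen_lt (by fun_prop) continuous_const

lemma measureReal_euclBall_pos : 0 < volume.real (euclBall n) := by
  have h0 : (0 : Fin n → ℂ) ∈ euclBall n := by
    change ∑ i : Fin n, ‖(0 : Fin n → ℂ) i‖ ^ 2 < 1
    simp
  have hsub : euclBall n ⊆ Metric.ball 0 1 := by
    intro w hw
    rw [mem_ball_zero_iff]
    have h1 : ∑ i, ‖w i‖ ^ 2 < 1 := hw
    have h2 := norm_sq_le_sum w
    nlinarith [norm_nonneg w]
  exact ENNReal.toReal_pos (isOpen_euclBall.measure_pos volume ⟨0, h0⟩).ne'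
    ((measure_mono hsub).trans_lt measure_ball_lt_top).ne

lemma measureReal_levi_lt {ψ : (Fin n → ℂ) → ℝ} (hψ : ContDiff ℝ ∞ ψ) {a : Fin n → ℂ}
    (hL : ∀ v, 0 ≤ levi ψ a v) (hdet : 0 < (leviM ψ a).det.re) {s : ℝ} (hs : 0 < s) :
    volume.real {z | levi ψ a (z - a) < s ^ 2} * (leviM ψ a).det.re =
      s ^ (2 * n) * volume.real (euclBall n) := by
  obtain ⟨A, hA⟩ := exists_conjTranspose_mul_self (posSemidef_leviM hψ hL)
  have hdetA : (leviM ψ a).det.re = Complex.normSq A.det := by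
    rw [hA, Matrix.det_mul, Matrix.det_conjTranspose, Complex.star_def,
      ← Complex.normSq_eq_conj_mul_self, Complex.ofReal_re]
  set T : (Fin n → ℂ) →ₗ[ℂ] (Fin n → ℂ) := ((s⁻¹ : ℝ) : ℂ) • Matrix.toLin' A with hT
  have hTdet : LinearMap.det (T.restrictScalars ℝ) = (s ^ (2 * n))⁻¹ * (leviM ψ a).det.re := by
    rw [LinearMap.det_restrictScalars, Algebra.norm_complex_apply, hT, LinearMap.det_smul,
      LinearMap.det_toLin', Complex.normSq_mul, ← hdetA, map_pow, Complex.normSq_ofReal,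
      Module.finrank_fin_fun, ← sq, ← pow_mul, inv_pow]
  have hlev : ∀ v, levi ψ a v = ∑ i, ‖A.mulVec v i‖ ^ 2 := by
    intro v
    have : ((levi ψ a v : ℝ) : ℂ) = ((∑ i, ‖A.mulVec v i‖ ^ 2 : ℝ) : ℂ) := by
      rw [levi_eq_dotProduct hψ, hA, ← Matrix.mulVec_mulVec, Matrix.dotProduct_mulVec,
        Matrix.vecMul_conjTranspose, star_star]
      push_cast
      refine Finset.sum_congr rfl fun i _ => ?_
      rw [Pi.star_apply, Complex.star_def, Complex.conj_mul']
    exact_mod_cast this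
  have hset : {z | levi ψ a (z - a) < s ^ 2} =
      (fun z => z + -a) ⁻¹' ((T.restrictScalars ℝ) ⁻¹' euclBall n) := by
    ext z
    simp only [mem_preimage, ← sub_eq_add_neg]
    change levi ψ a (z - a) < s ^ 2 ↔ ∑ i, ‖((s⁻¹ : ℝ) : ℂ) * A.mulVec (z - a) i‖ ^ 2 < 1
    rw [hlev]
    simp only [norm_mul, Complex.norm_real, Real.norm_eq_abs, mul_pow, sq_abs]
    rw [← Finset.mul_sum, inv_pow, inv_mul_lt_iff₀ (by positivity), mul_one]
  have hne : LinearMap.det (T.restrictScalars ℝ) ≠ 0 := by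
    rw [hTdet]; positivity
  rw [hset, measureReal_def, measure_preimage_add_right, Measure.addHaar_preimage_linearMap _ hne,
    ENNReal.toReal_mul, ENNReal.toReal_ofReal (abs_nonneg _), hTdet, abs_of_pos (by positivity),
    measureReal_def]
  field_simp

/-- The Levi ball of radius `s` centered at `a`. -/
def leviBall (ψ : (Fin n → ℂ) → ℝ) (s : ℝ) (a : Fin n → ℂ) : Set (Fin n → ℂ) :=
  {z | levi ψ a (z - a) < s ^ 2}

lemma mem_leviBall {ψ : (Fin n → ℂ) → ℝ} {s : ℝ} {a z : Fin n → ℂ} :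
    z ∈ leviBall ψ s a ↔ levi ψ a (z - a) < s ^ 2 := Iff.rfl

lemma isOpen_leviBall (ψ : (Fin n → ℂ) → ℝ) (s : ℝ) (a : Fin n → ℂ) :
    IsOpen (leviBall ψ s a) := by
  refine isOpen_lt ?_ continuous_const
  have h : Continuous fun z : Fin n → ℂ => z - a := by fun_prop
  have h' : Continuous fun z : Fin n → ℂ => I • (z - a) := by fun_prop
  exact ((((hess ψ a).continuous.comp h).clm_apply h).add
    (((hess ψ a).continuous.comp h').clm_apply h')).div_const 4

section Covering

variable {ψ : (Fin n → ℂ) → ℝ} {K : Set (Fin n → ℂ)} {c ε s : ℝ}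

lemma LocalData.norm_le (h : LocalData ψ K c ε) (hc : 0 < c) {t δ : ℝ} (hδ : 0 ≤ δ)
    (hs : t ≤ c * δ ^ 2) {a : Fin n → ℂ} (ha : a ∈ K) {v : Fin n → ℂ} (hv : levi ψ a v ≤ t) :
    ‖v‖ ≤ δ := by
  have := h.lower a ha v
  have h2 : ‖v‖ ^ 2 ≤ δ ^ 2 := le_of_mul_le_mul_left (by linarith) hc
  exact le_of_sq_le_sq h2 hδ

lemma LocalData.levi_nonneg (h : LocalData ψ K c ε) (hc : 0 < c) {a : Fin n → ℂ} (ha : a ∈ K)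
    (v : Fin n → ℂ) : 0 ≤ levi ψ a v := le_trans (by positivity) (h.lower a ha v)

lemma LocalData.integral_leviBall (h : LocalData ψ K c ε) (hc : 0 < c) (hs : 0 < s)
    (hsε : s ^ 2 ≤ c * ε ^ 2) (hε : 0 ≤ ε) (hdet : ∀ a ∈ K, 0 < (leviM ψ a).det.re)
    {a : Fin n → ℂ} (ha : a ∈ K) :
    s ^ (2 * n) * volume.real (euclBall n) ≤ 2 * ∫ z in leviBall ψ s a, (leviM ψ z).det.re := by
  have hsub : leviBall ψ s a ⊆ Metric.closedBall a ε := fun z hz => by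
    rw [mem_closedBall_iff_norm]
    exact h.norm_le hc hε hsε ha (mem_leviBall.1 hz).le
  have hcd : Continuous fun z => (leviM ψ z).det.re :=
    Complex.continuous_re.comp (continuous_leviM h.smooth).matrix_det
  have hfin : volume (leviBall ψ s a) ≠ ⊤ :=
    ((measure_mono hsub).trans_lt measure_closedBall_lt_top).ne
  have h1 : s ^ (2 * n) * volume.real (euclBall n) =
      ∫ z in leviBall ψ s a, (leviM ψ a).det.re := by
    rw [setIntegral_const, smul_eq_mul]
    exact (measureReal_levi_lt h.smooth (h.levi_nonneg hc ha) (hdet a ha) hs).symm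
  rw [h1, ← integral_const_mul]
  refine setIntegral_mono_on (integrableOn_const hfin)
    (((hcd.locallyIntegrable.integrableOn_isCompact (isCompact_closedBall a ε)).mono_set
      hsub).const_mul 2) (isOpen_leviBall ψ s a).measurableSet fun z hz => ?_
  exact h.det a ha z (by simpa [dist_eq_norm] using hsub hz)

lemma LocalData.card_le (h : LocalData ψ K c ε) (hc : 0 < c) (hs : 0 < s)
    (hsε : s ^ 2 ≤ c * ε ^ 2) (hε : 0 ≤ ε) (hdet : ∀ a ∈ K, 0 < (leviM ψ a).det.re) {η : ℝ}
    {V : Set (Fin n → ℂ)}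
    (hη : ∀ U : Set (Fin n → ℂ), MeasurableSet U → U ⊆ V → ∫ z in U, (leviM ψ z).det.re ≤ η)
    {T : Finset (Fin n → ℂ)} (hTK : ∀ a ∈ T, a ∈ K) (hTV : ∀ a ∈ T, leviBall ψ s a ⊆ V)
    (hd : (T : Set (Fin n → ℂ)).PairwiseDisjoint (leviBall ψ s)) :
    (T.card : ℝ) * (s ^ (2 * n) * volume.real (euclBall n)) ≤ 2 * η := by
  have hcd : Continuous fun z => (leviM ψ z).det.re :=
    Complex.continuous_re.comp (continuous_leviM h.smooth).matrix_det
  have hsub : ∀ a ∈ T, leviBall ψ s a ⊆ Metric.closedBall a ε := fun a ha z hz => by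
    rw [mem_closedBall_iff_norm]
    exact h.norm_le hc hε hsε (hTK a ha) (mem_leviBall.1 hz).le
  have h1 := hη (⋃ a ∈ T, leviBall ψ s a)
    (T.measurableSet_biUnion fun a _ => (isOpen_leviBall ψ s a).measurableSet)
    (iUnion₂_subset hTV)
  rw [integral_biUnion_finset T (fun a _ => (isOpen_leviBall ψ s a).measurableSet) hd
    fun a ha => (hcd.locallyIntegrable.integrableOn_isCompact
      (isCompact_closedBall a ε)).mono_set (hsub a ha)] at h1
  calc (T.card : ℝ) * (s ^ (2 * n) * volume.real (euclBall n))
      = ∑ _a ∈ T, s ^ (2 * n) * volume.real (euclBall n) := by simp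
    _ ≤ ∑ a ∈ T, 2 * ∫ z in leviBall ψ s a, (leviM ψ z).det.re :=
        Finset.sum_le_sum fun a ha => h.integral_leviBall hc hs hsε hε hdet (hTK a ha)
    _ ≤ 2 * η := by rw [← Finset.mul_sum]; linarith

/-- A finite family of disjoint Levi balls whose enlargements cover. -/
lemma LocalData.exists_cover (h : LocalData ψ K c ε) (hc : 0 < c) (hs : 0 < s)
    (hsε : s ^ 2 ≤ c * (ε / 2) ^ 2) (hε : 0 ≤ ε) (hdet : ∀ a ∈ K, 0 < (leviM ψ a).det.re) {η : ℝ}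
    {V K' : Set (Fin n → ℂ)} (hK' : K' ⊆ K) (hV : ∀ a ∈ K', leviBall ψ s a ⊆ V)
    (hη : ∀ U : Set (Fin n → ℂ), MeasurableSet U → U ⊆ V → ∫ z in U, (leviM ψ z).det.re ≤ η) :
    ∃ T : Finset (Fin n → ℂ), (∀ a ∈ T, a ∈ K') ∧
      (T.card : ℝ) * (s ^ (2 * n) * volume.real (euclBall n)) ≤ 2 * η ∧
      ∀ b ∈ K', ∃ a ∈ T, levi ψ a (b - a) ≤ 6 * s ^ 2 := by
  classical
  let P : ℕ → Prop := fun m => ∃ T : Finset (Fin n → ℂ), (∀ a ∈ T, a ∈ K') ∧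
    (T : Set (Fin n → ℂ)).PairwiseDisjoint (leviBall ψ s) ∧ T.card = m
  have hκ : 0 < s ^ (2 * n) * volume.real (euclBall n) :=
    mul_pos (by positivity) measureReal_euclBall_pos
  have hsε' : s ^ 2 ≤ c * ε ^ 2 := hsε.trans (by gcongr; linarith)
  have hcard : ∀ T : Finset (Fin n → ℂ), (∀ a ∈ T, a ∈ K') →
      (T : Set (Fin n → ℂ)).PairwiseDisjoint (leviBall ψ s) →
      (T.card : ℝ) * (s ^ (2 * n) * volume.real (euclBall n)) ≤ 2 * η := fun T hT hd =>
    h.card_le hc hs hsε' hε hdet hη (fun a ha => hK' (hT a ha)) (fun a ha => hV a (hT a ha)) hd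
  have hbdd : BddAbove {m | P m} := by
    refine ⟨⌊2 * η / (s ^ (2 * n) * volume.real (euclBall n))⌋₊, ?_⟩
    rintro m ⟨T, hT, hd, rfl⟩
    exact Nat.le_floor ((le_div_iff₀ hκ).2 (hcard T hT hd))
  have hne : {m | P m}.Nonempty := ⟨0, ∅, by simp, by simp, rfl⟩
  obtain ⟨T, hT, hd, hTm⟩ : P (sSup {m | P m}) := Nat.sSup_mem hne hbdd
  refine ⟨T, hT, hcard T hT hd, fun b hb => ?_⟩
  by_contra! hcon
  have hbT : b ∉ T := fun hbT => by
    have := hcon b hbT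
    rw [sub_self] at this
    have h0 : levi ψ b 0 = 0 := by simp [levi]
    nlinarith [sq_nonneg s]
  have hP : P (T.card + 1) := by
    refine ⟨insert b T, ?_, ?_, Finset.card_insert_of_notMem hbT⟩
    · intro a ha
      rcases Finset.mem_insert.1 ha with rfl | ha
      exacts [hb, hT a ha]
    · rw [Finset.coe_insert]
      refine hd.insert fun a ha _ => ?_
      refine Set.disjoint_left.2 fun z hzb hza => ?_
      rw [mem_leviBall] at hza hzb
      have haK := hK' (hT a ha)
      have hbK := hK' hb
      have n1 := h.norm_le hc (by positivity) hsε haK hza.le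
      have n2 := h.norm_le hc (by positivity) hsε hbK hzb.le
      have hab : ‖a - b‖ ≤ ε := by
        have : a - b = (z - b) - (z - a) := by abel
        rw [this]
        exact (norm_sub_le _ _).trans (by linarith)
      have h1 := h.comp b hbK a hab (z - b)
      have h2 := levi_add_le (h.levi_nonneg hc haK) (z - a) (-(z - b))
      rw [levi_neg] at h2
      have h3 : z - a + -(z - b) = b - a := by abel
      rw [h3] at h2
      linarith [hcon a ha]
  have := le_csSup hbdd (show T.card + 1 ∈ {m | P m} from hP)
  omega

end Covering

lemma X_pow_dvd_mvLine_zero {Q : MvPolynomial (Fin n) ℂ} {N : ℕ}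
    (h : ∀ β : Fin n →₀ ℕ, (∀ i, β i < N) → Q.coeff β = 0) (v : Fin n → ℂ) :
    X ^ N ∣ mvLine Q 0 v := by
  rw [mvLine, MvPolynomial.aeval_def, MvPolynomial.eval₂_eq']
  refine Finset.dvd_sum fun β hβ => ?_
  have : ∃ i, N ≤ β i := by
    by_contra! hcon
    exact MvPolynomial.mem_support_iff.1 hβ (h β hcon)
  obtain ⟨i, hi⟩ := this
  refine Dvd.dvd.mul_left ?_ _
  refine Dvd.dvd.trans ?_ (Finset.dvd_prod_of_mem _ (Finset.mem_univ i))
  simp only [Pi.zero_apply, map_zero, zero_add, mul_pow]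
  exact Dvd.dvd.mul_left (pow_dvd_pow X hi) _

/-- The polynomial `z ↦ P (z + a)`. -/
def translate (a : Fin n → ℂ) : MvPolynomial (Fin n) ℂ →ₐ[ℂ] MvPolynomial (Fin n) ℂ :=
  MvPolynomial.aeval fun i => MvPolynomial.X i + MvPolynomial.C (a i)

lemma eval_translate (a z : Fin n → ℂ) (P : MvPolynomial (Fin n) ℂ) :
    MvPolynomial.eval z (translate a P) = MvPolynomial.eval (a + z) P := by
  have h := DFunLike.congr_fun (MvPolynomial.comp_aeval (R := ℂ)
    (fun i => MvPolynomial.X i + MvPolynomial.C (a i))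
    (MvPolynomial.aeval z : MvPolynomial (Fin n) ℂ →ₐ[ℂ] ℂ)) P
  simp only [AlgHom.comp_apply] at h
  rw [← MvPolynomial.coe_aeval_eq_eval, translate]
  refine h.trans ?_
  rw [← MvPolynomial.coe_aeval_eq_eval]
  have e : (fun i => MvPolynomial.aeval z (MvPolynomial.X i + MvPolynomial.C (a i)
      : MvPolynomial (Fin n) ℂ)) = a + z := by
    ext i
    simp [add_comm]
  rw [e]
  rfl

lemma mvLine_eq_translate (P : MvPolynomial (Fin n) ℂ) (a v : Fin n → ℂ) :
    mvLine P a v = mvLine (translate a P) 0 v := by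
  refine Polynomial.funext fun ζ => ?_
  rw [eval_mvLine, eval_mvLine, eval_translate, zero_add]

/-- A nonzero polynomial vanishing to high order at finitely many points. -/
lemma exists_vanishing (T : Finset (Fin n → ℂ)) {d N : ℕ} (h : T.card * N ^ n < d ^ n) :
    ∃ P : MvPolynomial (Fin n) ℂ, P ≠ 0 ∧ P.totalDegree ≤ n * d ∧
      ∀ a ∈ T, ∀ v, X ^ N ∣ mvLine P a v := by
  let e : (Fin n → Fin d) → (Fin n →₀ ℕ) := fun α =>
    Finsupp.equivFunOnFinite.symm fun i => (α i : ℕ)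
  have he : Function.Injective e := fun α β hαβ => by
    have := Finsupp.equivFunOnFinite.symm.injective hαβ
    funext i
    exact Fin.ext (congrFun this i)
  let p : ((Fin n → Fin d) → ℂ) →ₗ[ℂ] MvPolynomial (Fin n) ℂ :=
    ∑ α, (MvPolynomial.monomial (e α)).comp (LinearMap.proj α)
  have hp : ∀ c, p c = ∑ α, MvPolynomial.monomial (e α) (c α) := fun c => by
    simp [p, LinearMap.sum_apply]
  let F : ((Fin n → Fin d) → ℂ) →ₗ[ℂ] (T × (Fin n → Fin N) → ℂ) :=
    LinearMap.pi fun x =>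
      (MvPolynomial.lcoeff ℂ (Finsupp.equivFunOnFinite.symm fun i => (x.2 i : ℕ))).comp
      ((translate (x.1 : Fin n → ℂ)).toLinearMap.comp p)
  have hF : LinearMap.ker F ≠ ⊥ := LinearMap.ker_ne_bot_of_finrank_lt (by
    simpa [Module.finrank_fintype_fun_eq_card] using h)
  obtain ⟨c, hc, hc0⟩ := (Submodule.ne_bot_iff _).1 hF
  refine ⟨p c, fun h0 => hc0 ?_, ?_, fun a ha v => ?_⟩
  · funext α
    have : (p c).coeff (e α) = c α := by
      rw [hp, MvPolynomial.coeff_sum]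
      simp only [MvPolynomial.coeff_monomial, he.eq_iff]
      simp
    rw [← this, h0]; simp
  · rw [hp]
    refine MvPolynomial.totalDegree_finsetSum_le fun α _ => ?_
    refine (MvPolynomial.totalDegree_monomial_le _ _).trans ?_
    rw [Finsupp.sum_fintype _ _ (fun _ => rfl)]
    calc ∑ i, (e α) i ≤ ∑ _i : Fin n, d := Finset.sum_le_sum fun i _ => (α i).2.le
      _ = n * d := by simp
  · rw [mvLine_eq_translate]
    refine X_pow_dvd_mvLine_zero (fun β hβ => ?_) v
    have := congrFun (LinearMap.mem_ker.1 hc) (⟨a, ha⟩, fun i => ⟨β i, hβ i⟩)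
    have e2 : (Finsupp.equivFunOnFinite.symm fun i => β i) = β := by ext; rfl
    simpa [F, e2] using this

/-- A polynomial vanishing to high order on a net of small Levi balls is exponentially small
where `ψ` is negative. -/
lemma LocalData.norm_eval_le {ψ : (Fin n → ℂ) → ℝ} {z₀ : Fin n → ℂ} {r c ε s m : ℝ}
    (h : LocalData ψ (Metric.closedBall z₀ r) c ε) (hm : 0 ≤ m) {T : Finset (Fin n → ℂ)}
    (hT : ∀ a ∈ T, a ∈ Metric.closedBall z₀ r)
    (hcov : ∀ b ∈ Metric.closedBall z₀ r, ψ b ≤ -(1 / 2) → ∃ a ∈ T, levi ψ a (b - a) ≤ 6 * s ^ 2)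
    (hdisc : ∀ a ∈ T, ∀ v, levi ψ a v ≤ 6 * s ^ 2 → ∀ ζ : ℂ, ‖ζ‖ ≤ 3 →
      a + ζ • v ∈ Metric.closedBall z₀ r ∧ ‖ζ • v‖ ≤ ε)
    {N : ℕ} (hN : 0 < N) (hNm : 108 * (m * s ^ 2) ≤ N) {P : MvPolynomial (Fin n) ℂ}
    (hdvd : ∀ a ∈ T, ∀ v, X ^ N ∣ mvLine P a v)
    (hP : ∀ z ∈ Metric.closedBall z₀ r, ‖MvPolynomial.eval z P‖ ≤ 1) {z : Fin n → ℂ}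
    (hz : z ∈ Metric.closedBall z₀ r) :
    ‖MvPolynomial.eval z P‖ ≤ Real.exp (m / 2 + m * ψ z) := by
  set g : (Fin n → ℂ) → ℝ := fun z => ‖MvPolynomial.eval z P‖ * Real.exp (-(m * ψ z)) with hg
  have hcont : Continuous g :=
    (MvPolynomial.continuous_eval P).norm.mul
      (Real.continuous_exp.comp (continuous_const.mul h.smooth.continuous).neg)
  obtain ⟨b, hbK, hb⟩ := (isCompact_closedBall z₀ r).exists_isMaxOn ⟨z, hz⟩ hcont.continuousOn
  have hb' : ∀ y ∈ Metric.closedBall z₀ r, g y ≤ g b := fun y hy => hb hy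
  suffices hM : g b ≤ Real.exp (m / 2) by
    have h1 : g z ≤ Real.exp (m / 2) := (hb' z hz).trans hM
    calc ‖MvPolynomial.eval z P‖ = g z * Real.exp (m * ψ z) := by
          rw [hg]; simp only; rw [mul_assoc, ← Real.exp_add]; simp
      _ ≤ Real.exp (m / 2) * Real.exp (m * ψ z) := by gcongr
      _ = _ := (Real.exp_add _ _).symm
  rcases le_or_gt (-(1 / 2)) (ψ b) with hψ | hψ
  · have h1 := hP b hbK
    calc g b ≤ 1 * Real.exp (-(m * ψ b)) := by rw [hg]; simp only; gcongr
      _ ≤ Real.exp (m / 2) := by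
        rw [one_mul]; gcongr; nlinarith
  by_contra! hcon
  have hMpos : 0 < g b := (Real.exp_pos _).trans hcon
  obtain ⟨a, haT, ha⟩ := hcov b hbK hψ.le
  obtain ⟨Q, hQ⟩ := hdvd a haT (b - a)
  set v := b - a with hv
  have hev : ∀ ζ : ℂ, MvPolynomial.eval (a + ζ • v) P = ζ ^ N * Q.eval ζ := fun ζ => by
    rw [← eval_mvLine, hQ]; simp
  set F : ℂ → ℂ := fun ζ => Q.eval ζ * Complex.exp (-(m * (ψ a + (holoPart ψ a v).eval ζ))) with hF
  have hFd : Differentiable ℂ F := by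
    have h1 := Q.differentiable
    have h2 := (holoPart ψ a v).differentiable
    fun_prop
  have hFn : ∀ ζ, ‖F ζ‖ =
      ‖Q.eval ζ‖ * Real.exp (-(m * (ψ a + ((holoPart ψ a v).eval ζ).re))) := fun ζ => by
    rw [hF]; simp only; rw [norm_mul, Complex.norm_exp]; simp
  have hcirc : ∀ ζ : ℂ, ‖ζ‖ = 3 → ‖F ζ‖ ≤ g b * (Real.exp (108 * (m * s ^ 2)) / 3 ^ N) := by
    intro ζ hζ
    obtain ⟨h1, h2⟩ := hdisc a haT v ha ζ hζ.le
    have h3 := (h.taylor a (hT a haT) v ζ h2).2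
    rw [levi_smul h.smooth, hζ] at h3
    have h4 := hb' _ h1
    rw [hg] at h4
    simp only at h4
    rw [hev, norm_mul, norm_pow, hζ] at h4
    rw [hFn, ← mul_div_assoc, le_div_iff₀ (by positivity)]
    have h5 : -(m * (ψ a + ((holoPart ψ a v).eval ζ).re)) ≤
        -(m * ψ (a + ζ • v)) + 108 * (m * s ^ 2) := by nlinarith
    calc _ ≤ ‖Q.eval ζ‖ * Real.exp (-(m * ψ (a + ζ • v)) + 108 * (m * s ^ 2)) * 3 ^ N := by gcongr
      _ = (3 ^ N * ‖Q.eval ζ‖ * Real.exp (-(m * ψ (a + ζ • v)))) *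
          Real.exp (108 * (m * s ^ 2)) := by rw [Real.exp_add]; ring
      _ ≤ _ := by gcongr
  have h1 := norm_le_of_circle hFd (by norm_num) hcirc (ζ := 1) (by simp)
  have hd1 := hdisc a haT v ha 1 (by simp)
  have h2 := (h.taylor a (hT a haT) v 1 hd1.2).1
  have hab : a + (1 : ℂ) • v = b := by rw [one_smul, hv]; abel
  have h3 := hev 1
  rw [hab] at h2 h3
  have h4 : g b ≤ ‖F 1‖ := by
    rw [hFn, hg]; simp only
    rw [h3, one_pow, one_mul]
    gcongr
  have h5 : Real.exp (108 * (m * s ^ 2)) / 3 ^ N < 1 := by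
    rw [div_lt_one (by positivity)]
    calc Real.exp (108 * (m * s ^ 2)) ≤ Real.exp N := by gcongr
      _ = Real.exp 1 ^ N := by rw [← Real.exp_nat_mul]; simp
      _ < 3 ^ N := pow_lt_pow_left₀ (by linarith [Real.exp_one_lt_d9]) (Real.exp_pos _).le hN.ne'
  nlinarith

lemma exists_poly {φ : (Fin n → ℂ) → ℝ} {z₀ : Fin n → ℂ} {r A η : ℝ} (hr : 0 < r)
    (hφ : Good z₀ (2 * r) φ) (hA : 1 ≤ A)
    (hdet : ∀ U : Set (Fin n → ℂ), MeasurableSet U → U ⊆ Metric.ball z₀ r →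
      (∀ z ∈ U, φ z ≤ -(1 / 4)) → ∫ z in U, detL (1 / r ^ 2) φ z ≤ η)
    (hη : 2 * (109 * A) ^ n * η < volume.real (euclBall n)) :
    ∃ d : ℕ, 0 < d ∧ ∃ P : MvPolynomial (Fin n) ℂ, P.totalDegree ≤ n * d ∧
      (∃ z ∈ Metric.closedBall z₀ r, ‖MvPolynomial.eval z P‖ = 1) ∧
      (∀ z ∈ Metric.closedBall z₀ r, ‖MvPolynomial.eval z P‖ ≤ 1) ∧
      ∀ z ∈ Metric.closedBall z₀ r, pert (1 / r ^ 2) z₀ φ z ≤ -(3 / 4) →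
        ‖MvPolynomial.eval z P‖ ≤ Real.exp (-(A * d / 4)) := by
  set c : ℝ := 1 / r ^ 2 with hcdef
  have hc : 0 < c := by positivity
  set ψ := pert c z₀ φ with hψdef
  have hψφ : ∀ z, φ z ≤ ψ z := fun z => by
    have : 0 ≤ quad c z₀ z := mul_nonneg hc.le (Finset.sum_nonneg fun i _ => by positivity)
    change φ z ≤ φ z + quad c z₀ z
    linarith
  have hlevi : ∀ z, (leviM ψ z).det.re = detL c φ z := fun z => by
    have hm : leviM ψ z = leviM φ z + (c : ℂ) • 1 := leviM_add_quad hφ.smooth c z₀ z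
    rw [hm, detL]
  have hKB : Metric.closedBall z₀ r ⊆ Metric.ball z₀ (2 * r) :=
    Metric.closedBall_subset_ball (by linarith)
  obtain ⟨ε, hε, (hL : LocalData ψ (Metric.closedBall z₀ r) c ε)⟩ := hφ.exists_localData hr hc
  have hψc : Continuous ψ := hL.smooth.continuous
  have hsph : ∀ z, ‖z - z₀‖ = r → 0 ≤ ψ z := fun z hz => by
    have h1 := norm_sq_le_sum (z - z₀)
    have h2 : 1 ≤ quad c z₀ z := by
      have : c * ‖z - z₀‖ ^ 2 ≤ quad c z₀ z := mul_le_mul_of_nonneg_left h1 hc.le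
      rw [hz, hcdef] at this
      rwa [one_div_mul_cancel (by positivity)] at this
    change 0 ≤ φ z + quad c z₀ z
    linarith [hφ.lower z]
  set K' : Set (Fin n → ℂ) := {z | ψ z ≤ -(1 / 2)} ∩ Metric.closedBall z₀ r with hK'
  set V : Set (Fin n → ℂ) := {z | ψ z < -(1 / 4)} ∩ Metric.ball z₀ r with hV
  have hK'c : IsCompact K' :=
    (isCompact_closedBall z₀ r).inter_left (isClosed_le hψc continuous_const)
  have hVo : IsOpen V := (isOpen_lt hψc continuous_const).inter Metric.isOpen_ball
  have hK'V : K' ⊆ V := fun z hz => by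
    have hz1 : ψ z ≤ -(1 / 2) := hz.1
    refine ⟨show ψ z < -(1 / 4) by linarith, ?_⟩
    have hz2 := hz.2
    rw [mem_closedBall_iff_norm] at hz2
    rw [mem_ball_iff_norm]
    refine lt_of_le_of_ne hz2 fun heq => ?_
    linarith [hsph z heq]
  obtain ⟨δ, hδ, hδV⟩ := hK'c.exists_thickening_subset_open hVo hK'V
  have hthick : ∀ a ∈ K', ∀ y, ‖y‖ < δ → a + y ∈ V := fun a ha y hy =>
    hδV (Metric.mem_thickening_iff.2 ⟨a, ha, by simpa [dist_eq_norm] using hy⟩)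
  set e₁ : ℝ := min ε δ / 2 with he₁
  have he₁pos : 0 < e₁ := by positivity
  have he₁ε : e₁ ≤ ε / 2 := by rw [he₁]; gcongr; exact min_le_left _ _
  have he₁δ : e₁ < δ := by
    have := min_le_right ε δ
    rw [he₁]; linarith
  set s : ℝ := Real.sqrt (c * e₁ ^ 2 / 54) with hs
  have hspos : 0 < s := Real.sqrt_pos.2 (by positivity)
  have hs2 : s ^ 2 = c * e₁ ^ 2 / 54 := Real.sq_sqrt (by positivity)
  have hce : 0 < c * e₁ ^ 2 := by positivity
  have hballV : ∀ a ∈ K', leviBall ψ s a ⊆ V := fun a ha y hy => by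
    have := hL.norm_le hc he₁pos.le (by linarith) ha.2 (mem_leviBall.1 hy).le
    have h2 := hthick a ha (y - a) (by linarith)
    rwa [add_sub_cancel] at h2
  have hdpos : ∀ a ∈ Metric.closedBall z₀ r, 0 < (leviM ψ a).det.re := fun a ha => by
    rw [hlevi]
    exact (pow_pos hc n).trans_le (pow_le_detL hc hφ (hKB ha))
  obtain ⟨T, hTK', hTcard, hTcov⟩ := hL.exists_cover hc hspos
    (by rw [hs2]; have : c * e₁ ^ 2 ≤ c * (ε / 2) ^ 2 := by gcongr
        linarith) hε.le hdpos (η := η) (V := V) (K' := K') inter_subset_right hballV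
    (fun U hU hUV => by
      simp only [hlevi]
      exact hdet U hU (fun z hz => (hUV hz).2) fun z hz => (hψφ z).trans (le_of_lt (hUV hz).1))
  have hA0 : 0 < A := by linarith
  set d : ℕ := ⌈1 / (A * s ^ 2)⌉₊ with hd
  have hdle : 1 / (A * s ^ 2) ≤ d := Nat.le_ceil _
  have hdpos' : 0 < d := Nat.ceil_pos.2 (by positivity)
  have hm1 : 1 ≤ A * d * s ^ 2 := by
    rw [div_le_iff₀ (by positivity)] at hdle
    linarith
  set N : ℕ := ⌊108 * (A * d * s ^ 2)⌋₊ + 1 with hN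
  have hN1 : 108 * (A * d * s ^ 2) ≤ N := by
    rw [hN]; push_cast; exact (Nat.lt_floor_add_one _).le
  have hN2 : (N : ℝ) ≤ 109 * (A * d * s ^ 2) := by
    have := Nat.floor_le (show 0 ≤ 108 * (A * d * s ^ 2) by positivity)
    rw [hN]; push_cast; linarith
  have hκ := measureReal_euclBall_pos (n := n)
  have hcount : T.card * N ^ n < d ^ n := by
    have hreal : (T.card : ℝ) * (N : ℝ) ^ n * volume.real (euclBall n) <
        (d : ℝ) ^ n * volume.real (euclBall n) := by
      have hdr : (0 : ℝ) < d := by exact_mod_cast hdpos'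
      calc (T.card : ℝ) * (N : ℝ) ^ n * volume.real (euclBall n)
          ≤ T.card * (109 * (A * d * s ^ 2)) ^ n * volume.real (euclBall n) := by gcongr
        _ = (109 * A * d) ^ n * (T.card * (s ^ (2 * n) * volume.real (euclBall n))) := by
            rw [pow_mul]; rw [show 109 * (A * d * s ^ 2) = (109 * A * d) * s ^ 2 by ring, mul_pow]
            ring
        _ ≤ (109 * A * d) ^ n * (2 * η) := by gcongr
        _ = (d : ℝ) ^ n * (2 * (109 * A) ^ n * η) := by rw [mul_pow (109 * A)]; ring
        _ < _ := by gcongr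
    have := lt_of_mul_lt_mul_right hreal hκ.le
    exact_mod_cast this
  obtain ⟨P₀, hP₀, hdeg, hvan⟩ := exists_vanishing T hcount
  obtain ⟨b, hbK, hb⟩ := (isCompact_closedBall z₀ r).exists_isMaxOn
    ⟨z₀, Metric.mem_closedBall_self hr.le⟩ (MvPolynomial.continuous_eval P₀).norm.continuousOn
  have hb' : ∀ y ∈ Metric.closedBall z₀ r,
    ‖MvPolynomial.eval y P₀‖ ≤ ‖MvPolynomial.eval b P₀‖ := fun y hy => hb hy
  have hbne : 0 < ‖MvPolynomial.eval b P₀‖ := by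
    rw [norm_pos_iff]
    intro h0
    refine hP₀ (MvPolynomial.funext_set (fun i => Metric.closedBall (z₀ i) r)
      (fun i => infinite_of_mem_nhds (z₀ i) (Metric.closedBall_mem_nhds _ hr)) fun x hx => ?_)
    rw [map_zero, ← norm_le_zero_iff]
    have := hb' x (by rw [closedBall_pi _ hr.le]; exact hx)
    rwa [h0, norm_zero] at this
  set k : ℂ := ((‖MvPolynomial.eval b P₀‖⁻¹ : ℝ) : ℂ) with hk
  have hnorm : ∀ y, ‖MvPolynomial.eval y (MvPolynomial.C k * P₀)‖ =
      ‖MvPolynomial.eval b P₀‖⁻¹ * ‖MvPolynomial.eval y P₀‖ := fun y => by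
    rw [map_mul, MvPolynomial.eval_C, norm_mul, hk, Complex.norm_real, norm_inv, norm_norm]
  have hP1 : ∀ z ∈ Metric.closedBall z₀ r, ‖MvPolynomial.eval z (MvPolynomial.C k * P₀)‖ ≤ 1 :=
    fun z hz => by
      rw [hnorm, inv_mul_le_iff₀ hbne, mul_one]; exact hb' z hz
  refine ⟨d, hdpos', MvPolynomial.C k * P₀, ?_, ⟨b, hbK, ?_⟩, hP1, fun z hz hψz => ?_⟩
  · refine (MvPolynomial.totalDegree_mul _ _).trans ?_
    rw [MvPolynomial.totalDegree_C, zero_add]; exact hdeg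
  · rw [hnorm, inv_mul_cancel₀ hbne.ne']
  · have hdR : (0 : ℝ) ≤ A * d := by positivity
    have := hL.norm_eval_le (s := s) (m := A * d) hdR
      (T := T) (fun a ha => (hTK' a ha).2) (fun y hy hψy => hTcov y ⟨hψy, hy⟩)
      (fun a ha v hv ζ hζ => by
        have h1 := hL.norm_le hc (δ := e₁ / 3) (by positivity) (by linarith) (hTK' a ha).2 hv
        have h2 : ‖ζ • v‖ ≤ e₁ := by
          rw [norm_smul]
          calc ‖ζ‖ * ‖v‖ ≤ 3 * (e₁ / 3) := by gcongr
            _ = e₁ := by ring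
        exact ⟨Metric.ball_subset_closedBall (hthick a (hTK' a ha) _ (by linarith)).2,
          by linarith⟩)
      (N := N) (by omega) hN1 (P := MvPolynomial.C k * P₀)
      (fun a ha v => by
        rw [mvLine, map_mul]; exact Dvd.dvd.mul_left (hvan a ha v) _) hP1 hz
    refine this.trans (Real.exp_le_exp.2 ?_)
    nlinarith

lemma neg_coe_sub_le_iff (M r : ℝ) (x : EReal) :
    -((M : EReal) - x) ≤ (r : EReal) ↔ x ≤ ((r + M : ℝ) : EReal) := by
  induction x with
  | bot => simp
  | top => simpa using EReal.coe_ne_top (r + M)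
  | coe x => norm_cast; constructor <;> intro h <;> linarith

lemma neg_coe_sub_lt_iff (M : ℝ) (x y : EReal) :
    -((M : EReal) - x) < y ↔ x < y + (M : EReal) := by
  induction x with
  | bot =>
    induction y with
    | bot => simp
    | top => simp
    | coe y => norm_cast; simp
  | top =>
    induction y with
    | bot => simp
    | top => simp
    | coe y => norm_cast; simp
  | coe x =>
    induction y with
    | bot => norm_cast; simp
    | top => norm_cast; simpa using EReal.coe_lt_top (x - M)
    | coe y => norm_cast; constructor <;> intro h <;> linarith

lemma isPSupH_coe_sub {Ω U : Set (Fin n → ℂ)} {w : (Fin n → ℂ) → EReal} (hw : IsPSH Ω w)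
    (hU : U ⊆ Ω) (M : ℝ) (hf : ∃ z ∈ U, w z ≠ ⊥) : IsPSupH U fun z => (M : EReal) - w z := by
  refine ⟨?_, ?_, ?_, ?_⟩
  · intro z hz y hy
    have hy' := (neg_coe_sub_lt_iff M _ _).1 hy
    filter_upwards [(hw.1.mono hU) z hz _ hy'] with x hx
    exact (neg_coe_sub_lt_iff M _ _).2 hx
  · intro z hz
    have := hw.2.1 z (hU hz)
    change -((M : EReal) - w z) ≠ ⊤
    generalize w z = x at this
    induction x with
    | bot => exact bot_ne_top
    | top => exact absurd rfl this
    | coe x => exact EReal.coe_ne_top (-(M - x))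
  · obtain ⟨z, hz, h⟩ := hf
    refine ⟨z, hz, ?_⟩
    change -((M : EReal) - w z) ≠ ⊥
    generalize w z = x at h
    induction x with
    | bot => exact absurd rfl h
    | top => exact top_ne_bot
    | coe x => exact EReal.coe_ne_bot (-(M - x))
  · intro z hz v r hr hd p hp ζ hζ
    have e : ∀ ξ : ℂ, (p.eval ξ).re + M = ((p + C (M : ℂ)).eval ξ).re := fun ξ => by simp
    rw [neg_coe_sub_le_iff, e]
    refine hw.2.2.2 z (hU hz) v r hr (fun ξ hξ => hU (hd ξ hξ)) _ (fun ξ hξ => ?_) ζ hζ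
    rw [← e, ← neg_coe_sub_le_iff]
    exact hp ξ hξ

/-- Near every point of `Ω`, the polar set of a plurisubharmonic function is contained in the set
where some nonnegative plurisuperharmonic function, finite almost everywhere, is infinite. -/
lemma exists_local_potential {Ω : Set (Fin n → ℂ)} (hΩo : IsOpen Ω) (hΩc : IsConnected Ω)
    {w : (Fin n → ℂ) → EReal} (hw : IsPSH Ω w) {z₀ : Fin n → ℂ} (hz₀ : z₀ ∈ Ω) :
    ∃ r > 0, ∃ v : (Fin n → ℂ) → ℝ≥0∞, LowerSemicontinuous v ∧
      CircMean (Metric.ball z₀ (3 * r)) v ∧ (∀ z ∉ Metric.ball z₀ (3 * r), v z = 0) ∧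
      (∀ᵐ z, v z < ⊤) ∧ ∀ z ∈ Metric.ball z₀ (3 * r), w z = ⊥ → v z = ⊤ := by
  obtain ⟨z₁, hz₁, hw₁⟩ := hw.2.2.1
  obtain ⟨γ, hγ⟩ := (hΩo.isConnected_iff_isPathConnected.1 hΩc).joinedIn z₀ hz₀ z₁ hz₁
  set K := range γ with hK
  have hKc : IsCompact K := isCompact_range γ.continuous
  have hKΩ : K ⊆ Ω := by rintro _ ⟨t, rfl⟩; exact hγ t
  have h0K : z₀ ∈ K := ⟨0, γ.source⟩
  have h1K : z₁ ∈ K := ⟨1, γ.target⟩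
  obtain ⟨δ, hδ, hδΩ⟩ := hKc.exists_cthickening_subset_open hΩo hKΩ
  set U := Metric.thickening δ K with hU
  have hUc : U ⊆ Metric.cthickening δ K := Metric.thickening_subset_cthickening δ K
  have hUΩ : U ⊆ Ω := hUc.trans hδΩ
  have hKU : K ⊆ U := Metric.self_subset_thickening hδ K
  have hUo : IsOpen U := Metric.isOpen_thickening
  have hUp : IsPreconnected U := by
    refine isPreconnected_of_forall z₀ fun y hy => ?_
    obtain ⟨k, hk, hyk⟩ := Metric.mem_thickening_iff.1 hy
    refine ⟨K ∪ Metric.ball k δ, union_subset hKU fun x hx =>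
      Metric.mem_thickening_iff.2 ⟨k, hk, hx⟩, Or.inl h0K, Or.inr hyk, ?_⟩
    exact (isPreconnected_range γ.continuous).union k hk (Metric.mem_ball_self hδ)
      (convex_ball k δ).isPreconnected
  obtain ⟨x, hx, hxm⟩ := (hw.1.mono hδΩ).exists_isMaxOn (s := Metric.cthickening δ K)
    ⟨z₀, hUc (hKU h0K)⟩ hKc.cthickening
  obtain ⟨M, hM⟩ := EReal.exists_between_coe_real (hw.2.1 x (hδΩ hx)).lt_top
  have hnn : ∀ z ∈ U, 0 ≤ (M : EReal) - w z := fun z hz => by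
    rw [EReal.sub_nonneg (by simp) (by simp)]
    exact (hxm (hUc hz)).trans hM.1.le
  have htop : ∀ z, w z = ⊥ → (M : EReal) - w z = ⊤ := fun z hz => by rw [hz]; rfl
  have hsup := isPSupH_coe_sub hw hUΩ M ⟨z₁, hKU h1K, hw₁⟩
  have hlsc := lsc_toE hUo hsup hnn
  have hnull := ((polySup_toE hsup hnn).circMean hlsc).ae_lt_top hUo hUp hlsc.measurable
    (exists_toE_ne_top hsup hnn)
  obtain ⟨R, hR, hRU⟩ := Metric.isOpen_iff.1 hUo z₀ (hKU h0K)
  have e3 : 3 * (R / 3) = R := by ring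
  refine ⟨R / 3, by positivity, ?_⟩
  rw [e3]
  have hfin : ∃ z ∈ Metric.ball z₀ R, w z ≠ ⊥ := by
    by_contra! hcon
    refine (Metric.isOpen_ball.measure_pos volume (U := Metric.ball z₀ R)
      ⟨z₀, Metric.mem_ball_self hR⟩).ne' (measure_mono_null ?_ hnull)
    refine fun z hz => ⟨hRU hz, ?_⟩
    change toE U _ z = ⊤
    rw [toE, indicator_of_mem (hRU hz), htop z (hcon z hz)]
    rfl
  have hsup' := isPSupH_coe_sub hw (hRU.trans hUΩ) M hfin
  have hnn' : ∀ z ∈ Metric.ball z₀ R, 0 ≤ (M : EReal) - w z := fun z hz => hnn z (hRU hz)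
  have hlsc' := lsc_toE Metric.isOpen_ball hsup' hnn'
  refine ⟨toE (Metric.ball z₀ R) fun z => (M : EReal) - w z, hlsc',
    (polySup_toE hsup' hnn').circMean hlsc', fun z hz => indicator_of_notMem hz _, ?_,
    fun z hz hwz => ?_⟩
  · rw [ae_iff]
    refine measure_mono_null (fun z hz => ?_) hnull
    have hz' : toE (Metric.ball z₀ R) (fun z => (M : EReal) - w z) z = ⊤ := not_lt_top_iff.1 hz
    have hzB : z ∈ Metric.ball z₀ R := by
      by_contra hcon
      rw [toE, indicator_of_notMem hcon] at hz'
      exact ENNReal.zero_ne_top hz'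
    refine ⟨hRU hzB, ?_⟩
    change toE U _ z = ⊤
    rw [toE, indicator_of_mem hzB] at hz'
    rw [toE, indicator_of_mem (hRU hzB), hz']
  · rw [toE, indicator_of_mem hz, htop z hwz]
    rfl

lemma quad_le {z₀ z : Fin n → ℂ} {r : ℝ} (hr : 0 < r) (hn : 0 < n)
    (hz : z ∈ Metric.ball z₀ (r / (2 * n))) : quad (1 / r ^ 2) z₀ z ≤ 1 / 4 := by
  have hn' : (1 : ℝ) ≤ n := by exact_mod_cast hn
  rw [mem_ball_iff_norm] at hz
  have h1 : ∑ i, ‖z i - z₀ i‖ ^ 2 ≤ n * (r / (2 * n)) ^ 2 := by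
    calc ∑ i, ‖z i - z₀ i‖ ^ 2 ≤ ∑ _i : Fin n, (r / (2 * n)) ^ 2 := by
          refine Finset.sum_le_sum fun i _ => ?_
          have : ‖z i - z₀ i‖ ≤ ‖z - z₀‖ := norm_le_pi_norm (z - z₀) i
          gcongr
          linarith
      _ = _ := by simp
  calc quad (1 / r ^ 2) z₀ z ≤ 1 / r ^ 2 * (n * (r / (2 * n)) ^ 2) := by
        rw [quad]; gcongr
    _ = 1 / (4 * n) := by field_simp; ring
    _ ≤ 1 / 4 := by gcongr; linarith

/-- A plurisuperharmonic function which is large near `z₀` on the polar set `{v = ⊤}`, with an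
integral bound not depending on the lower bound. -/
lemma exists_large_potential {z₀ : Fin n → ℂ} {r R₁ : ℝ} (hn : 0 < n) (hr : 0 < r) (hrR : r ≤ R₁)
    {v : (Fin n → ℂ) → ℝ≥0∞} (hv : LowerSemicontinuous v)
    (hm : CircMean (Metric.ball z₀ (3 * r)) v)
    (h0 : ∀ z ∉ Metric.ball z₀ (3 * r), v z = 0) (hfin : ∀ᵐ z, v z < ⊤) (c : ℝ) :
    ∃ W : (Fin n → ℂ) → ℝ≥0∞, LowerSemicontinuous W ∧ PolySup (Metric.ball z₀ (3 * R₁)) W ∧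
      (∀ z ∈ Metric.ball z₀ (r / (2 * n)), v z = ⊤ → ENNReal.ofReal c ≤ W z) ∧
      ∫⁻ z in Metric.ball z₀ R₁, W z ≤ ENNReal.ofReal (Real.log (3 * R₁ / r)) *
        volume (Metric.ball (0 : Fin n → ℂ) (2 * R₁)) := by
  have hn' : (1 : ℝ) ≤ n := by exact_mod_cast hn
  have hR₁ : 0 < R₁ := hr.trans_le hrR
  set ρ := Real.log (3 * R₁ / r) with hρ
  have hq1 : 1 ≤ 3 * R₁ / r := by rw [one_le_div hr]; linarith
  have hρ0 : 0 ≤ ρ := Real.log_nonneg hq1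
  set A : ℝ := max 1 (4 * n * c) with hA
  have hA1 : 1 ≤ A := le_max_left _ _
  have hAc : 4 * n * c ≤ A := le_max_right _ _
  obtain ⟨C, hC, hdet⟩ := detL_integral_bound (c := 1 / r ^ 2) (by positivity) z₀ hr
    (show r < 2 * r by linarith)
  set κ := volume.real (euclBall n) with hκ
  have hκ0 : 0 < κ := measureReal_euclBall_pos
  set η : ℝ := κ / (4 * (109 * A) ^ n * (C + 1)) with hη
  have hη0 : 0 < η := by positivity
  have hηC : 2 * (109 * A) ^ n * (C * η) < κ := by
    have h1 : 2 * (109 * A) ^ n * ((C + 1) * η) = κ / 2 := by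
      rw [hη]; field_simp; ring
    have h2 : 2 * (109 * A) ^ n * (C * η) ≤ 2 * (109 * A) ^ n * ((C + 1) * η) := by
      gcongr; linarith
    linarith
  obtain ⟨j, hj, hgood⟩ := exists_good hv.measurable hm h0 hfin hη0
  have hex : ∀ l : ℕ, ∃ d : ℕ, 0 < d ∧ ∃ P : MvPolynomial (Fin n) ℂ, P.totalDegree ≤ n * d ∧
      (∃ z ∈ Metric.closedBall z₀ r, ‖MvPolynomial.eval z P‖ = 1) ∧
      (∀ z ∈ Metric.closedBall z₀ r, ‖MvPolynomial.eval z P‖ ≤ 1) ∧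
      ∀ z ∈ Metric.ball z₀ (r / (2 * n)), (∀ y ∈ Metric.ball z (r / (l + 1)), (j : ℝ≥0∞) ≤ v y) →
        ‖MvPolynomial.eval z P‖ ≤ Real.exp (-(A * d / 4)) := by
    intro l
    obtain ⟨φ, hφ, hinteg, hneg⟩ := hgood (r / (l + 1)) (by positivity)
      (div_le_self hr.le (by linarith [(Nat.cast_nonneg l : (0 : ℝ) ≤ l)]))
    obtain ⟨d, hd, P, hP, hP1, hP2, hP3⟩ := exists_poly hr hφ hA1 (η := C * η)
      (fun U hU hUB hUφ => (hdet φ hφ U hU hUB hUφ).trans (by gcongr)) hηC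
    refine ⟨d, hd, P, hP, hP1, hP2, fun z hz hzv => hP3 z ?_ ?_⟩
    · refine Metric.ball_subset_closedBall (Metric.ball_subset_ball ?_ hz)
      exact div_le_self hr.le (by linarith)
    · have := quad_le hr hn hz
      change φ z + quad (1 / r ^ 2) z₀ z ≤ _
      rw [hneg z hzv]
      linarith
  choose d hd P hP hP1 hP2 hP3 using hex
  have hD : ∀ l, (0 : ℝ) < ((n * d l : ℕ) : ℝ) := fun l => by
    exact_mod_cast Nat.mul_pos hn (hd l)
  set V : ℕ → (Fin n → ℂ) → ℝ≥0∞ := fun l => logV (P l) ((n * d l : ℕ) : ℝ) ρ with hV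
  have hVP : ∀ l, PolySup (Metric.ball z₀ (3 * R₁)) (V l) := fun l => by
    refine polySup_logV (hD l) fun z hz => ?_
    rw [mem_ball_iff_norm] at hz
    refine (bernstein_walsh (hP l) hr (by linarith) (hP2 l) hz.le).trans (le_of_eq ?_)
    rw [hρ, Real.exp_nat_mul, Real.exp_log (by linarith)]
  have hVl : ∀ l, LowerSemicontinuous (V l) := fun l => lsc_logV (P l) (hD l) ρ
  refine ⟨liminfReg V, lsc_liminfReg V, polySup_liminfReg Metric.isOpen_ball hVP,
    fun z hz hvz => ?_, lintegral_liminfReg_le (fun l => (hVl l).measurable) _ fun l => ?_⟩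
  · have hnear : {y | (j : ℝ≥0∞) < v y} ∈ 𝓝 z :=
      hv z _ (show (j : ℝ≥0∞) < v z by rw [hvz]; exact ENNReal.natCast_lt_top j)
    obtain ⟨δ, hδ, hδj⟩ := Metric.mem_nhds_iff.1 hnear
    obtain ⟨N, hN⟩ := exists_nat_one_div_lt (show 0 < δ / 2 / r by positivity)
    refine le_liminfReg (N := N) (U := Metric.ball z (δ / 2) ∩ Metric.ball z₀ (r / (2 * n)))
      (inter_mem (Metric.ball_mem_nhds _ (by positivity)) (Metric.isOpen_ball.mem_nhds hz))
      fun l hl y hy => le_logV (hD l) ?_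
    refine (hP3 l y hy.2 fun x hx => le_of_lt (hδj ?_)).trans (Real.exp_le_exp.2 ?_)
    · have h1 : r / ((l : ℝ) + 1) ≤ δ / 2 := by
        have hlN : (N : ℝ) ≤ l := by exact_mod_cast hl
        have h2 : 1 / ((l : ℝ) + 1) ≤ 1 / ((N : ℝ) + 1) := by gcongr
        have h3 := h2.trans hN.le
        rw [le_div_iff₀ hr] at h3
        calc r / ((l : ℝ) + 1) = 1 / ((l : ℝ) + 1) * r := by ring
          _ ≤ _ := h3
      have hx' := Metric.mem_ball.1 hx
      have hy' := Metric.mem_ball.1 hy.1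
      rw [Metric.mem_ball]
      linarith [dist_triangle x y z]
    · push_cast
      have hdl : (0 : ℝ) ≤ d l := Nat.cast_nonneg _
      nlinarith [mul_nonneg hdl (sub_nonneg.2 hAc),
        mul_nonneg (mul_nonneg (by linarith : (0:ℝ) ≤ n) hdl) hρ0]
  · obtain ⟨b, hb, hb1⟩ := hP1 l
    rw [Metric.mem_closedBall] at hb
    have hsub : Metric.ball z₀ R₁ ⊆ Metric.ball b (2 * R₁) := fun x hx => by
      rw [Metric.mem_ball] at hx ⊢
      have := dist_triangle x z₀ b
      rw [dist_comm z₀ b] at this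
      linarith
    have hsub' : Metric.ball b (2 * R₁) ⊆ Metric.ball z₀ (3 * R₁) := fun x hx => by
      rw [Metric.mem_ball] at hx ⊢
      linarith [dist_triangle x b z₀]
    calc ∫⁻ z in Metric.ball z₀ R₁, V l z ≤ ∫⁻ z in Metric.ball b (2 * R₁), V l z :=
          lintegral_mono_set hsub
      _ ≤ V l b * volume (Metric.ball b (2 * R₁)) :=
          ((hVP l).circMean (hVl l)).lintegral_ball_le (hVl l).measurable hsub'
      _ = _ := by
          rw [Measure.addHaar_ball_center]
          change logV _ _ _ _ * _ = _
          rw [logV_eq_of_norm_eq_one hb1]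

/-- A superharmonic majorant which is infinite near `z₀` on the polar set `{v = ⊤}`. -/
lemma exists_infinite_potential {z₀ : Fin n → ℂ} {r R₁ : ℝ} (hn : 0 < n) (hr : 0 < r)
    (hrR : r ≤ R₁) {v : (Fin n → ℂ) → ℝ≥0∞} (hv : LowerSemicontinuous v)
    (hm : CircMean (Metric.ball z₀ (3 * r)) v)
    (h0 : ∀ z ∉ Metric.ball z₀ (3 * r), v z = 0) (hfin : ∀ᵐ z, v z < ⊤) :
    ∃ W : (Fin n → ℂ) → ℝ≥0∞, LowerSemicontinuous W ∧ CircMean (Metric.ball z₀ (3 * R₁)) W ∧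
      (∀ z ∈ Metric.ball z₀ (r / (2 * n)), v z = ⊤ → W z = ⊤) ∧
      ∫⁻ z in Metric.ball z₀ R₁, W z ≠ ⊤ := by
  obtain ⟨a, ha, hsum⟩ := ENNReal.exists_pos_sum_of_countable (one_ne_zero (α := ℝ≥0∞)) ℕ
  choose W hW hWP hWc hWi using fun k =>
    exists_large_potential hn hr hrR hv hm h0 hfin ((a k : ℝ)⁻¹)
  refine ⟨fun z => ∑' k, (a k : ℝ≥0∞) * W k z,
    lowerSemicontinuous_tsum fun k => lsc_const_mul (hW k) ENNReal.coe_ne_top,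
    CircMean.tsum (fun k => ((hWP k).circMean (hW k)).const_mul (hW k).measurable _)
      (fun k => (hW k).measurable.const_mul _), fun z hz hvz => ?_, ?_⟩
  · refine top_le_iff.1 ?_
    calc (⊤ : ℝ≥0∞) = ∑' _k : ℕ, 1 := (ENNReal.tsum_const_eq_top_of_ne_zero one_ne_zero).symm
      _ ≤ _ := ENNReal.tsum_le_tsum fun k => ?_
    have hk := hWc k z hz hvz
    have hak : (0 : ℝ) < a k := ha k
    calc (1 : ℝ≥0∞) = a k * ENNReal.ofReal ((a k : ℝ)⁻¹) := by
          rw [ENNReal.ofReal_inv_of_pos hak, ENNReal.ofReal_coe_nnreal,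
            ENNReal.mul_inv_cancel (by exact_mod_cast (ha k).ne') ENNReal.coe_ne_top]
      _ ≤ _ := by gcongr
  · rw [lintegral_tsum fun k => ((hW k).measurable.const_mul _).aemeasurable]
    set C := ENNReal.ofReal (Real.log (3 * R₁ / r)) *
      volume (Metric.ball (0 : Fin n → ℂ) (2 * R₁)) with hC
    have hCt : C ≠ ⊤ := ENNReal.mul_ne_top ENNReal.ofReal_ne_top measure_ball_lt_top.ne
    refine ne_top_of_le_ne_top (b := 1 * C) (ENNReal.mul_ne_top ENNReal.one_ne_top hCt) ?_
    calc ∑' k, ∫⁻ z in Metric.ball z₀ R₁, (a k : ℝ≥0∞) * W k z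
        ≤ ∑' k, (a k : ℝ≥0∞) * C := ENNReal.tsum_le_tsum fun k => by
          rw [lintegral_const_mul _ (hW k).measurable]
          gcongr
          exact hWi k
      _ = (∑' k, (a k : ℝ≥0∞)) * C := ENNReal.tsum_mul_right
      _ ≤ 1 * C := by gcongr

/-- Josefson's theorem on bounded domains, in the form needed for the domination principle. -/
theorem exists_global_potential {Ω : Set (Fin n → ℂ)} (hn : 0 < n) (hΩo : IsOpen Ω)
    (hΩc : IsConnected Ω) (hΩb : Bornology.IsBounded Ω) {w : (Fin n → ℂ) → EReal}
    (hw : IsPSH Ω w) :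
    ∃ V : (Fin n → ℂ) → ℝ≥0∞, LowerSemicontinuous V ∧ CircMean Ω V ∧
      (∀ z ∈ Ω, w z = ⊥ → V z = ⊤) ∧ ∃ z ∈ Ω, V z ≠ ⊤ := by
  have hloc : ∀ z₀ ∈ Ω, ∃ e > 0, ∃ W : (Fin n → ℂ) → ℝ≥0∞, LowerSemicontinuous W ∧
      CircMean Ω W ∧ (∀ z ∈ Metric.ball z₀ e, w z = ⊥ → W z = ⊤) ∧ ∫⁻ z in Ω, W z ≠ ⊤ := by
    intro z₀ hz₀
    obtain ⟨r, hr, v, hv, hm, h0, hfin, hvw⟩ := exists_local_potential hΩo hΩc hw hz₀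
    obtain ⟨R, hR⟩ := hΩb.subset_ball z₀
    set R₁ := max r R with hR₁
    have hΩR : Ω ⊆ Metric.ball z₀ R₁ := hR.trans (Metric.ball_subset_ball (le_max_right _ _))
    have hR₁0 : 0 < R₁ := hr.trans_le (le_max_left _ _)
    obtain ⟨W, hW, hWm, hWt, hWi⟩ := exists_infinite_potential hn hr (le_max_left r R) hv hm h0 hfin
    have hn' : (1 : ℝ) ≤ n := by exact_mod_cast hn
    refine ⟨r / (2 * n), by positivity, W, hW, fun z y hd => hWm z y fun ζ hζ =>
      Metric.ball_subset_ball (by linarith) (hΩR (hd ζ hζ)),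
      fun z hz hwz => hWt z hz (hvw z ?_ hwz),
      ne_top_of_le_ne_top hWi (lintegral_mono_set hΩR)⟩
    refine Metric.ball_subset_ball ?_ hz
    exact (div_le_self hr.le (by linarith)).trans (by linarith)
  choose! e he W hW hWm hWt hWi using hloc
  obtain ⟨t, htΩ, htc, hcov⟩ := TopologicalSpace.countable_cover_nhdsWithin (s := Ω)
    (f := fun z => Metric.ball z (e z))
    fun z hz => mem_nhdsWithin_of_mem_nhds (Metric.ball_mem_nhds z (he z hz))
  have := htc.to_subtype
  obtain ⟨a, ha, hsum⟩ := ENNReal.exists_pos_tsum_mul_lt_of_countable (one_ne_zero (α := ℝ≥0∞))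
    (fun x : t => ∫⁻ z in Ω, W x z) fun x => hWi x (htΩ x.2)
  have hWx : ∀ x : t, LowerSemicontinuous (W x) := fun x => hW x (htΩ x.2)
  set V : (Fin n → ℂ) → ℝ≥0∞ := fun z => ∑' x : t, (a x : ℝ≥0∞) * W x z with hV
  have hVl : LowerSemicontinuous V :=
    lowerSemicontinuous_tsum fun x => lsc_const_mul (hWx x) ENNReal.coe_ne_top
  refine ⟨V, hVl, CircMean.tsum (fun x => (hWm x (htΩ x.2)).const_mul (hWx x).measurable _)
      (fun x => (hWx x).measurable.const_mul _), fun z hz hwz => ?_, ?_⟩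
  · obtain ⟨x, hx, hzx⟩ := mem_iUnion₂.1 (hcov hz)
    refine ENNReal.tsum_eq_top_of_eq_top ⟨⟨x, hx⟩, ?_⟩
    rw [hWt x (htΩ hx) z hzx hwz]
    exact ENNReal.mul_top (by exact_mod_cast (ha ⟨x, hx⟩).ne')
  · by_contra! hcon
    have hinteg : ∫⁻ z in Ω, V z < 1 := by
      refine lt_of_eq_of_lt ?_ hsum
      rw [lintegral_tsum fun x => ((hWx x).measurable.const_mul _).aemeasurable]
      refine tsum_congr fun x => ?_
      rw [lintegral_const_mul _ (hWx x).measurable, mul_comm]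
    have htop : ∫⁻ z in Ω, V z = ⊤ := by
      rw [setLIntegral_congr_fun hΩo.measurableSet (g := fun _ => ⊤) fun z hz => hcon z hz,
        setLIntegral_const, ENNReal.top_mul (hΩo.measure_pos volume hΩc.nonempty).ne']
    rw [htop] at hinteg
    exact not_top_lt hinteg

theorem Sop_le_of_le_off_pluripolar {Ω : Set (Fin n → ℂ)} (hΩo : IsOpen Ω)
    (hΩc : IsConnected Ω) (hΩb : Bornology.IsBounded Ω) {f g : (Fin n → ℂ) → EReal}
    {E : Set (Fin n → ℂ)} (hE : Pluripolar Ω E) (hfg : ∀ z ∈ Ω \ E, f z ≤ g z)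
    (z : Fin n → ℂ) : Sop Ω f z ≤ Sop Ω g z := by
  obtain ⟨hEΩ, w, hw, hEw⟩ := hE
  rcases Nat.eq_zero_or_pos n with rfl | hn
  · obtain ⟨x, hx, hwx⟩ := hw.2.2.1
    refine Sop_le_of_majorant hΩo hΩc hfg (V := fun _ => 0) lowerSemicontinuous_const
      (fun _ _ _ => by simp) (fun y hy => absurd (hEw y hy) ?_) ⟨x, hx, ENNReal.zero_ne_top⟩ z
    rwa [Subsingleton.elim y x]
  · obtain ⟨V, hV, hVm, hVE, hVf⟩ := exists_global_potential hn hΩo hΩc hΩb hw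
    exact Sop_le_of_majorant hΩo hΩc hfg hV hVm (fun y hy => hVE y (hEΩ hy) (hEw y hy)) hVf z

end PshTools

end

/-- Lemma 2.2: for a bounded domain `Ω ⊆ ℂⁿ` and `f, g ∈ ℳ`, if `f ≤ g`
outside a pluripolar subset of `Ω`, then `S f ≤ S g` everywhere on `Ω`; in particular, if
`f = g` outside a pluripolar set, then `S f ≡ S g` on `Ω`. -/
theorem statement3 {n : ℕ} (Ω : Set (Fin n → ℂ))
    (hΩo : IsOpen Ω) (hΩc : IsConnected Ω) (hΩb : Bornology.IsBounded Ω)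
    (f g : (Fin n → ℂ) → EReal) (hf : MemM Ω f) (hg : MemM Ω g) :
    (∀ E : Set (Fin n → ℂ), Pluripolar Ω E → (∀ z ∈ Ω \ E, f z ≤ g z) →
      ∀ z ∈ Ω, Sop Ω f z ≤ Sop Ω g z) ∧
    (∀ E : Set (Fin n → ℂ), Pluripolar Ω E → (∀ z ∈ Ω \ E, f z = g z) →
      ∀ z ∈ Ω, Sop Ω f z = Sop Ω g z) := by
  refine ⟨fun E hE h z _ => PshTools.Sop_le_of_le_off_pluripolar hΩo hΩc hΩb hE h z,
    fun E hE h z _ => le_antisymm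
      (PshTools.Sop_le_of_le_off_pluripolar hΩo hΩc hΩb hE (fun y hy => (h y hy).le) z)
      (PshTools.Sop_le_of_le_off_pluripolar hΩo hΩc hΩb hE (fun y hy => (h y hy).ge) z)⟩
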